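/- arXiv:1412.1413 — 5 statements merged into one kernel-verified Lean document; each statement's English description precedes it below -/
import Mathlib

section
/- Under hypotheses (H1) and (H2), there exists an analytic map Φ : Ω → A such that for every b ∈ Ω and every t ≥ 0, the map s ↦ f_s(b) is differentiable at t with derivative (d/dt) f_t(b) = −Φ(f_t(b)). -/
open Filter Metric Set Topology

theorem aux_cauchy {E F : Type*} [NormedAddCommGroup E] [NormedSpace ℂ E]
    [NormedAddCommGroup F] [NormedSpace ℂ F] [CompleteSpace F] (G : E → F) {M ε : ℝ} (hε : 0 < ε)
    (n : ℕ) : ∀ (x : E) (R : ℝ), n * ε ≤ R → 0 < R → AnalyticOnNhd ℂ G (ball x R) →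
      (∀ y ∈ ball x R, ‖G y‖ ≤ M) → ‖iteratedFDeriv ℂ n G x‖ ≤ M * (2 / ε) ^ n := by
  induction n with
  | zero =>
    intro x R _ hR _ hM
    simpa using hM x (mem_ball_self hR)
  | succ n ih =>
    intro x R hn hR hG hM
    push_cast at hn
    have key : ∀ x' ∈ ball x ε, ‖iteratedFDeriv ℂ n G x'‖ ≤ M * (2 / ε) ^ n := by
      intro x' hx'
      have hx'' := mem_ball.1 hx'
      have hd0 : 0 ≤ dist x' x := dist_nonneg
      have hR' : 0 < R - dist x' x := by
        have : 0 ≤ (n:ℝ) * ε := by positivity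
        linarith
      have hsub : ball x' (R - dist x' x) ⊆ ball x R := ball_subset_ball' (by linarith)
      exact ih x' (R - dist x' x) (by linarith) hR' (hG.mono hsub) (fun y hy => hM y (hsub hy))
    rw [← norm_fderiv_iteratedFDeriv]
    have hsub : ball x ε ⊆ ball x R := ball_subset_ball (by
        have : 0 ≤ (n:ℝ) * ε := by positivity
        linarith)
    have hd : DifferentiableOn ℂ (iteratedFDeriv ℂ n G) (ball x ε) :=
      ((hG.mono hsub).iteratedFDeriv n).differentiableOn
    have := Complex.norm_fderiv_le_div_of_mapsTo_ball (R₂ := 2 * (M * (2 / ε) ^ n)) hd ?_ hε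
    · refine this.trans (le_of_eq ?_)
      rw [pow_succ]; ring
    · intro y hy
      rw [mem_closedBall, dist_eq_norm]
      refine (norm_sub_le _ _).trans ?_
      have := key y hy
      have := key x (mem_ball_self hε)
      linarith

theorem aux_coeff {E F : Type*} [NormedAddCommGroup E] [NormedSpace ℂ E]
    [NormedAddCommGroup F] [NormedSpace ℂ F] [CompleteSpace F] (G : E → F) {M R : ℝ} {x : E}
    (hR : 0 < R) (hG : AnalyticOnNhd ℂ G (ball x R)) (hM : ∀ y ∈ ball x R, ‖G y‖ ≤ M) (n : ℕ) :
    ‖((n.factorial : ℂ)⁻¹) • iteratedFDeriv ℂ n G x‖ ≤ M * (2 * Real.exp 1 / R) ^ n := by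
  have hM0 : 0 ≤ M := (norm_nonneg _).trans (hM x (mem_ball_self hR))
  rcases Nat.eq_zero_or_pos n with rfl | hn
  · simpa using hM x (mem_ball_self hR)
  have hn' : (0:ℝ) < n := by exact_mod_cast hn
  have h1 := aux_cauchy G (M := M) (ε := R / n) (by positivity) n x R
    (le_of_eq (by field_simp)) hR hG hM
  have h2 := Real.pow_div_factorial_le_exp (x := n) hn'.le n
  have hfac : (0:ℝ) < n.factorial := by positivity
  rw [norm_smul, norm_inv, Complex.norm_natCast]
  calc (n.factorial : ℝ)⁻¹ * ‖iteratedFDeriv ℂ n G x‖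
      ≤ (n.factorial : ℝ)⁻¹ * (M * (2 / (R / n)) ^ n) := by gcongr
    _ = M * (2 / R) ^ n * ((n:ℝ) ^ n / n.factorial) := by
        rw [show 2 / (R / (n:ℝ)) = 2 / R * n by field_simp, mul_pow]; ring
    _ ≤ M * (2 / R) ^ n * Real.exp n := by gcongr
    _ = M * (2 * Real.exp 1 / R) ^ n := by
        rw [show Real.exp n = Real.exp 1 ^ n by rw [← Real.exp_nat_mul]; simp, mul_assoc,
          ← mul_pow]; ring

theorem aux_line {E F : Type*} [NormedAddCommGroup E] [NormedSpace ℂ E]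
    [NormedAddCommGroup F] [NormedSpace ℂ F] [CompleteSpace F] (G : E → F) {R : ℝ} {x : E}
    (hG : AnalyticOnNhd ℂ G (ball x R)) (y : E) (n : ℕ) :
    ∀ z : ℂ, x + z • y ∈ ball x R →
      iteratedDeriv n (fun z : ℂ => G (x + z • y)) z
        = iteratedFDeriv ℂ n G (x + z • y) (fun _ => y) := by
  induction n with
  | zero => intro z hz; simp
  | succ n ih =>
    intro z hz
    have hc : Continuous (fun z : ℂ => x + z • y) := by fun_prop
    have hev : ∀ᶠ w in 𝓝 z, x + w • y ∈ ball x R :=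
      hc.continuousAt.eventually (isOpen_ball.mem_nhds hz)
    rw [iteratedDeriv_succ]
    have he : iteratedDeriv n (fun z : ℂ => G (x + z • y)) =ᶠ[𝓝 z]
        fun w => iteratedFDeriv ℂ n G (x + w • y) (fun _ => y) := by
      filter_upwards [hev] with w hw using ih w hw
    rw [he.deriv_eq, iteratedFDeriv_succ_apply_left]
    have h1 : HasDerivAt (fun z : ℂ => x + z • y) y z := by
      simpa using ((hasDerivAt_id z).smul_const y).const_add x
    have h2 : HasFDerivAt (iteratedFDeriv ℂ n G) (fderiv ℂ (iteratedFDeriv ℂ n G) (x + z • y))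
        (x + z • y) := ((hG.iteratedFDeriv n) _ hz).differentiableAt.hasFDerivAt
    have h3 := h2.comp_hasDerivAt z h1
    have h4 := ((ContinuousMultilinearMap.apply ℂ (fun _ : Fin n => E) F
      (fun _ => y)).hasFDerivAt).comp_hasDerivAt z h3
    exact h4.deriv

theorem aux_taylor {E F : Type*} [NormedAddCommGroup E] [NormedSpace ℂ E]
    [NormedAddCommGroup F] [NormedSpace ℂ F] [CompleteSpace F] (G : E → F) {R : ℝ} {x : E}
    (hG : AnalyticOnNhd ℂ G (ball x R)) (y : E) (hy : 2 * ‖y‖ < R) :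
    HasSum (fun n : ℕ => (((n.factorial : ℂ)⁻¹) • iteratedFDeriv ℂ n G x) (fun _ => y))
      (G (x + y)) := by
  have hmem : ∀ z ∈ ball (0:ℂ) 2, x + z • y ∈ ball x R := by
    intro z hz
    rw [mem_ball_zero_iff] at hz
    simp only [mem_ball, dist_self_add_left, norm_smul]
    nlinarith [norm_nonneg y]
  have hd : DifferentiableOn ℂ (fun z : ℂ => G (x + z • y)) (ball 0 2) := by
    refine hG.differentiableOn.comp (by fun_prop) hmem
  have := Complex.hasSum_taylorSeries_on_ball hd (z := 1) (by simp)
  simp only [sub_zero, one_pow, one_smul] at this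
  convert this using 2 with n
  rw [aux_line G hG y n 0 (hmem 0 (by simp))]
  simp

theorem aux_integral {E F : Type*} [NormedAddCommGroup E] [NormedSpace ℂ E]
    [NormedAddCommGroup F] [NormedSpace ℂ F] [CompleteSpace F] (g : ℝ → E → F) {R M h : ℝ} {x : E}
    (hh : 0 ≤ h)
    (hR : 0 < R) (hg : ∀ s, AnalyticOnNhd ℂ (g s) (ball x R))
    (hM : ∀ s ∈ Icc 0 h, ∀ y ∈ ball x R, ‖g s y‖ ≤ M)
    (hcont : ∀ s₀ ∈ Icc 0 h, ∀ ε > 0, ∃ η > 0, ∀ s ∈ Icc 0 h, |s - s₀| < η →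
      ∀ y ∈ ball x R, ‖g s y - g s₀ y‖ ≤ ε) :
    AnalyticAt ℂ (fun y => ∫ s in (0:ℝ)..h, g s y) x := by
  have hM0 : 0 ≤ M := (norm_nonneg _).trans (hM 0 ⟨le_rfl, hh⟩ x (mem_ball_self hR))
  set K : ℝ := 2 * Real.exp 1 / R with hK
  have hKpos : 0 < K := by positivity
  set p : ℝ → (n : ℕ) → ContinuousMultilinearMap ℂ (fun _ : Fin n => E) F :=
    fun s n => ((n.factorial : ℂ)⁻¹) • iteratedFDeriv ℂ n (g s) x with hp
  have hpb : ∀ s ∈ Icc 0 h, ∀ n, ‖p s n‖ ≤ M * K ^ n := fun s hs n =>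
    aux_coeff (g s) hR (hg s) (hM s hs) n
  have hpc : ∀ n, ContinuousOn (fun s => p s n) (Icc 0 h) := by
    intro n s₀ hs₀
    rw [Metric.continuousWithinAt_iff]
    intro ε hε
    obtain ⟨η, hη, H⟩ := hcont s₀ hs₀ (ε / (2 * K ^ n)) (by positivity)
    refine ⟨η, hη, fun s hs hd => ?_⟩
    have h1 := aux_coeff (fun y => g s y - g s₀ y) hR ((hg s).sub (hg s₀))
      (H s hs (by simpa [Real.dist_eq] using hd)) n
    have hsub : iteratedFDeriv ℂ n (fun y => g s y - g s₀ y) x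
        = iteratedFDeriv ℂ n (g s) x - iteratedFDeriv ℂ n (g s₀) x := by
      have a := (hg s x (mem_ball_self hR)).contDiffAt (n := n)
      have b := (hg s₀ x (mem_ball_self hR)).contDiffAt (n := n)
      exact iteratedFDeriv_sub_apply a b
    rw [hsub, smul_sub] at h1
    rw [dist_eq_norm]
    refine lt_of_le_of_lt h1 ?_
    rw [← hK]
    have : ε / (2 * K ^ n) * K ^ n = ε / 2 := by field_simp
    rw [this]; linarith
  have hint : ∀ n, IntervalIntegrable (fun s => p s n) MeasureTheory.volume 0 h := by
    intro n
    apply ContinuousOn.intervalIntegrable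
    rw [uIcc_of_le hh]; exact hpc n
  set P : FormalMultilinearSeries ℂ E F := fun n => ∫ s in (0:ℝ)..h, p s n with hP
  set r : ℝ := min (1 / (2 * K)) (R / 4) with hr
  have hrpos : 0 < r := by positivity
  have hrK : r * K ≤ 1 / 2 := by
    have : r ≤ 1 / (2 * K) := min_le_left _ _
    calc r * K ≤ 1 / (2 * K) * K := by gcongr
      _ = 1 / 2 := by field_simp
  have hPb : ∀ n, ‖P n‖ ≤ M * K ^ n * h := by
    intro n
    have := intervalIntegral.norm_integral_le_of_norm_le_const (a := 0) (b := h)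
      (f := fun s => p s n) (C := M * K ^ n) (fun s hs => hpb s (by
        rw [uIoc_of_le hh] at hs; exact Ioc_subset_Icc_self hs) n)
    simpa [abs_of_nonneg hh] using this
  refine ⟨P, ENNReal.ofReal r, ?_, ?_, ?_⟩
  · refine P.le_radius_of_bound (M * h) (r := r.toNNReal) fun n => ?_
    rw [Real.coe_toNNReal _ hrpos.le]
    calc ‖P n‖ * r ^ n ≤ M * K ^ n * h * r ^ n := by gcongr; exact hPb n
      _ = M * h * (r * K) ^ n := by rw [mul_pow]; ring
      _ ≤ M * h * 1 := by
        gcongr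
        exact pow_le_one₀ (by positivity) (by linarith)
      _ = M * h := by ring
  · simpa using hrpos
  · intro y hy
    rw [Metric.eball_ofReal, mem_ball_zero_iff] at hy
    have happ : ∀ n, P n (fun _ => y) = ∫ s in (0:ℝ)..h, p s n (fun _ => y) := by
      intro n
      exact ((ContinuousMultilinearMap.apply ℂ (fun _ : Fin n => E) F
        (fun _ => y)).intervalIntegral_comp_comm (hint n)).symm
    simp_rw [happ]
    have hys : 2 * ‖y‖ < R := by
      have : r ≤ R / 4 := min_le_right _ _
      linarith
    refine intervalIntegral.hasSum_integral_of_dominated_convergence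
      (fun n _ => M * (1 / 2) ^ n) ?_ ?_ ?_ ?_ ?_
    · intro n
      have : ContinuousOn (fun s => p s n (fun _ => y)) (Icc 0 h) :=
        (ContinuousMultilinearMap.apply ℂ (fun _ : Fin n => E) F
          (fun _ => y)).continuous.comp_continuousOn (hpc n)
      have h2 : IntervalIntegrable (fun s => p s n (fun _ => y)) MeasureTheory.volume 0 h := by
        apply ContinuousOn.intervalIntegrable
        rw [uIcc_of_le hh]; exact this
      exact h2.aestronglyMeasurable_restrict_uIoc
    · intro n
      refine Eventually.of_forall fun s hs => ?_
      rw [uIoc_of_le hh] at hs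
      have h1 := hpb s (Ioc_subset_Icc_self hs) n
      calc ‖p s n (fun _ => y)‖ ≤ ‖p s n‖ * ∏ _i : Fin n, ‖y‖ := (p s n).le_opNorm _
        _ = ‖p s n‖ * ‖y‖ ^ n := by simp
        _ ≤ M * K ^ n * r ^ n := by gcongr
        _ = M * (r * K) ^ n := by rw [mul_pow]; ring
        _ ≤ M * (1 / 2) ^ n := by gcongr
    · refine Eventually.of_forall fun s hs => ?_
      exact (summable_geometric_of_lt_one (by norm_num) (by norm_num)).mul_left M
    · exact intervalIntegrable_const
    · refine Eventually.of_forall fun s hs => ?_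
      exact aux_taylor (g s) (hg s) y hys

theorem aux_equicont {A : Type*} [NormedAddCommGroup A] [NormedSpace ℂ A]
    (Ω : Set A) (f : ℝ → A → A)
    (hf0 : ∀ b ∈ Ω, f 0 b = b)
    (hsemi : ∀ s t : ℝ, 0 ≤ s → 0 ≤ t → ∀ b ∈ Ω, f (s + t) b = f s (f t b))
    (hanal : ∀ t : ℝ, 0 ≤ t → AnalyticOnNhd ℂ (f t) Ω)
    (hloc : ∀ b' ∈ Ω, ∃ δ > 0, ball b' δ ⊆ Ω ∧
      TendstoUniformlyOn (fun t b => f t b) id (𝓝[>] (0:ℝ)) (ball b' δ) ∧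
      ∀ T > 0, ∃ C, ∀ t ∈ Icc (0:ℝ) T, ∀ b ∈ ball b' δ, ‖f t b - b‖ ≤ C)
    (c : A) (hc : c ∈ Ω) :
    ∃ r > 0, ball c r ⊆ Ω ∧ ∀ T > 0,
      (∃ M, ∀ s ∈ Icc 0 T, ∀ x ∈ ball c r, ‖f s x‖ ≤ M) ∧
      ∀ ε > 0, ∃ η > 0, ∀ s ∈ Icc 0 T, ∀ t ∈ Icc 0 T, |s - t| < η →
        ∀ x ∈ ball c r, ‖f s x - f t x‖ ≤ ε := by
  obtain ⟨δ, hδ, hsub, hunif, hbd⟩ := hloc c hc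
  have hhalf : ball c (δ / 2) ⊆ ball c δ := ball_subset_ball (by linarith)
  refine ⟨δ / 2, by positivity, hhalf.trans hsub, fun T hT => ?_⟩
  obtain ⟨C, hC⟩ := hbd T hT
  have hM : ∀ s ∈ Icc 0 T, ∀ x ∈ ball c δ, ‖f s x‖ ≤ C + (‖c‖ + δ) := by
    intro s hs x hx
    have h1 := hC s hs x hx
    have h2 : ‖f s x‖ ≤ ‖f s x - x‖ + ‖x‖ := by simpa using norm_add_le (f s x - x) x
    have h3 : ‖x‖ ≤ ‖x - c‖ + ‖c‖ := by simpa using norm_add_le (x - c) c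
    have h4 : ‖x - c‖ < δ := by simpa [dist_eq_norm] using hx
    linarith
  refine ⟨⟨_, fun s hs x hx => hM s hs x (hhalf hx)⟩, fun ε hε => ?_⟩
  set M : ℝ := C + (‖c‖ + δ) with hMdef
  have hM0 : 0 ≤ M := (norm_nonneg _).trans (hM 0 ⟨le_rfl, hT.le⟩ c (mem_ball_self hδ))
  set L : ℝ := 2 * M / (δ / 2) with hL
  have hL0 : 0 ≤ L := by positivity
  have hlip : ∀ s ∈ Icc 0 T, ∀ x ∈ ball c (δ / 2), ∀ z ∈ ball x (δ / 2),
      ‖f s z - f s x‖ ≤ L * ‖z - x‖ := by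
    intro s hs x hx z hz
    have hss : ball x (δ / 2) ⊆ ball c δ := ball_subset_ball' (by
      have := mem_ball.1 hx; linarith)
    have := Complex.dist_le_div_mul_dist_of_mapsTo_ball (R₂ := 2 * M)
      ((hanal s hs.1).mono (hss.trans hsub)).differentiableOn ?_ hz
    · simpa [dist_eq_norm] using this
    · intro w hw
      rw [mem_closedBall, dist_eq_norm]
      refine (norm_sub_le _ _).trans ?_
      have := hM s hs w (hss hw)
      have := hM s hs x (hhalf hx)
      linarith
  rw [Metric.tendstoUniformlyOn_iff] at hunif
  obtain ⟨η, hη, H⟩ := Metric.eventually_nhds_iff.1 (eventually_nhdsWithin_iff.1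
    (hunif (min (δ / 2) (ε / (L + 1))) (by positivity)))
  have main : ∀ s ∈ Icc 0 T, ∀ t ∈ Icc 0 T, |s - t| < η → s ≤ t →
        ∀ x ∈ ball c (δ / 2), ‖f t x - f s x‖ ≤ ε := by
    intro s hs t ht hst hle x hx
    rcases hle.eq_or_lt with rfl | hlt
    · simp [hε.le]
    have hd := H (y := t - s) (by
      rw [abs_sub_comm] at hst; simpa [Real.dist_eq] using hst) (by simpa using hlt) x (hhalf hx)
    simp only [id] at hd
    have hxΩ := hsub (hhalf hx)
    have he : f t x = f s (f (t - s) x) := by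
      rw [← hsemi s (t - s) hs.1 (by linarith) x hxΩ]; congr 1; ring
    rw [he]
    rw [dist_comm] at hd
    have h1 := hlip s hs x hx (f (t - s) x) (lt_of_lt_of_le hd (min_le_left _ _))
    have h2 : ‖f (t - s) x - x‖ ≤ ε / (L + 1) := by
      rw [← dist_eq_norm]; exact hd.le.trans (min_le_right _ _)
    calc _ ≤ L * ‖f (t - s) x - x‖ := h1
      _ ≤ (L + 1) * (ε / (L + 1)) := by gcongr; linarith
      _ = ε := by field_simp
  refine ⟨η, hη, fun s hs t ht hst x hx => ?_⟩
  rcases le_total s t with h | h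
  · rw [norm_sub_rev]; exact main s hs t ht hst h x hx
  · exact main t ht s hs (by rwa [abs_sub_comm]) h x hx

theorem aux_local {A : Type*} [NormedAddCommGroup A] [NormedSpace ℂ A] [CompleteSpace A]
    (Ω : Set A) (f : ℝ → A → A)
    (hf0 : ∀ b ∈ Ω, f 0 b = b)
    (hmaps : ∀ t : ℝ, 0 ≤ t → Set.MapsTo (f t) Ω Ω)
    (hsemi : ∀ s t : ℝ, 0 ≤ s → 0 ≤ t → ∀ b ∈ Ω, f (s + t) b = f s (f t b))
    (hanal : ∀ t : ℝ, 0 ≤ t → AnalyticOnNhd ℂ (f t) Ω)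
    (hφ : ∀ b ∈ Ω, Continuous (fun u => f (max u 0) b))
    (heq : ∀ c ∈ Ω, ∃ r > 0, ball c r ⊆ Ω ∧ ∀ T > 0,
      (∃ M, ∀ s ∈ Icc 0 T, ∀ x ∈ ball c r, ‖f s x‖ ≤ M) ∧
      ∀ ε > 0, ∃ η > 0, ∀ s ∈ Icc 0 T, ∀ t ∈ Icc 0 T, |s - t| < η →
        ∀ x ∈ ball c r, ‖f s x - f t x‖ ≤ ε)
    (c : A) (hc : c ∈ Ω) :
    ∃ U ∈ 𝓝 c, U ⊆ Ω ∧ ∃ Ψ : A → A, AnalyticAt ℂ Ψ c ∧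
      ∀ b ∈ Ω, ∀ t : ℝ, 0 ≤ t → f t b ∈ U →
        HasDerivWithinAt (fun s => f s b) (Ψ (f t b)) (Ici 0) t := by
  obtain ⟨r, hr, hsub, H⟩ := heq c hc
  obtain ⟨⟨M, hM⟩, hec⟩ := H 1 one_pos
  obtain ⟨η, hη, hsmall⟩ := hec (r / 8) (by positivity)
  set h : ℝ := min 1 (η / 2) with hh
  have hpos : 0 < h := by positivity
  have hh1 : h ≤ 1 := min_le_left _ _
  have hhη : h < η := lt_of_le_of_lt (min_le_right _ _) (by linarith)
  have hIcc : Icc 0 h ⊆ Icc 0 (1:ℝ) := Icc_subset_Icc_right hh1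
  set J : A → A := fun y => ∫ s in (0:ℝ)..h, f (max s 0) y with hJ
  set Fh : A → A := fun y => (h⁻¹ : ℂ) • J y with hFh
  have hJan : AnalyticOnNhd ℂ J (ball c r) := by
    intro x hx
    have hx' := mem_ball.1 hx
    have hs2 : ball x (r - dist x c) ⊆ ball c r := ball_subset_ball' (by linarith)
    refine aux_integral (fun s => f (max s 0)) hpos.le (R := r - dist x c) (M := M)
      (by linarith) (fun s => (hanal _ (le_max_right _ _)).mono (hs2.trans hsub)) ?_ ?_
    · intro s hs y hy
      simp only [max_eq_left hs.1]
      exact hM s (hIcc hs) y (hs2 hy)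
    · intro s₀ hs₀ ε hε
      obtain ⟨η', hη', h'⟩ := hec ε hε
      refine ⟨η', hη', fun s hs hd y hy => ?_⟩
      simp only [max_eq_left hs.1, max_eq_left hs₀.1]
      exact h' s (hIcc hs) s₀ (hIcc hs₀) hd y (hs2 hy)
  have hFan : AnalyticOnNhd ℂ Fh (ball c r) := fun x hx => (hJan x hx).const_smul
  have hclose : ∀ x ∈ ball c r, ‖Fh x - x‖ ≤ r / 8 := by
    intro x hx
    have hint : IntervalIntegrable (fun s => f (max s 0) x) MeasureTheory.volume 0 h :=
      (hφ x (hsub hx)).intervalIntegrable _ _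
    have h1 : J x - h • x = ∫ s in (0:ℝ)..h, (f (max s 0) x - x) := by
      rw [intervalIntegral.integral_sub hint intervalIntegrable_const]
      simp [hJ]
    have h2 : ‖J x - h • x‖ ≤ r / 8 * h := by
      rw [h1]
      have := intervalIntegral.norm_integral_le_of_norm_le_const (a := 0) (b := h)
        (f := fun s => f (max s 0) x - x) (C := r / 8) (fun s hs => by
          rw [uIoc_of_le hpos.le] at hs
          have hs' := hIcc (Ioc_subset_Icc_self hs)
          have := hsmall s hs' 0 ⟨le_rfl, zero_le_one⟩ (by
            rw [sub_zero, abs_of_pos hs.1]; exact lt_of_le_of_lt hs.2 hhη) x hx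
          rw [hf0 x (hsub hx)] at this
          simpa only [max_eq_left hs.1.le] using this)
      simpa [abs_of_pos hpos] using this
    have h3 : Fh x - x = (h⁻¹ : ℂ) • (J x - h • x) := by
      have hne : (h : ℂ) ≠ 0 := by exact_mod_cast hpos.ne'
      rw [smul_sub, ← Complex.coe_smul h x, smul_smul, inv_mul_cancel₀ hne, one_smul]
    rw [h3, norm_smul, norm_inv, Complex.norm_real, Real.norm_of_nonneg hpos.le]
    calc h⁻¹ * ‖J x - h • x‖ ≤ h⁻¹ * (r / 8 * h) := by gcongr
      _ = r / 8 := by field_simp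
  have hunit : ∀ x ∈ ball c (r / 2), IsUnit (fderiv ℂ Fh x) := by
    intro x hx
    have hs2 : ball x (r / 2) ⊆ ball c r := ball_subset_ball' (by
      have := mem_ball.1 hx; linarith)
    have hxr : x ∈ ball c r := hs2 (mem_ball_self (by positivity))
    have hd : DifferentiableOn ℂ (fun y => y - Fh y) (ball x (r / 2)) :=
      differentiableOn_id.sub (hFan.mono hs2).differentiableOn
    have h1 := Complex.norm_fderiv_le_div_of_mapsTo_ball (R₂ := r / 4) hd (by
      intro y hy
      rw [mem_closedBall, dist_eq_norm]
      refine (norm_sub_le _ _).trans ?_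
      have a := hclose y (hs2 hy)
      have b := hclose x hxr
      rw [norm_sub_rev] at a b
      linarith) (by positivity)
    have h2 : fderiv ℂ (fun y => y - Fh y) x = 1 - fderiv ℂ Fh x := by
      rw [fderiv_fun_sub (f := fun y => y) differentiableAt_id (hFan x hxr).differentiableAt]
      simp [ContinuousLinearMap.one_def]
    rw [h2] at h1
    have h3 : r / 4 / (r / 2) = 1 / 2 := by field_simp; norm_num
    rw [h3] at h1
    have := isUnit_one_sub_of_norm_lt_one (lt_of_le_of_lt h1 (by norm_num))
    simpa using this
  refine ⟨ball c (r / 2), ball_mem_nhds _ (by positivity),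
    (ball_subset_ball (by linarith)).trans hsub,
    fun x => (Ring.inverse (fderiv ℂ Fh x)) ((h⁻¹ : ℂ) • (f h x - x)), ?_, ?_⟩
  · have hcr : c ∈ ball c r := mem_ball_self hr
    have hcr2 : c ∈ ball c (r / 2) := mem_ball_self (by positivity)
    obtain ⟨u, hu⟩ := hunit c hcr2
    have a1 : AnalyticAt ℂ (fderiv ℂ Fh) c := (hFan c hcr).fderiv
    have a2 : AnalyticAt ℂ (fun x => Ring.inverse (fderiv ℂ Fh x)) c := by
      have := analyticAt_inverse (𝕜 := ℂ) u
      rw [hu] at this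
      exact this.comp a1
    have a3 : AnalyticAt ℂ (fun x => (h⁻¹ : ℂ) • (f h x - x)) c :=
      ((hanal h hpos.le c hc).sub analyticAt_id).const_smul
    have a4 := (ContinuousLinearMap.id ℂ (A →L[ℂ] A)).analyticAt_bilinear
      (Ring.inverse (fderiv ℂ Fh c), (h⁻¹ : ℂ) • (f h c - c))
    exact AnalyticAt.comp (f := fun x => (Ring.inverse (fderiv ℂ Fh x), (h⁻¹ : ℂ) • (f h x - x)))
      a4 (a2.prod a3)
  · intro b hb t ht hmem
    set x := f t b with hx
    have hxr : x ∈ ball c r := ball_subset_ball (by linarith) hmem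
    obtain ⟨u, hu⟩ := hunit x hmem
    let e : A ≃L[ℂ] A := ContinuousLinearEquiv.unitsEquiv ℂ A u
    have hstr : HasStrictFDerivAt Fh (e : A →L[ℂ] A) x := by
      have := (hFan x hxr).hasStrictFDerivAt
      rw [← hu] at this
      exact this
    set φ : ℝ → A := fun u => f (max u 0) b with hφdef
    have hφc : Continuous φ := hφ b hb
    have hcomp : ∀ s, 0 ≤ s → Fh (f s b) = (h⁻¹ : ℂ) • ∫ v in s..(s + h), φ v := by
      intro s hs
      simp only [hFh, hJ]
      congr 1
      have : ∫ v in s..(s + h), φ v = ∫ v in (0:ℝ)..h, φ (v + s) := by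
        rw [intervalIntegral.integral_comp_add_right]; simp [add_comm]
      rw [this]
      apply intervalIntegral.integral_congr
      intro v hv
      rw [uIcc_of_le hpos.le] at hv
      simp only [hφdef, max_eq_left hv.1, max_eq_left (add_nonneg hv.1 hs)]
      exact (hsemi v s hv.1 hs b hb).symm
    have hI : ∀ s, HasDerivAt (fun s => ∫ v in (0:ℝ)..s, φ v) (φ s) s := fun s =>
      intervalIntegral.integral_hasDerivAt_right (hφc.intervalIntegrable _ _)
        (hφc.stronglyMeasurableAtFilter _ _) hφc.continuousAt
    have hD : HasDerivAt (fun s => (h⁻¹ : ℂ) • ∫ v in s..(s + h), φ v)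
        ((h⁻¹ : ℂ) • (φ (t + h) - φ t)) t := by
      have h1 : HasDerivAt (fun s => (∫ v in (0:ℝ)..(s + h), φ v) - ∫ v in (0:ℝ)..s, φ v)
          (φ (t + h) - φ t) t := by
        exact ((hI (t + h)).comp_add_const t h).sub (hI t)
      have h2 : (fun s => ∫ v in s..(s + h), φ v)
          = fun s => (∫ v in (0:ℝ)..(s + h), φ v) - ∫ v in (0:ℝ)..s, φ v := by
        funext s
        rw [intervalIntegral.integral_interval_sub_left (hφc.intervalIntegrable _ _)
          (hφc.intervalIntegrable _ _)]
      rw [← h2] at h1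
      exact h1.const_smul (h⁻¹ : ℂ)
    have hval : φ (t + h) - φ t = f h x - x := by
      simp only [hφdef, max_eq_left ht, max_eq_left (add_nonneg ht hpos.le)]
      rw [add_comm t h, hsemi h t hpos.le ht b hb]
    rw [hval] at hD
    have hD2 : HasDerivWithinAt (fun s => Fh (f s b)) ((h⁻¹ : ℂ) • (f h x - x)) (Ici 0) t :=
      hD.hasDerivWithinAt.congr (fun s hs => hcomp s hs) (hcomp t ht)
    have hinv := (hstr.to_localInverse.hasFDerivAt.restrictScalars ℝ)
    have hD3 := hinv.comp_hasDerivWithinAt t hD2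
    have hct : Tendsto (fun s => f s b) (𝓝[Ici 0] t) (𝓝 x) := by
      have h1 : Tendsto φ (𝓝[Ici 0] t) (𝓝 x) := by
        have := hφc.continuousAt (x := t)
        have h2 : φ t = x := by simp only [hφdef, max_eq_left ht, hx]
        rw [ContinuousAt, h2] at this
        exact this.mono_left nhdsWithin_le_nhds
      refine h1.congr' ?_
      filter_upwards [self_mem_nhdsWithin] with s hs
      simp only [hφdef, max_eq_left (mem_Ici.1 hs)]
    have hev := hct.eventually hstr.eventually_left_inverse
    have hfin : Ring.inverse (fderiv ℂ Fh x) ((h⁻¹ : ℂ) • (f h x - x))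
        = (e.symm : A →L[ℂ] A) ((h⁻¹ : ℂ) • (f h x - x)) := by
      rw [← hu, Ring.inverse_unit]
      rfl
    beta_reduce
    rw [hfin]
    refine hD3.congr_of_eventuallyEq ?_ ?_
    · filter_upwards [hev] with s hs
      exact hs.symm
    · exact hstr.localInverse_apply_image.symm

/-- (Proposition `differentiate0`.) Let `A` be a complex Banach space, `Ω ⊆ A` open,
and `(f_t)_{t ≥ 0}` a composition semigroup of analytic self-maps of `Ω` satisfying
(H1) local uniform convergence `f_t → id` as `t ↓ 0`, and
(H2) local uniform boundedness of `f_t - id` for `t` in compact intervals.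
Then there is an analytic map `Φ : Ω → A` with `(d/dt) f_t(b) = -Φ(f_t(b))`. -/
theorem semigroup_generator_exists
    {A : Type*} [NormedAddCommGroup A] [NormedSpace ℂ A] [CompleteSpace A]
    (Ω : Set A) (hΩ : IsOpen Ω)
    (f : ℝ → A → A)
    (hf0 : ∀ b ∈ Ω, f 0 b = b)
    (hmaps : ∀ t : ℝ, 0 ≤ t → Set.MapsTo (f t) Ω Ω)
    (hsemi : ∀ s t : ℝ, 0 ≤ s → 0 ≤ t → ∀ b ∈ Ω, f (s + t) b = f s (f t b))
    (hanal : ∀ t : ℝ, 0 ≤ t → AnalyticOnNhd ℂ (f t) Ω)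
    (hloc : ∀ b' ∈ Ω, ∃ δ > 0, ball b' δ ⊆ Ω ∧
      TendstoUniformlyOn (fun t b => f t b) id (𝓝[>] (0:ℝ)) (ball b' δ) ∧
      ∀ T > 0, ∃ C, ∀ t ∈ Icc (0:ℝ) T, ∀ b ∈ ball b' δ, ‖f t b - b‖ ≤ C) :
    ∃ Φ : A → A, AnalyticOnNhd ℂ Φ Ω ∧
      ∀ b ∈ Ω, ∀ t : ℝ, 0 ≤ t →
        HasDerivWithinAt (fun s => f s b) (-(Φ (f t b))) (Ici 0) t := by
  have heq := aux_equicont Ω f hf0 hsemi hanal hloc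
  have hφ : ∀ b ∈ Ω, Continuous (fun u => f (max u 0) b) := by
    intro b hb
    obtain ⟨r, hr, hsub, H⟩ := heq b hb
    rw [Metric.continuous_iff]
    intro u ε hε
    obtain ⟨_, hec⟩ := H (|u| + 1) (by positivity)
    obtain ⟨η, hη, h'⟩ := hec (ε / 2) (by positivity)
    refine ⟨min η 1, by positivity, fun v hv => ?_⟩
    rw [Real.dist_eq, lt_min_iff] at hv
    have hu := le_abs_self u
    have hv2 := (abs_lt.1 hv.2).2
    have := h' (max v 0) ⟨le_max_right _ _, max_le (by linarith) (by positivity)⟩ (max u 0)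
      ⟨le_max_right _ _, max_le (by linarith) (by positivity)⟩
      (lt_of_le_of_lt (abs_max_sub_max_le_abs v u 0) hv.1) b (mem_ball_self hr)
    rw [dist_eq_norm]
    linarith
  have hloc2 := aux_local Ω f hf0 hmaps hsemi hanal hφ heq
  have hΦ : ∀ c ∈ Ω, ∀ U ⊆ Ω, ∀ Ψ : A → A, (∀ b ∈ Ω, ∀ t : ℝ, 0 ≤ t → f t b ∈ U →
        HasDerivWithinAt (fun s => f s b) (Ψ (f t b)) (Ici 0) t) →
      ∀ x ∈ U, derivWithin (fun s => f s x) (Ici 0) 0 = Ψ x := by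
    intro c hc U hU Ψ hΨ x hx
    have h1 := hΨ x (hU hx) 0 le_rfl (by rw [hf0 x (hU hx)]; exact hx)
    rw [hf0 x (hU hx)] at h1
    exact h1.derivWithin (uniqueDiffOn_Ici 0 0 self_mem_Ici)
  refine ⟨fun x => -derivWithin (fun s => f s x) (Ici 0) 0, ?_, ?_⟩
  · intro c hc
    obtain ⟨U, hUn, hU, Ψ, hΨa, hΨ⟩ := hloc2 c hc
    refine hΨa.neg.congr ?_
    filter_upwards [hUn] with x hx
    simp [hΦ c hc U hU Ψ hΨ x hx]
  · intro b hb t ht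
    have hc := hmaps t ht hb
    obtain ⟨U, hUn, hU, Ψ, hΨa, hΨ⟩ := hloc2 (f t b) hc
    have hx := mem_of_mem_nhds hUn
    simp only [neg_neg]
    rw [hΦ _ hc U hU Ψ hΨ _ hx]
    exact hΨ b hb t ht hx
end

section
/- Under hypotheses (H1) and (H2), for every b' ∈ Ω with δ > 0 as in (H1)–(H2), the sequence of maps b ↦ 2^k (f_{2^{−k}}(b) − b) converges uniformly on the ball B_{δ/2}(b') as k → ∞; moreover, denoting the limit by −Φ(b), there exists M > 0 such that for every p ∈ ℕ and every b ∈ B_{δ/2}(b'), ‖2^p (f_{2^{−p}}(b) − b) + Φ(b)‖ ≤ (M/2) Σ_{k=p}^{∞} 2^{−k/3}. -/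
open Filter Metric Set Topology

/-- For a composition semigroup of analytic self-maps of an open set `Ω` in a complex
Banach space satisfying (H1) and (H2) near `b'` (with parameter `δ`), the maps
`b ↦ 2^k (f_{2^{-k}}(b) - b)` converge uniformly on `B_{δ/2}(b')` to a limit `-Φ(b)`,
with the quantitative estimate
`‖2^p (f_{2^{-p}}(b) - b) + Φ(b)‖ ≤ (M/2) Σ_{k=p}^∞ 2^{-k/3}`. -/
theorem semigroup_dyadic_difference_quotients_converge
    {A : Type*} [NormedAddCommGroup A] [NormedSpace ℂ A] [CompleteSpace A]
    (Ω : Set A) (hΩ : IsOpen Ω)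
    (f : ℝ → A → A)
    (hf0 : ∀ b ∈ Ω, f 0 b = b)
    (hmaps : ∀ t : ℝ, 0 ≤ t → Set.MapsTo (f t) Ω Ω)
    (hsemi : ∀ s t : ℝ, 0 ≤ s → 0 ≤ t → ∀ b ∈ Ω, f (s + t) b = f s (f t b))
    (hanal : ∀ t : ℝ, 0 ≤ t → AnalyticOnNhd ℂ (f t) Ω)
    (b' : A) (hb' : b' ∈ Ω) (δ : ℝ) (hδ : 0 < δ) (hball : ball b' δ ⊆ Ω)
    (hH1 : TendstoUniformlyOn (fun t b => f t b) id (𝓝[>] (0:ℝ)) (ball b' δ))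
    (hH2 : ∀ T > 0, ∃ C, ∀ t ∈ Icc (0:ℝ) T, ∀ b ∈ ball b' δ, ‖f t b - b‖ ≤ C) :
    ∃ Φ : A → A,
      TendstoUniformlyOn (fun (k : ℕ) b => (2:ℝ)^k • (f ((1/2:ℝ)^k) b - b))
        (fun b => -Φ b) atTop (ball b' (δ/2)) ∧
      ∃ M > 0, ∀ p : ℕ, ∀ b ∈ ball b' (δ/2),
        ‖(2:ℝ)^p • (f ((1/2:ℝ)^p) b - b) + Φ b‖
          ≤ (M/2) * ∑' k : ℕ, (2:ℝ) ^ (-(((p + k : ℕ) : ℝ)) / 3) := by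
  classical
  obtain ⟨s, hs0, hs1, hs3, hspow⟩ : ∃ s : ℝ, 0 < s ∧ s < 1 ∧ s ^ 3 = 1 / 2 ∧
      ∀ n : ℕ, (2:ℝ) ^ (-((n : ℝ)) / 3) = s ^ n := by
    have h3 : ((2:ℝ) ^ (-(1:ℝ) / 3)) ^ 3 = 1 / 2 := by
      rw [← Real.rpow_natCast, ← Real.rpow_mul (by norm_num)]
      norm_num [Real.rpow_neg_one]
    have h0 : 0 < (2:ℝ) ^ (-(1:ℝ) / 3) := Real.rpow_pos_of_pos (by norm_num) _
    refine ⟨(2:ℝ) ^ (-(1:ℝ) / 3), h0, ?_, h3, ?_⟩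
    · exact Real.rpow_lt_one_of_one_lt_of_neg (by norm_num) (by norm_num)
    · intro n
      rw [← Real.rpow_natCast, ← Real.rpow_mul (by norm_num)]
      congr 1
      ring
  have hs17 : 1 ≤ s ^ 2 * (17 / 10) := by
    have : 7 / 9 ≤ s := by
      by_contra hlt
      push Not at hlt
      have : s ^ 3 < (7 / 9) ^ 3 := pow_lt_pow_left₀ hlt hs0.le (by norm_num)
      norm_num [hs3] at this
    nlinarith
  have h2s : ∀ k : ℕ, (2:ℝ) ^ k * (s ^ k) ^ 3 = 1 := by
    intro k
    rw [← pow_mul, mul_comm k 3, pow_mul, hs3, ← mul_pow]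
    norm_num
  set g : ℕ → A → A := fun k b => f ((1/2:ℝ)^k) b - b with hg
  have hgan : ∀ k, DifferentiableOn ℂ (g k) Ω := fun k =>
    (hanal _ (by positivity)).differentiableOn.sub differentiableOn_id
  have hrel : ∀ k, ∀ b ∈ Ω,
      g k b - (2:ℝ) • g (k+1) b = g (k+1) (b + g (k+1) b) - g (k+1) b := by
    intro k b hb
    have h1 : f ((1/2:ℝ)^k) b = f ((1/2:ℝ)^(k+1)) (f ((1/2:ℝ)^(k+1)) b) := by
      rw [← hsemi _ _ (by positivity) (by positivity) b hb]
      congr 1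
      ring
    simp only [hg, two_smul, h1, add_sub_cancel]
    abel
  have key : ∀ (k : ℕ) (b : A) (ε : ℝ), ball b (δ/4) ⊆ Ω →
      (∀ x ∈ ball b (δ/4), ‖g (k+1) x‖ ≤ ε) → ‖g (k+1) b‖ < δ/4 →
      ‖g k b - (2:ℝ) • g (k+1) b‖ ≤ (2*ε)/(δ/4) * ‖g (k+1) b‖ := by
    intro k b ε hb hε hlt
    have hbb : b ∈ ball b (δ/4) := mem_ball_self (by positivity)
    rw [hrel k b (hb hbb)]
    have := Complex.dist_le_div_mul_dist_of_mapsTo_ball (f := g (k+1)) (c := b)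
      (z := b + g (k+1) b) (R₁ := δ/4) (R₂ := 2*ε) ((hgan (k+1)).mono hb) ?_ ?_
    · simpa [dist_eq_norm] using this
    · intro x hx
      rw [mem_closedBall, dist_eq_norm]
      have := norm_sub_le (g (k+1) x) (g (k+1) b)
      linarith [hε x hx, hε b hbb]
    · simpa [dist_eq_norm] using hlt
  -- smallness
  have hlim : Tendsto (fun k : ℕ => (1/2:ℝ)^k) atTop (𝓝[>] 0) := by
    refine tendsto_nhdsWithin_iff.2 ⟨tendsto_pow_atTop_nhds_zero_of_lt_one
      (by norm_num) (by norm_num), Eventually.of_forall fun k => ?_⟩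
    simp only [mem_Ioi]
    positivity
  obtain ⟨N, hN⟩ : ∃ N : ℕ, ∀ k ≥ N, ∀ b ∈ ball b' δ, ‖g k b‖ ≤ δ/4 * (3/20) := by
    have h1 := hlim.eventually (Metric.tendstoUniformlyOn_iff.1 hH1 (δ/4*(3/20)) (by positivity))
    obtain ⟨N, hN⟩ := eventually_atTop.1 h1
    refine ⟨N, fun k hk b hb => ?_⟩
    have := hN k hk b hb
    rw [dist_comm, dist_eq_norm] at this
    exact this.le
  obtain ⟨C0, hC0⟩ := hH2 1 one_pos
  have hC0' : ∀ k, ∀ b ∈ ball b' δ, ‖g k b‖ ≤ C0 := fun k b hb =>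
    hC0 _ ⟨by positivity, pow_le_one₀ (by norm_num) (by norm_num)⟩ b hb
  have hC0nn : 0 ≤ C0 := (norm_nonneg _).trans (hC0' 0 b' (mem_ball_self hδ))
  have hsub1 : ∀ b ∈ ball b' (3*δ/4), ball b (δ/4) ⊆ ball b' δ := by
    intro b hb
    apply ball_subset_ball'
    rw [mem_ball] at hb
    linarith
  have hsub2 : ∀ b ∈ ball b' (δ/2), ball b (δ/4) ⊆ ball b' (3*δ/4) := by
    intro b hb
    apply ball_subset_ball'
    rw [mem_ball] at hb
    linarith
  have hsub3 : ball b' (3*δ/4) ⊆ ball b' δ := ball_subset_ball (by linarith)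
  have hsub4 : ball b' (δ/2) ⊆ ball b' (3*δ/4) := ball_subset_ball (by linarith)
  have hsmall : ∀ k ≥ N, ∀ b ∈ ball b' δ, ‖g k b‖ < δ/4 := fun k hk b hb =>
    (hN k hk b hb).trans_lt (by linarith)
  -- contraction
  have hcontr : ∀ k ≥ N, ∀ b ∈ ball b' (3*δ/4), ‖g (k+1) b‖ ≤ s^2 * ‖g k b‖ := by
    intro k hk b hb
    have h1 := key k b (δ/4*(3/20)) ((hsub1 b hb).trans hball)
      (fun x hx => hN (k+1) (by omega) x (hsub1 b hb hx)) (hsmall (k+1) (by omega) b (hsub3 hb))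
    have h2 : 2 * (δ/4*(3/20)) / (δ/4) = 3/10 := by
      field_simp
      norm_num
    rw [h2] at h1
    have h3 : ‖(2:ℝ) • g (k+1) b‖ = 2 * ‖g (k+1) b‖ := by
      rw [norm_smul]
      norm_num
    have h4 : ‖(2:ℝ) • g (k+1) b‖ - ‖g k b‖ ≤ ‖g k b - (2:ℝ) • g (k+1) b‖ := by
      rw [norm_sub_rev (g k b)]
      exact norm_sub_norm_le _ _
    have h5 : 17/10 * ‖g (k+1) b‖ ≤ ‖g k b‖ := by linarith
    have h6 := mul_le_mul_of_nonneg_left h5 (sq_nonneg s)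
    have h7 := mul_le_mul_of_nonneg_right hs17 (norm_nonneg (g (k+1) b))
    linarith
  obtain ⟨C, hCnn, hC⟩ : ∃ C : ℝ, 0 ≤ C ∧ ∀ k ≥ N, ∀ b ∈ ball b' (3*δ/4),
      ‖g k b‖ ≤ C * (s^k)^2 := by
    refine ⟨C0 / (s^N)^2, by positivity, fun k hk b hb => ?_⟩
    induction k, hk using Nat.le_induction with
    | base =>
      rw [div_mul_cancel₀ _ (by positivity)]
      exact hC0' N b (hsub3 hb)
    | succ k hk ih =>
      calc ‖g (k+1) b‖ ≤ s^2 * ‖g k b‖ := hcontr k hk b hb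
        _ ≤ s^2 * (C0 / (s^N)^2 * (s^k)^2) := by gcongr
        _ = _ := by ring
  set F : ℕ → A → A := fun k b => (2:ℝ)^k • g k b with hF
  have hFd : ∀ k b, dist (F k b) (F (k+1) b) = 2^k * ‖g k b - (2:ℝ) • g (k+1) b‖ := by
    intro k b
    have : F k b - F (k+1) b = (2:ℝ)^k • (g k b - (2:ℝ) • g (k+1) b) := by
      simp only [hF, smul_sub, smul_smul, pow_succ]
    rw [dist_eq_norm, this, norm_smul]
    simp
  obtain ⟨M, hM0, hM⟩ : ∃ M > 0, ∀ k, ∀ b ∈ ball b' (δ/2),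
      dist (F k b) (F (k+1) b) ≤ M/2 * s^k := by
    set K1 : ℝ := 8 * C^2 / δ with hK1
    set K2 : ℝ := 2^N * (3*C0) / s^N with hK2
    have hK1n : 0 ≤ K1 := by positivity
    have hK2n : 0 ≤ K2 := by positivity
    refine ⟨2 * (K1 + K2 + 1), by positivity, fun k b hb => ?_⟩
    have hsk : 0 < s^k := by positivity
    have hmain : dist (F k b) (F (k+1) b) ≤ max K1 K2 * s^k := by
      rw [hFd]
      rcases le_or_gt N k with hk | hk
      · have h1 := key k b (C * (s^(k+1))^2)
          ((hsub2 b hb).trans (hsub3.trans hball))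
          (fun x hx => hC (k+1) (by omega) x (hsub2 b hb hx))
          (hsmall (k+1) (by omega) b (hsub3 (hsub4 hb)))
        have hle : ∀ x : ℝ, x = s^(k+1) → x^2 ≤ (s^k)^2 := by
          rintro x rfl
          have : s^(k+1) ≤ s^k := pow_le_pow_of_le_one hs0.le hs1.le (by omega)
          gcongr
        have hle' := hle _ rfl
        have h2 := hC (k+1) (by omega) b (hsub4 hb)
        calc (2:ℝ)^k * ‖g k b - (2:ℝ) • g (k+1) b‖
            ≤ 2^k * ((2*(C * (s^(k+1))^2))/(δ/4) * (C * (s^(k+1))^2)) := by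
              refine mul_le_mul_of_nonneg_left (h1.trans ?_) (by positivity)
              exact mul_le_mul_of_nonneg_left h2 (by positivity)
          _ ≤ 2^k * ((2*(C * (s^k)^2))/(δ/4) * (C * (s^k)^2)) := by gcongr
          _ = K1 * s^k * (2^k * (s^k)^3) := by
              rw [hK1]
              field_simp
              ring
          _ = K1 * s^k := by rw [h2s, mul_one]
          _ ≤ _ := mul_le_mul_of_nonneg_right (le_max_left _ _) hsk.le
      · have hb2 := hsub3 (hsub4 hb)
        have h1 : ‖g k b - (2:ℝ) • g (k+1) b‖ ≤ 3 * C0 := by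
          have h3 : ‖(2:ℝ) • g (k+1) b‖ = 2 * ‖g (k+1) b‖ := by
            rw [norm_smul]
            norm_num
          have := norm_sub_le (g k b) ((2:ℝ) • g (k+1) b)
          linarith [hC0' k b hb2, hC0' (k+1) b hb2]
        have h2 : (2:ℝ)^k ≤ 2^N := pow_le_pow_right₀ (by norm_num) hk.le
        have h3 : s^N ≤ s^k := pow_le_pow_of_le_one hs0.le hs1.le hk.le
        calc (2:ℝ)^k * ‖g k b - (2:ℝ) • g (k+1) b‖ ≤ 2^N * (3*C0) := by gcongr
          _ = K2 * s^N := by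
              rw [hK2, div_mul_cancel₀ _ (by positivity)]
          _ ≤ K2 * s^k := by gcongr
          _ ≤ _ := mul_le_mul_of_nonneg_right (le_max_right _ _) hsk.le
    refine hmain.trans (mul_le_mul_of_nonneg_right ?_ hsk.le)
    refine max_le ?_ ?_ <;> linarith
  have hsum : Summable (fun k : ℕ => M/2 * s^k) :=
    (summable_geometric_of_lt_one hs0.le hs1).mul_left _
  have hex : ∀ b, ∃ a, b ∈ ball b' (δ/2) → Tendsto (fun k => F k b) atTop (𝓝 a) := by
    intro b
    by_cases hb : b ∈ ball b' (δ/2)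
    · obtain ⟨a, ha⟩ := cauchySeq_tendsto_of_complete
        (cauchySeq_of_dist_le_of_summable _ (fun k => hM k b hb) hsum)
      exact ⟨a, fun _ => ha⟩
    · exact ⟨0, fun h => absurd h hb⟩
  choose L hL using hex
  have hbound : ∀ p, ∀ b ∈ ball b' (δ/2), dist (F p b) (L b) ≤ ∑' k : ℕ, M/2 * s^(p+k) :=
    fun p b hb => dist_le_tsum_of_dist_le_of_tendsto (fun k => M/2 * s^k)
      (fun k => hM k b hb) hsum (hL b hb) p
  refine ⟨fun b => - L b, ?_, M, hM0, ?_⟩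
  · simp only [neg_neg]
    have ht : Tendsto (fun p : ℕ => ∑' k : ℕ, M/2 * s^(p+k)) atTop (𝓝 0) := by
      have := tendsto_sum_nat_add (fun k : ℕ => M/2 * s^k)
      simpa only [add_comm] using this
    rw [Metric.tendstoUniformlyOn_iff]
    intro ε hε
    filter_upwards [ht.eventually (gt_mem_nhds hε)] with p hp b hb
    rw [dist_comm]
    exact (hbound p b hb).trans_lt hp
  · intro p b hb
    have := hbound p b hb
    rw [tsum_mul_left, dist_eq_norm] at this
    simp only [hspow, ← sub_eq_add_neg]
    exact this
end

section
/- Let B be a unital C*-algebra and let Φ : H⁺(B) → B be an analytic map such that Im(Φ(b)) ≤ 0 for all b ∈ H⁺(B) and such that for every ε > 0, sup_{b ∈ H^{+,ε}(B)} ‖Φ(b)‖ < ∞. Then there exists a family f : [0, ∞) × H⁺(B) → H⁺(B) such that: (i) f(0, b) = b for all b; (ii) for each b, the map t ↦ f(t, b) is differentiable with (d/dt) f(t, b) = −Φ(f(t, b)); (iii) Im(f(t, b)) ≥ Im(b) for all t ≥ 0 and b ∈ H⁺(B); (iv) f(s + t, b) = f(s, f(t, b)) for all s, t ≥ 0; (v)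 each map f(t, ·) is analytic on H⁺(B); and (vi) for every ε > 0, sup_{b ∈ H^{+,ε}(B)} ‖f(t, b) − b‖ → 0 as t ↓ 0. -/
open Filter Metric Set Topology

/-- The "imaginary part" `Im(b) = (b - b*)/(2i)` of an element of a complex
star-algebra. -/
noncomputable def imPart {B : Type*} [AddCommGroup B] [Module ℂ B] [Star B]
    (b : B) : B :=
  (2 * Complex.I)⁻¹ • (b - star b)

/-- The set `H^{+,ε}(B) = {b : Im(b) ≥ ε·1}`. -/
noncomputable def UHPeps (B : Type*) [Ring B] [Module ℂ B] [Star B]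
    [PartialOrder B] (ε : ℝ) : Set B :=
  {b : B | (ε : ℂ) • (1 : B) ≤ imPart b}

/-- The operator upper half-plane `H⁺(B) = ⋃_{ε > 0} H^{+,ε}(B)`. -/
noncomputable def UHP (B : Type*) [Ring B] [Module ℂ B] [Star B]
    [PartialOrder B] : Set B :=
  ⋃ ε > (0:ℝ), UHPeps B ε


section Nemytskii
variable {X : Type*} [TopologicalSpace X] [CompactSpace X]
  {E : Type*} [NormedAddCommGroup E] [NormedSpace ℂ E]

/-- pointwise application of a continuous multilinear map to continuous functions -/
noncomputable def nemMulti (n : ℕ) (p : ContinuousMultilinearMap ℂ (fun _ : Fin n => E) E) :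
    ContinuousMultilinearMap ℂ (fun _ : Fin n => C(X, E)) C(X, E) :=
  MultilinearMap.mkContinuous
    { toFun := fun h => ⟨fun s => p (fun i => h i s), by fun_prop⟩
      map_update_add' := by
        intro _ m i x y
        ext s
        have key : ∀ z : C(X, E), (fun j => (Function.update m i z) j s)
            = Function.update (fun j => m j s) i (z s) := by
          intro z; funext j
          by_cases hj : j = i
          · subst hj; simp
          · simp [hj]
        simp only [ContinuousMap.coe_mk, ContinuousMap.add_apply]
        rw [key, key, key]
        simp
      map_update_smul' := by
        intro _ m i c x
        ext s
        have key : ∀ z : C(X, E), (fun j => (Function.update m i z) j s)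
            = Function.update (fun j => m j s) i (z s) := by
          intro z; funext j
          by_cases hj : j = i
          · subst hj; simp
          · simp [hj]
        simp only [ContinuousMap.coe_mk, ContinuousMap.smul_apply]
        rw [key, key]
        simp }
    ‖p‖ (by
      intro m
      rw [ContinuousMap.norm_le _ (by positivity)]
      intro s
      refine (p.le_opNorm _).trans ?_
      gcongr with i
      exact (m i).norm_coe_le_norm s)

theorem nemMulti_apply (n : ℕ) (p : ContinuousMultilinearMap ℂ (fun _ : Fin n => E) E)
    (h : Fin n → C(X, E)) (s : X) : nemMulti n p h s = p (fun i => h i s) := rfl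

theorem nemMulti_norm (n : ℕ) (p : ContinuousMultilinearMap ℂ (fun _ : Fin n => E) E) :
    ‖nemMulti (X := X) n p‖ ≤ ‖p‖ :=
  MultilinearMap.mkContinuous_norm_le _ (norm_nonneg _) _

theorem exists_nemytskii [CompleteSpace E] {Φ : E → E} {p : FormalMultilinearSeries ℂ E E} {c : E}
    {r : ℝ} (hr : 0 < r) (hp : HasFPowerSeriesOnBall Φ p c (ENNReal.ofReal r)) :
    ∃ N : C(X, E) → C(X, E), AnalyticOnNhd ℂ N (ball (ContinuousMap.const X c) r) ∧
      ∀ h ∈ ball (ContinuousMap.const X c) r, ∀ s, N h s = Φ (h s) := by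
  let P : FormalMultilinearSeries ℂ C(X, E) C(X, E) := fun n => nemMulti n (p n)
  have hrad : ENNReal.ofReal r ≤ P.radius :=
    hp.r_le.trans (FormalMultilinearSeries.radius_le_of_le fun n => nemMulti_norm n (p n))
  have hpos : 0 < ENNReal.ofReal r := by simpa using hr
  have hP := P.hasFPowerSeriesOnBall (hpos.trans_le hrad)
  have hsub : ∀ h ∈ ball (ContinuousMap.const X c) r,
      h - ContinuousMap.const X c ∈ Metric.eball (0 : C(X, E)) (ENNReal.ofReal r) := by
    intro h hh
    rw [Metric.eball_ofReal]
    simpa [mem_ball, dist_eq_norm] using hh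
  refine ⟨fun h => P.sum (h - ContinuousMap.const X c), ?_, ?_⟩
  · intro h hh
    have h1 : AnalyticAt ℂ P.sum (h - ContinuousMap.const X c) :=
      hP.analyticAt_of_mem (Metric.eball_subset_eball hrad (hsub h hh))
    exact AnalyticAt.fun_comp h1 (by fun_prop)
  · intro h hh s
    have h1 := P.hasSum (Metric.eball_subset_eball hrad (hsub h hh))
    have h2 := h1.mapL (ContinuousMap.evalCLM ℂ s)
    have hs : h s - c ∈ Metric.eball (0 : E) (ENNReal.ofReal r) := by
      rw [Metric.eball_ofReal]
      have h3 := (ContinuousMap.dist_lt_iff hr).1 hh s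
      simpa [mem_ball, dist_eq_norm] using h3
    have h3 := hp.hasSum hs
    rw [add_sub_cancel] at h3
    exact h2.unique h3

end Nemytskii

section Volterra
variable {E : Type*} [NormedAddCommGroup E] [NormedSpace ℂ E] [CompleteSpace E]

noncomputable def volterra (δ : ℝ) (hδ : 0 ≤ δ) : C(Icc 0 δ, E) →L[ℂ] C(Icc 0 δ, E) :=
  LinearMap.mkContinuous
    { toFun := fun x => ⟨fun t => ∫ s in (0:ℝ)..t, x (projIcc 0 δ hδ s), by
        have h : Continuous fun t : ℝ => ∫ s in (0:ℝ)..t, x (projIcc 0 δ hδ s) :=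
          intervalIntegral.continuous_primitive
            (fun a b => (x.continuous.comp continuous_projIcc).intervalIntegrable a b) 0
        exact h.comp continuous_subtype_val⟩
      map_add' := by
        intro x y
        ext t
        simp only [ContinuousMap.coe_mk, ContinuousMap.add_apply]
        exact intervalIntegral.integral_add
          ((x.continuous.comp continuous_projIcc).intervalIntegrable _ _)
          ((y.continuous.comp continuous_projIcc).intervalIntegrable _ _)
      map_smul' := by
        intro c x
        ext t
        simp }
    δ (by
      intro x
      rw [ContinuousMap.norm_le _ (by positivity)]
      intro t
      have := intervalIntegral.norm_integral_le_of_norm_le_const (a := 0) (b := (t : ℝ)) (C := ‖x‖)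
        (f := fun s => x (projIcc 0 δ hδ s)) (fun s _ => x.norm_coe_le_norm _)
      refine this.trans ?_
      rw [sub_zero, abs_of_nonneg t.2.1, mul_comm]
      gcongr
      exact t.2.2)

theorem volterra_apply (δ : ℝ) (hδ : 0 ≤ δ) (x : C(Icc 0 δ, E)) (t : Icc 0 δ) :
    volterra δ hδ x t = ∫ s in (0:ℝ)..t, x (projIcc 0 δ hδ s) := rfl

theorem volterra_norm (δ : ℝ) (hδ : 0 ≤ δ) : ‖volterra (E := E) δ hδ‖ ≤ δ :=
  LinearMap.mkContinuous_norm_le _ hδ _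

/-- local analytic dependence on initial data -/
theorem analytic_of_volterra {Φ : E → E} {p : FormalMultilinearSeries ℂ E E} {c c' : E}
    {r δ : ℝ} (hr : 0 < r) (hp : HasFPowerSeriesOnBall Φ p c (ENNReal.ofReal r)) (hδ : 0 ≤ δ)
    {K : NNReal} (hK : LipschitzOnWith K Φ (ball c r)) (hδK : δ * K < 1)
    (F : E → C(Icc 0 δ, E)) (hF : ContinuousAt F c')
    (hFc : F c' ∈ ball (ContinuousMap.const _ c) r)
    (hFe : ∀ᶠ b in 𝓝 c', ∀ t : Icc 0 δ,
      F b t + ∫ s in (0:ℝ)..t, Φ (F b (projIcc 0 δ hδ s)) = b) :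
    AnalyticAt ℂ F c' := by
  obtain ⟨N, hN, hNe⟩ := exists_nemytskii (X := Icc 0 δ) hr hp
  have hopen : ball (ContinuousMap.const (Icc 0 δ) c) r ∈ 𝓝 (F c') := isOpen_ball.mem_nhds hFc
  have hNlip : LipschitzOnWith K N (ball (ContinuousMap.const (Icc 0 δ) c) r) := by
    refine LipschitzOnWith.of_dist_le_mul fun x hx y hy => ?_
    rw [ContinuousMap.dist_le (by positivity)]
    intro s
    rw [hNe x hx, hNe y hy]
    refine (hK.dist_le_mul _ ((ContinuousMap.dist_lt_iff hr).1 hx s) _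
      ((ContinuousMap.dist_lt_iff hr).1 hy s)).trans ?_
    gcongr
    exact ContinuousMap.dist_apply_le_dist s
  have hD : ‖fderiv ℂ N (F c')‖ ≤ K := norm_fderiv_le_of_lipschitzOn ℂ hopen hNlip
  set V : C(Icc 0 δ, E) →L[ℂ] C(Icc 0 δ, E) := volterra δ hδ with hV
  set T : C(Icc 0 δ, E) →L[ℂ] C(Icc 0 δ, E) := -(V.comp (fderiv ℂ N (F c'))) with hT
  have hTn : ‖T‖ < 1 := by
    rw [hT, ContinuousLinearMap.opNorm_neg]
    refine (ContinuousLinearMap.opNorm_comp_le _ _).trans_lt (lt_of_le_of_lt ?_ hδK)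
    gcongr
    exact volterra_norm δ hδ
  let u := ContinuousLinearEquiv.ofUnit (Units.oneSub T hTn)
  let G : C(Icc 0 δ, E) → C(Icc 0 δ, E) := fun x => x + V (N x)
  have hNa := hN _ hFc
  have hGa : AnalyticAt ℂ G (F c') := by
    have h1 : AnalyticAt ℂ (fun x => V (N x)) (F c') :=
      (V.analyticAt _).comp hNa
    exact analyticAt_id.add h1
  have hGd : HasStrictFDerivAt G (u : C(Icc 0 δ, E) →L[ℂ] C(Icc 0 δ, E)) (F c') := by
    have h1 : HasStrictFDerivAt G
        (ContinuousLinearMap.id ℂ _ + V.comp (fderiv ℂ N (F c'))) (F c') :=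
      (hasStrictFDerivAt_id _).add (V.hasStrictFDerivAt.comp _ hNa.hasStrictFDerivAt)
    convert h1 using 1
    ext x s
    simp [u, hT, ContinuousLinearEquiv.ofUnit]
  have hinv : AnalyticAt ℂ (HasStrictFDerivAt.localInverse G u (F c') hGd) (G (F c')) :=
    (ContDiffAt.to_localInverse (n := ⊤) (hGa.contDiffAt) hGd.hasFDerivAt (by simp)).analyticAt
  have hconst : ∀ᶠ b in 𝓝 c', G (F b) = ContinuousMap.const _ b := by
    filter_upwards [hFe, hF hopen] with b hb hb2
    ext t
    simp only [G, ContinuousMap.add_apply, hV, volterra_apply, ContinuousMap.const_apply]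
    refine Eq.trans ?_ (hb t)
    congr 1
    refine intervalIntegral.integral_congr fun s _ => ?_
    exact hNe _ hb2 _
  have hev : ∀ᶠ b in 𝓝 c', HasStrictFDerivAt.localInverse G u (F c') hGd
      (ContinuousMap.const _ b) = F b := by
    filter_upwards [hconst, hF.eventually hGd.eventually_left_inverse] with b h1 h2
    rw [← h1, h2]
  let L : E →L[ℂ] C(Icc 0 δ, E) := LinearMap.mkContinuous
    { toFun := fun b => ContinuousMap.const _ b
      map_add' := fun _ _ => rfl
      map_smul' := fun _ _ => rfl } 1 (by
        intro b
        rw [ContinuousMap.norm_le _ (by positivity)]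
        intro s
        rw [one_mul]
        exact le_rfl)
  have hL : AnalyticAt ℂ (fun b => HasStrictFDerivAt.localInverse G u (F c') hGd (L b)) c' := by
    refine AnalyticAt.fun_comp ?_ (L.analyticAt _)
    have : L c' = G (F c') := (hconst.self_of_nhds).symm
    rw [this]
    exact hinv
  exact hL.congr hev

end Volterra

/-- Global existence for a Lipschitz bounded field on a translate `b + P` of a cone. -/
theorem exists_global_solution {E : Type*} [NormedAddCommGroup E] [NormedSpace ℝ E]
    [CompleteSpace E] (P : Set E) (hPc : IsClosed P) (hP0 : (0:E) ∈ P)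
    (hPs : ∀ a : ℝ, 0 ≤ a → ∀ x ∈ P, a • x ∈ P)
    (hPi : ∀ g : ℝ → E, Continuous g → (∀ s, g s ∈ P) → ∀ t, 0 ≤ t → (∫ s in (0:ℝ)..t, g s) ∈ P)
    (Ψ : E → E) (b : E) (K : NNReal) (C : ℝ)
    (hK : LipschitzOnWith K Ψ {x | x - b ∈ P})
    (hC : ∀ x, x - b ∈ P → ‖Ψ x‖ ≤ C)
    (hΨ : ∀ x, x - b ∈ P → Ψ x ∈ P) :
    ∃ x : ℝ → E, x 0 = b ∧ (∀ t, x t - b ∈ P) ∧ Continuous x ∧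
      (∀ t, 0 ≤ t → x t = b + ∫ s in (0:ℝ)..t, Ψ (x s)) ∧
      ∀ t, 0 ≤ t → HasDerivWithinAt x (Ψ (x t)) (Ici 0) t := by
  have hC0 : 0 ≤ C := (norm_nonneg _).trans (hC b (by simpa using hP0))
  set l : ℝ := 2 * K + 1 with hl
  have hlpos : 0 < l := by positivity
  let S : Set (BoundedContinuousFunction ℝ E) := {y | ∀ t, y t ∈ P}
  have hSc : IsClosed S := by
    have : S = ⋂ t, {y : BoundedContinuousFunction ℝ E | y t ∈ P} := by ext; simp [S]
    rw [this]
    exact isClosed_iInter fun t => hPc.preimage (continuous_eval_const t)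
  have : CompleteSpace S := hSc.completeSpace_coe
  have : Nonempty S := ⟨⟨0, fun t => hP0⟩⟩
  let X : S → ℝ → E := fun y t => b + Real.exp (l * |t|) • y.1 t
  have hX : ∀ y t, X y t - b ∈ P := by
    intro y t
    simp only [X, add_sub_cancel_left]
    exact hPs _ (Real.exp_pos _).le _ (y.2 t)
  have hXc : ∀ y, Continuous (X y) := by
    intro y
    have := y.1.continuous
    simp only [X]; fun_prop
  have hgc : ∀ y, Continuous fun t => Ψ (X y t) := fun y =>
    hK.continuousOn.comp_continuous (hXc y) (hX y)
  have hIc : ∀ y : S, Continuous fun t : ℝ => ∫ s in (0:ℝ)..|t|, Ψ (X y s) := fun y =>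
    (intervalIntegral.continuous_primitive (fun _ _ => (hgc y).intervalIntegrable _ _) 0).comp
      continuous_abs
  have hexp : ∀ t : ℝ, Real.exp (-(l * |t|)) * |t| ≤ 1 / l := by
    intro t
    rw [Real.exp_neg, le_div_iff₀ hlpos, inv_mul_eq_div, div_mul_eq_mul_div,
      div_le_one (Real.exp_pos _)]
    have := Real.add_one_le_exp (l * |t|)
    nlinarith
  let T : S → S := fun y => ⟨BoundedContinuousFunction.ofNormedAddCommGroup
      (fun t => Real.exp (-(l * |t|)) • ∫ s in (0:ℝ)..|t|, Ψ (X y s))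
      (by have := hIc y; fun_prop) (C * (1 / l)) (by
        intro t
        rw [norm_smul, Real.norm_of_nonneg (Real.exp_pos _).le]
        have h1 := intervalIntegral.norm_integral_le_of_norm_le_const (a := 0) (b := |t|) (C := C)
          (f := fun s => Ψ (X y s)) (fun s _ => hC _ (hX y s))
        rw [sub_zero, abs_abs] at h1
        calc Real.exp (-(l * |t|)) * ‖∫ s in (0:ℝ)..|t|, Ψ (X y s)‖
            ≤ Real.exp (-(l * |t|)) * (C * |t|) := by gcongr
          _ = C * (Real.exp (-(l * |t|)) * |t|) := by ring
          _ ≤ C * (1 / l) := by gcongr; exact hexp t), fun t =>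
      hPs _ (Real.exp_pos _).le _ (hPi _ (hgc y) (fun s => hΨ _ (hX y s)) _ (abs_nonneg t))⟩
  have hT : ∀ y t, (T y).1 t = Real.exp (-(l * |t|)) • ∫ s in (0:ℝ)..|t|, Ψ (X y s) :=
    fun _ _ => rfl
  have hcontr : ContractingWith (1/2) T := by
    refine ⟨by rw [← NNReal.coe_lt_coe]; norm_num, LipschitzWith.of_dist_le_mul fun y z => ?_⟩
    rw [Subtype.dist_eq, Subtype.dist_eq, BoundedContinuousFunction.dist_le (by positivity)]
    intro t
    rw [hT, hT, dist_eq_norm, ← smul_sub, norm_smul, Real.norm_of_nonneg (Real.exp_pos _).le,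
      ← intervalIntegral.integral_sub ((hgc y).intervalIntegrable _ _)
        ((hgc z).intervalIntegrable _ _)]
    set d := dist y.1 z.1 with hd
    have hd0 : 0 ≤ d := dist_nonneg
    have h1 : ‖∫ s in (0:ℝ)..|t|, (Ψ (X y s) - Ψ (X z s))‖ ≤
        ∫ s in (0:ℝ)..|t|, (K * d) * Real.exp (l * s) := by
      refine intervalIntegral.norm_integral_le_of_norm_le (abs_nonneg t) ?_ ?_
      · refine Filter.Eventually.of_forall fun s hs => ?_
        have h2 := hK.dist_le_mul _ (hX y s) _ (hX z s)
        rw [dist_eq_norm] at h2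
        refine h2.trans ?_
        have h3 : dist (X y s) (X z s) = Real.exp (l * s) * dist (y.1 s) (z.1 s) := by
          simp only [X, dist_add_left]
          rw [dist_smul₀, Real.norm_of_nonneg (Real.exp_pos _).le, abs_of_nonneg hs.1.le]
        rw [h3]
        have h4 : dist (y.1 s) (z.1 s) ≤ d := BoundedContinuousFunction.dist_coe_le_dist s
        calc (K:ℝ) * (Real.exp (l * s) * dist (y.1 s) (z.1 s))
            ≤ K * (Real.exp (l * s) * d) := by gcongr
          _ = _ := by ring
      · exact Continuous.intervalIntegrable (by fun_prop) _ _
    have h5 : ∫ s in (0:ℝ)..|t|, (K * d) * Real.exp (l * s) =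
        (K * d) * ((Real.exp (l * |t|) - 1) / l) := by
      rw [intervalIntegral.integral_const_mul, intervalIntegral.integral_comp_mul_left Real.exp hlpos.ne',
        integral_exp, mul_zero, Real.exp_zero, smul_eq_mul, div_eq_inv_mul]
    rw [h5] at h1
    calc _ ≤ Real.exp (-(l * |t|)) * ((K * d) * ((Real.exp (l * |t|) - 1) / l)) := by gcongr
      _ ≤ Real.exp (-(l * |t|)) * ((K * d) * (Real.exp (l * |t|) / l)) := by gcongr; linarith
      _ = (K / l) * d := by
        rw [Real.exp_neg]; field_simp
      _ ≤ _ := by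
        gcongr
        rw [div_le_iff₀ hlpos, hl]
        push_cast
        linarith
  set y := hcontr.fixedPoint T with hy
  have hfix : T y = y := hcontr.fixedPoint_isFixedPt
  have hXe : ∀ t, X y t = b + ∫ s in (0:ℝ)..|t|, Ψ (X y s) := by
    intro t
    have h1 : y.1 t = Real.exp (-(l * |t|)) • ∫ s in (0:ℝ)..|t|, Ψ (X y s) := by
      rw [← hT, hfix]
    conv_lhs => simp only [X]
    rw [h1, smul_smul, ← Real.exp_add]
    simp
  have hXe' : ∀ t, 0 ≤ t → X y t = b + ∫ s in (0:ℝ)..t, Ψ (X y s) := by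
    intro t ht
    rw [hXe, abs_of_nonneg ht]
  refine ⟨X y, by rw [hXe]; simp, hX y, hXc y, hXe', fun t ht => ?_⟩
  have hd : HasDerivAt (fun t => b + ∫ s in (0:ℝ)..t, Ψ (X y s)) (Ψ (X y t)) t :=
    ((hgc y).integral_hasStrictDerivAt 0 t).hasDerivAt.const_add b
  exact hd.hasDerivWithinAt.congr (fun s hs => hXe' s hs) (hXe' t ht)
section CStar
variable {B : Type*} [NormedRing B] [StarRing B] [CStarRing B] [CompleteSpace B]
    [NormedAlgebra ℂ B] [StarModule ℂ B]

theorem imPart_norm_le (b : B) : ‖imPart b‖ ≤ ‖b‖ := by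
  unfold imPart
  rw [norm_smul]
  have h : ‖b - star b‖ ≤ ‖b‖ + ‖b‖ := by
    simpa using norm_sub_le b (star b)
  have h2 : ‖(2 * Complex.I)⁻¹‖ = 1/2 := by simp
  rw [h2]
  linarith

noncomputable def imPartL : B →L[ℝ] B :=
  LinearMap.mkContinuous
    { toFun := imPart
      map_add' := by
        intro x y
        simp only [imPart, star_add, ← smul_add]
        congr 1
        abel
      map_smul' := by
        intro a x
        simp only [imPart, RingHom.id_apply]
        have : star (a • x) = a • star x := by
          rw [← Complex.coe_smul a x, star_smul, Complex.star_def, Complex.conj_ofReal,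
            Complex.coe_smul]
        rw [this, ← smul_sub, smul_comm] } 1 (by
    intro x
    rw [one_mul]
    exact imPart_norm_le x)

theorem imPartL_apply (b : B) : imPartL b = imPart b := rfl

theorem imPart_sub (a b : B) : imPart (a - b) = imPart a - imPart b := by
  simp only [← imPartL_apply, map_sub]

theorem imPart_neg (a : B) : imPart (-a) = -imPart a := by
  simp only [← imPartL_apply, map_neg]

theorem imPart_selfAdjoint (b : B) : IsSelfAdjoint (imPart b) := by
  unfold IsSelfAdjoint imPart
  rw [star_smul, star_sub, star_star, ← neg_sub b (star b), smul_neg, ← neg_smul]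
  congr 1
  simp

variable [PartialOrder B] [StarOrderedRing B]

theorem uhpEps_ball {ε : ℝ} {y z : B} (hy : y ∈ UHPeps B ε) (hz : dist z y ≤ ε / 2) :
    z ∈ UHPeps B (ε / 2) := by
  let : CStarAlgebra B := {}
  have h1 : -algebraMap ℝ B ‖imPart (z - y)‖ ≤ imPart (z - y) :=
    (imPart_selfAdjoint (z - y)).neg_algebraMap_norm_le_self
  have h2 : ‖imPart (z - y)‖ ≤ ε / 2 := (imPart_norm_le _).trans (by rwa [← dist_eq_norm])
  have h3 : algebraMap ℝ B ‖imPart (z - y)‖ ≤ algebraMap ℝ B (ε / 2) :=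
    algebraMap_mono B h2
  have h4 : algebraMap ℝ B ε ≤ imPart y := by
    have : ((ε : ℝ) : ℂ) • (1 : B) ≤ imPart y := hy
    rwa [Complex.coe_smul, ← Algebra.algebraMap_eq_smul_one] at this
  show (((ε / 2 : ℝ)) : ℂ) • (1 : B) ≤ imPart z
  rw [Complex.coe_smul, ← Algebra.algebraMap_eq_smul_one]
  have h5 : algebraMap ℝ B ε = algebraMap ℝ B (ε / 2) + algebraMap ℝ B (ε / 2) := by
    rw [← map_add]; congr 1; ring
  rw [imPart_sub] at h1 h3
  have h6 := add_le_add h4 ((neg_le_neg h3).trans h1)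
  rw [h5] at h6
  simpa using h6

theorem uhpEps_mono_im {ε : ℝ} {y z : B} (hy : y ∈ UHPeps B ε) (h : imPart y ≤ imPart z) :
    z ∈ UHPeps B ε := le_trans hy h

theorem mem_uhp {y : B} : y ∈ UHP B ↔ ∃ ε > 0, y ∈ UHPeps B ε := by
  simp [UHP]

theorem uhpEps_lip (Φ : B → B)
    (hΦa : AnalyticOnNhd ℂ Φ (UHP B))
    (hΦbd : ∀ ε > (0:ℝ), ∃ C, ∀ b ∈ UHPeps B ε, ‖Φ b‖ ≤ C) {ε : ℝ} (hε : 0 < ε) :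
    ∃ K : NNReal, LipschitzOnWith K Φ (UHPeps B ε) := by
  obtain ⟨C, hC⟩ := hΦbd (ε / 2) (by positivity)
  rcases (UHPeps B ε).eq_empty_or_nonempty with h0 | ⟨x0, hx0⟩
  · exact ⟨0, by rw [h0]; exact lipschitzOnWith_empty _ _⟩
  have hmem : ∀ y ∈ UHPeps B ε, y ∈ UHPeps B (ε / 2) := fun y hy =>
    uhpEps_ball hy (by rw [dist_self]; positivity)
  have hC0 : 0 ≤ C := (norm_nonneg _).trans (hC x0 (hmem _ hx0))
  refine ⟨Real.toNNReal (2 * C / (ε / 2)), LipschitzOnWith.of_dist_le_mul fun z hz y hy => ?_⟩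
  rw [Real.coe_toNNReal _ (by positivity)]
  have hb : ∀ w ∈ UHPeps B (ε / 2), dist (Φ w) (Φ y) ≤ 2 * C := by
    intro w hw
    rw [dist_eq_norm]
    have := norm_sub_le (Φ w) (Φ y)
    linarith [hC w hw, hC y (hmem y hy)]
  by_cases hd : dist z y < ε / 2
  · refine Complex.dist_le_div_mul_dist_of_mapsTo_ball (R₁ := ε / 2) (R₂ := 2 * C) ?_ ?_ hd
    · intro w hw
      have : w ∈ UHP B := mem_uhp.2 ⟨ε / 2, by positivity, uhpEps_ball hy (le_of_lt hw)⟩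
      exact (hΦa w this).differentiableAt.differentiableWithinAt
    · intro w hw
      exact hb w (uhpEps_ball hy (le_of_lt hw))
  · push Not at hd
    refine (hb z (hmem z hz)).trans ?_
    rw [div_mul_eq_mul_div, le_div_iff₀ (by positivity)]
    gcongr

theorem exists_flow_curve (Φ : B → B)
    (hΦa : AnalyticOnNhd ℂ Φ (UHP B))
    (hΦim : ∀ b ∈ UHP B, imPart (Φ b) ≤ 0)
    (hΦbd : ∀ ε > (0:ℝ), ∃ C, ∀ b ∈ UHPeps B ε, ‖Φ b‖ ≤ C) (b : B) :
    ∃ x : ℝ → B, Continuous x ∧ (b ∈ UHP B → x 0 = b ∧ (∀ t, imPart b ≤ imPart (x t)) ∧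
      (∀ t, 0 ≤ t → x t + ∫ s in (0:ℝ)..t, Φ (x s) = b) ∧
      ∀ t, 0 ≤ t → HasDerivWithinAt x (-Φ (x t)) (Ici 0) t) := by
  let : CStarAlgebra B := {}
  by_cases hb : b ∈ UHP B
  swap
  · exact ⟨fun _ => b, continuous_const, fun h => absurd h hb⟩
  obtain ⟨ε, hε, hbε⟩ := mem_uhp.1 hb
  obtain ⟨C, hC⟩ := hΦbd ε hε
  obtain ⟨K, hK⟩ := uhpEps_lip Φ hΦa hΦbd hε
  have hsub : ∀ x : B, x - b ∈ {x : B | 0 ≤ imPart x} → x ∈ UHPeps B ε := by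
    intro x hx
    have hx : 0 ≤ imPart (x - b) := hx
    rw [imPart_sub, sub_nonneg] at hx
    exact uhpEps_mono_im hbε hx
  have hmem : ∀ x ∈ UHPeps B ε, x ∈ UHP B := fun x hx => mem_uhp.2 ⟨ε, hε, hx⟩
  obtain ⟨x, hx0, hxP, hxc, hxi, hxd⟩ := exists_global_solution {x : B | 0 ≤ imPart x}
    (isClosed_le continuous_const (imPartL (B := B)).continuous)
    (by simp [← imPartL_apply])
    (by
      intro a ha x hx
      have hx : 0 ≤ imPart x := hx
      show 0 ≤ imPart (a • x)
      rw [← imPartL_apply, map_smul]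
      exact smul_nonneg ha hx)
    (by
      intro g hg hgP t ht
      show 0 ≤ imPart _
      rw [← imPartL_apply, ← ContinuousLinearMap.intervalIntegral_comp_comm _
        (hg.intervalIntegrable _ _), intervalIntegral.integral_of_le ht]
      exact MeasureTheory.integral_nonneg fun s => hgP s)
    (fun x => -Φ x) b K C
    (by
      intro x hx y hy
      rw [edist_neg_neg]
      exact hK (hsub x hx) (hsub y hy))
    (by
      intro x hx
      rw [norm_neg]
      exact hC x (hsub x hx))
    (by
      intro x hx
      show 0 ≤ imPart (-Φ x)
      rw [imPart_neg]
      exact neg_nonneg.2 (hΦim x (hmem _ (hsub x hx))))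
  refine ⟨x, hxc, fun _ => ⟨hx0, fun t => ?_, fun t ht => ?_, hxd⟩⟩
  · have : 0 ≤ imPart (x t - b) := hxP t
    rwa [imPart_sub, sub_nonneg] at this
  · rw [hxi t ht, intervalIntegral.integral_neg]
    simp

end CStar

section Main
variable {B : Type*} [NormedRing B] [StarRing B] [CStarRing B] [CompleteSpace B]
    [NormedAlgebra ℂ B] [StarModule ℂ B] [PartialOrder B] [StarOrderedRing B]

/-- Short-time analyticity, uniformly near a point. -/
theorem short_time_analytic (Φ : B → B)
    (hΦa : AnalyticOnNhd ℂ Φ (UHP B))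
    (hΦbd : ∀ ε > (0:ℝ), ∃ C, ∀ b ∈ UHPeps B ε, ‖Φ b‖ ≤ C)
    (f : ℝ → B → B) (hfc : ∀ b, Continuous fun t => f t b)
    (hf0 : ∀ b ∈ UHP B, f 0 b = b)
    (hfim : ∀ b ∈ UHP B, ∀ t, imPart b ≤ imPart (f t b))
    (hfi : ∀ b ∈ UHP B, ∀ t, 0 ≤ t → f t b + ∫ s in (0:ℝ)..t, Φ (f s b) = b)
    (hfd : ∀ b ∈ UHP B, ∀ t, 0 ≤ t →
      HasDerivWithinAt (fun s => f s b) (-Φ (f t b)) (Ici 0) t)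
    (hfn : ∀ ε C : ℝ, (∀ b ∈ UHPeps B ε, ‖Φ b‖ ≤ C) → 0 < ε → ∀ b ∈ UHPeps B ε, ∀ t, 0 ≤ t →
      ‖f t b - b‖ ≤ C * t)
    (c : B) (hc : c ∈ UHP B) :
    ∃ ρ > 0, ∃ δ > 0, ∀ c' ∈ ball c ρ, ∀ t, 0 ≤ t → t ≤ δ → AnalyticAt ℂ (f t) c' := by
  obtain ⟨ε, hε, hcε⟩ := mem_uhp.1 hc
  have hε2 : 0 < ε / 2 := by positivity
  obtain ⟨C, hC⟩ := hΦbd (ε / 2) hε2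
  obtain ⟨K, hK⟩ := uhpEps_lip Φ hΦa hΦbd hε2
  have hC0 : 0 ≤ C := (norm_nonneg _).trans
    (hC c (uhpEps_ball hcε (by rw [dist_self]; positivity)))
  obtain ⟨p, R, hp⟩ := hΦa c hc
  obtain ⟨r0, hr0, hr0R⟩ : ∃ r0 : ℝ, 0 < r0 ∧ ENNReal.ofReal r0 ≤ R := by
    obtain ⟨q, hq0, hqR⟩ := ENNReal.lt_iff_exists_nnreal_btwn.1 hp.r_pos
    exact ⟨q, by simpa using hq0, by simpa using hqR.le⟩
  set r := min r0 (ε / 2) with hr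
  have hrpos : 0 < r := lt_min hr0 hε2
  have hp' : HasFPowerSeriesOnBall Φ p c (ENNReal.ofReal r) :=
    hp.mono (by simpa using hrpos) ((ENNReal.ofReal_le_ofReal (min_le_left _ _)).trans hr0R)
  have hball : ∀ b ∈ ball c r, b ∈ UHPeps B (ε / 2) := fun b hb =>
    uhpEps_ball hcε ((le_of_lt hb).trans (min_le_right _ _))
  have hmem : ∀ b ∈ UHPeps B (ε / 2), b ∈ UHP B := fun b hb => mem_uhp.2 ⟨_, hε2, hb⟩
  set δ := min (r / (2 * (C + 1))) (1 / (2 * (K + 1))) with hδ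
  have hδpos : 0 < δ := lt_min (by positivity) (by positivity)
  have hδC : C * δ < r / 2 := by
    have h1 : δ ≤ r / (2 * (C + 1)) := min_le_left _ _
    rw [le_div_iff₀ (by positivity)] at h1
    nlinarith
  have hδK : δ * K < 1 := by
    have h1 : δ ≤ 1 / (2 * (K + 1)) := min_le_right _ _
    rw [le_div_iff₀ (by positivity)] at h1
    have := K.coe_nonneg
    nlinarith
  refine ⟨r / 2, by positivity, δ, hδpos, fun c' hc' t ht0 htδ => ?_⟩
  let F : B → C(Icc 0 δ, B) := fun b => ⟨fun t => f t b, (hfc b).comp continuous_subtype_val⟩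
  have hnear : ∀ᶠ b in 𝓝 c', b ∈ ball c (r / 2) := isOpen_ball.mem_nhds hc'
  have hhalf : ∀ b ∈ ball c (r / 2), b ∈ UHPeps B (ε / 2) := fun b hb =>
    hball b (ball_subset_ball (by linarith) hb)
  have hFan : AnalyticAt ℂ F c' := by
    refine analytic_of_volterra hrpos hp' hδpos.le (hK.mono hball) hδK F ?_ ?_ ?_
    · have hlip : ∀ᶠ b in 𝓝 c', dist (F b) (F c') ≤ dist b c' * Real.exp (K * δ) := by
        filter_upwards [hnear] with b hb
        rw [ContinuousMap.dist_le (by positivity)]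
        intro s
        have hbm := hhalf b hb
        have hcm := hhalf c' hc'
        have hneg : LipschitzOnWith K (fun x => -Φ x) (UHPeps B (ε / 2)) := by
          intro x hx y hy
          rw [edist_neg_neg]
          exact hK hx hy
        have := dist_le_of_trajectories_ODE_of_mem (v := fun _ x => -Φ x)
          (s := fun _ => UHPeps B (ε / 2)) (a := 0) (b := δ) (K := K)
          (f := fun t => f t b) (g := fun t => f t c') (δ := dist b c')
          (fun t _ => hneg) (hfc b).continuousOn
          (fun t ht => (hfd b (hmem _ hbm) t ht.1).mono (Ici_subset_Ici.2 ht.1))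
          (fun t _ => uhpEps_mono_im hbm (hfim b (hmem _ hbm) t))
          (hfc c').continuousOn
          (fun t ht => (hfd c' (hmem _ hcm) t ht.1).mono (Ici_subset_Ici.2 ht.1))
          (fun t _ => uhpEps_mono_im hcm (hfim c' (hmem _ hcm) t))
          (by rw [hf0 b (hmem _ hbm), hf0 c' (hmem _ hcm)]) s s.2
        refine this.trans ?_
        rw [sub_zero]
        gcongr
        exact s.2.2
      rw [ContinuousAt, tendsto_iff_dist_tendsto_zero]
      have hlim : Tendsto (fun b => dist b c' * Real.exp (K * δ)) (𝓝 c') (𝓝 0) := by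
        have h : Continuous fun b => dist b c' * Real.exp (K * δ) := by fun_prop
        simpa using h.tendsto c'
      exact squeeze_zero' (Eventually.of_forall fun _ => dist_nonneg) hlip hlim
    · rw [mem_ball, ContinuousMap.dist_lt_iff hrpos]
      intro s
      have h1 := hfn (ε / 2) C hC hε2 c' (hhalf c' hc') s s.2.1
      have h2 : C * s ≤ C * δ := by gcongr; exact s.2.2
      have h3 : dist c' c < r / 2 := hc'
      have h4 := dist_triangle (f s c') c' c
      rw [dist_eq_norm (f s c') c'] at h4
      show dist (f s c') c < r
      linarith
    · filter_upwards [hnear] with b hb t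
      have h1 := hfi b (hmem _ (hhalf b hb)) t t.2.1
      refine Eq.trans ?_ h1
      show f t b + _ = f t b + _
      congr 1
      refine intervalIntegral.integral_congr fun s hs => ?_
      rw [uIcc_of_le t.2.1] at hs
      show Φ (f (projIcc 0 δ hδpos.le s) b) = _
      rw [projIcc_of_mem hδpos.le ⟨hs.1, hs.2.trans t.2.2⟩]
  exact ((ContinuousMap.evalCLM ℂ (⟨t, ht0, htδ⟩ : Icc 0 δ)).analyticAt (F c')).comp hFan

end Main

/-- Given an analytic map `Φ : H⁺(B) → B` with `Im Φ ≤ 0`, uniformly bounded on each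
`H^{+,ε}(B)`, there is a composition semigroup `(f_t)_{t ≥ 0}` of analytic self-maps
of `H⁺(B)` with `f_0 = id`, `(d/dt) f_t(b) = -Φ(f_t(b))`, `Im f_t(b) ≥ Im b`, and
`f_t → id` as `t ↓ 0` uniformly on each `H^{+,ε}(B)`. -/
theorem semigroup_generated_by_dissipative_analytic_map
    {B : Type*} [NormedRing B] [StarRing B] [CStarRing B] [CompleteSpace B]
    [NormedAlgebra ℂ B] [StarModule ℂ B] [PartialOrder B] [StarOrderedRing B]
    (Φ : B → B)
    (hΦa : AnalyticOnNhd ℂ Φ (UHP B))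
    (hΦim : ∀ b ∈ UHP B, imPart (Φ b) ≤ 0)
    (hΦbd : ∀ ε > (0:ℝ), ∃ C, ∀ b ∈ UHPeps B ε, ‖Φ b‖ ≤ C) :
    ∃ f : ℝ → B → B,
      (∀ b ∈ UHP B, f 0 b = b) ∧
      (∀ b ∈ UHP B, ∀ t : ℝ, 0 ≤ t →
        HasDerivWithinAt (fun s => f s b) (-(Φ (f t b))) (Ici 0) t) ∧
      (∀ t : ℝ, 0 ≤ t → ∀ b ∈ UHP B, f t b ∈ UHP B ∧ imPart b ≤ imPart (f t b)) ∧
      (∀ s t : ℝ, 0 ≤ s → 0 ≤ t → ∀ b ∈ UHP B, f (s + t) b = f s (f t b)) ∧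
      (∀ t : ℝ, 0 ≤ t → AnalyticOnNhd ℂ (f t) (UHP B)) ∧
      (∀ ε > (0:ℝ),
        TendstoUniformlyOn (fun t b => f t b) id (𝓝[>] (0:ℝ)) (UHPeps B ε)) := by
  choose x hxc hx using exists_flow_curve Φ hΦa hΦim hΦbd
  let f : ℝ → B → B := fun t b => x b t
  have hf0 : ∀ b ∈ UHP B, f 0 b = b := fun b hb => (hx b hb).1
  have hfim : ∀ b ∈ UHP B, ∀ t, imPart b ≤ imPart (f t b) := fun b hb => (hx b hb).2.1
  have hfi : ∀ b ∈ UHP B, ∀ t, 0 ≤ t → f t b + ∫ s in (0:ℝ)..t, Φ (f s b) = b :=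
    fun b hb => (hx b hb).2.2.1
  have hfd : ∀ b ∈ UHP B, ∀ t, 0 ≤ t →
      HasDerivWithinAt (fun s => f s b) (-Φ (f t b)) (Ici 0) t := fun b hb => (hx b hb).2.2.2
  have hfc : ∀ b, Continuous fun t => f t b := hxc
  have hmaps : ∀ b ∈ UHP B, ∀ t, f t b ∈ UHP B := by
    intro b hb t
    obtain ⟨ε, hε, hbε⟩ := mem_uhp.1 hb
    exact mem_uhp.2 ⟨ε, hε, uhpEps_mono_im hbε (hfim b hb t)⟩
  have hfn : ∀ ε C : ℝ, (∀ b ∈ UHPeps B ε, ‖Φ b‖ ≤ C) → 0 < ε → ∀ b ∈ UHPeps B ε, ∀ t, 0 ≤ t →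
      ‖f t b - b‖ ≤ C * t := by
    intro ε C hC hε b hb t ht
    have hbU : b ∈ UHP B := mem_uhp.2 ⟨ε, hε, hb⟩
    have h1 : f t b - b = -∫ s in (0:ℝ)..t, Φ (f s b) := by
      rw [sub_eq_iff_eq_add, neg_add_eq_sub]
      exact eq_sub_of_add_eq (hfi b hbU t ht)
    rw [h1, norm_neg]
    have h2 := intervalIntegral.norm_integral_le_of_norm_le_const (a := 0) (b := t) (C := C)
      (f := fun s => Φ (f s b)) (fun s _ => hC _ (uhpEps_mono_im hb (hfim b hbU s)))
    rwa [sub_zero, abs_of_nonneg ht] at h2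
  have hsemi : ∀ s t : ℝ, 0 ≤ s → 0 ≤ t → ∀ b ∈ UHP B, f (s + t) b = f s (f t b) := by
    intro s t hs ht b hb
    obtain ⟨ε, hε, hbε⟩ := mem_uhp.1 hb
    obtain ⟨K, hK⟩ := uhpEps_lip Φ hΦa hΦbd hε
    have hneg : LipschitzOnWith K (fun x => -Φ x) (UHPeps B ε) := by
      intro x hx y hy
      rw [edist_neg_neg]
      exact hK hx hy
    have hb' := hmaps b hb t
    have hbε' : f t b ∈ UHPeps B ε := uhpEps_mono_im hbε (hfim b hb t)
    refine ODE_solution_unique_of_mem_Icc_right (v := fun _ x => -Φ x)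
      (s := fun _ => UHPeps B ε) (a := 0) (b := s) (K := K)
      (f := fun u => f (u + t) b) (g := fun u => f u (f t b))
      (fun _ _ => hneg) ((hfc b).comp (continuous_add_const t)).continuousOn
      (fun u hu => ?_) (fun u _ => uhpEps_mono_im hbε (hfim b hb _))
      (hfc _).continuousOn
      (fun u hu => (hfd _ hb' u hu.1).mono (Ici_subset_Ici.2 hu.1))
      (fun u _ => uhpEps_mono_im hbε' (hfim _ hb' _)) ?_ (right_mem_Icc.2 hs)
    · have h1 := hfd b hb (u + t) (add_nonneg hu.1 ht)
      have h2 : HasDerivWithinAt (fun v : ℝ => v + t) 1 (Ici u) u :=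
        ((hasDerivAt_id u).add_const t).hasDerivWithinAt
      have h3 := HasDerivWithinAt.scomp (h := fun v : ℝ => v + t) u h1 h2
        (fun v hv => add_nonneg (hu.1.trans hv) ht)
      simpa [Function.comp_def] using h3
    · show f (0 + t) b = f 0 (f t b)
      rw [zero_add, hf0 _ hb']
  refine ⟨f, hf0, hfd, fun t _ b hb => ⟨hmaps b hb t, hfim b hb t⟩, hsemi, ?_, ?_⟩
  · intro T hT b hb
    have hcomp : IsCompact ((fun t => f t b) '' Icc 0 T) := isCompact_Icc.image (hfc b)
    obtain ⟨δ, hδ, hδa⟩ : ∃ δ > 0, ∀ c ∈ (fun t => f t b) '' Icc 0 T, ∀ t, 0 ≤ t → t ≤ δ →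
        AnalyticAt ℂ (f t) c := by
      refine hcomp.induction_on (p := fun S => ∃ δ > 0, ∀ c ∈ S, ∀ t, 0 ≤ t → t ≤ δ →
        AnalyticAt ℂ (f t) c) ⟨1, one_pos, by simp⟩ ?_ ?_ ?_
      · rintro S S' hSS' ⟨δ, hδ, h⟩
        exact ⟨δ, hδ, fun c hc => h c (hSS' hc)⟩
      · rintro S S' ⟨δ, hδ, h⟩ ⟨δ', hδ', h'⟩
        refine ⟨min δ δ', lt_min hδ hδ', ?_⟩
        rintro c (hc | hc) t ht ht'
        · exact h c hc t ht (ht'.trans (min_le_left _ _))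
        · exact h' c hc t ht (ht'.trans (min_le_right _ _))
      · rintro _ ⟨u, _, rfl⟩
        obtain ⟨ρ, hρ, δ, hδ, h⟩ := short_time_analytic Φ hΦa hΦbd f hfc hf0 hfim hfi hfd hfn
          (f u b) (hmaps b hb u)
        exact ⟨ball (f u b) ρ, mem_nhdsWithin_of_mem_nhds (ball_mem_nhds _ hρ), δ, hδ, h⟩
    have hopenU : ∀ᶠ b' in 𝓝 b, b' ∈ UHP B := by
      obtain ⟨ε, hε, hbε⟩ := mem_uhp.1 hb
      filter_upwards [ball_mem_nhds b (half_pos hε)] with z hz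
      exact mem_uhp.2 ⟨ε / 2, half_pos hε, uhpEps_ball hbε (le_of_lt hz)⟩
    have hind : ∀ n : ℕ, ∀ t, 0 ≤ t → t ≤ T → t ≤ n * δ → AnalyticAt ℂ (f t) b := by
      intro n
      induction n with
      | zero =>
        intro t ht0 _ ht
        have : t = 0 := le_antisymm (by simpa using ht) ht0
        subst this
        exact hδa b ⟨0, ⟨le_rfl, hT⟩, hf0 b hb⟩ 0 le_rfl hδ.le
      | succ n ih =>
        intro t ht0 htT ht
        push_cast at ht
        by_cases h : t ≤ n * δ
        · exact ih t ht0 htT h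
        push Not at h
        have hn : 0 ≤ n * δ := by positivity
        have h1 := ih (n * δ) hn (h.le.trans htT) le_rfl
        have h2 := hδa (f (n * δ) b) ⟨n * δ, ⟨hn, h.le.trans htT⟩, rfl⟩ (t - n * δ)
          (by linarith) (by linarith)
        refine (h2.fun_comp h1).congr ?_
        filter_upwards [hopenU] with b' hb'
        rw [← hsemi (t - n * δ) (n * δ) (by linarith) hn b' hb', sub_add_cancel]
    obtain ⟨n, hn⟩ := exists_nat_ge (T / δ)
    exact hind n T hT le_rfl (by rwa [div_le_iff₀ hδ] at hn)
  · intro ε hε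
    obtain ⟨C, hC⟩ := hΦbd ε hε
    rw [Metric.tendstoUniformlyOn_iff]
    intro η hη
    have hlim : Tendsto (fun t : ℝ => C * t) (𝓝[>] 0) (𝓝 0) := by
      have h : Continuous fun t : ℝ => C * t := by fun_prop
      have h2 := h.tendsto 0
      rw [mul_zero] at h2
      exact h2.mono_left nhdsWithin_le_nhds
    filter_upwards [hlim (Iio_mem_nhds hη), self_mem_nhdsWithin] with t ht ht0 b hb
    rw [dist_comm, dist_eq_norm]
    exact (hfn ε C hC hε b hb t (le_of_lt ht0)).trans_lt ht
end

section
/- (Classical part of the Bercovici–Pata limit theorem.) Let σ be a finite positive Borel measure on ℝ, γ ∈ ℝ, (μ_n) a sequence of Borel probability measures on ℝ, and k₁ < k₂ < ⋯ a strictly increasing sequence of positive integers. Let ν be a Borel probability measure on ℝ whose characteristic function satisfies ν̂(t) = exp( iγt + ∫_ℝ g_t(x) dσ(x) ) for all t ∈ ℝ, where g_t(x) = (e^{itx} − 1 − itx/(1 + x²))·(1 + x²)/x² for x ≠ 0 and g_t(0) = −t²/2. Then the following are equivalent: (1) the k_n-fold convolution powers μ_n^{∗k_n} converge weakly to ν;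 (2) the finite measures with density k_n x²/(1 + x²) with respect to μ_n converge weakly to σ, and k_n ∫_ℝ x/(1 + x²) dμ_n(x) → γ. -/
open MeasureTheory Filter Topology

/-- The characteristic function `μ̂(t) = ∫ e^{itx} dμ(x)` of a measure on `ℝ`. -/
noncomputable def charFn (μ : Measure ℝ) (t : ℝ) : ℂ :=
  ∫ x, Complex.exp (Complex.I * t * x) ∂μ

/-- Convolution of two Borel measures on `ℝ`. -/
noncomputable def mconv (μ ν : Measure ℝ) : Measure ℝ :=
  (μ.prod ν).map (fun p => p.1 + p.2)

/-- The `k`-fold convolution power `μ^{∗k}` (with `μ^{∗0} = δ₀`). -/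
noncomputable def convPow (μ : Measure ℝ) : ℕ → Measure ℝ
  | 0 => Measure.dirac 0
  | n + 1 => mconv μ (convPow μ n)

/-- Weak convergence of a sequence of finite Borel measures on `ℝ`. -/
def WeakLim (ρ : ℕ → Measure ℝ) (ρlim : Measure ℝ) : Prop :=
  ∀ g : BoundedContinuousFunction ℝ ℝ,
    Tendsto (fun n => ∫ x, g x ∂(ρ n)) atTop (𝓝 (∫ x, g x ∂ρlim))

/-- The integrand of the classical Lévy–Hinčin formula:
`g_t(x) = (e^{itx} - 1 - itx/(1+x²))(1+x²)/x²` for `x ≠ 0`, `g_t(0) = -t²/2`. -/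
noncomputable def levyIntegrand (t x : ℝ) : ℂ :=
  if x = 0 then -(t^2)/2
  else (Complex.exp (Complex.I * t * x) - 1 - Complex.I * t * x / (1 + x^2))
          * (1 + x^2) / x^2


namespace BP

lemma charFn_eq (μ : Measure ℝ) (t : ℝ) : charFn μ t = charFun μ t := by
  rw [charFn, charFun_apply_real]
  congr 1
  ext x
  congr 1
  ring

lemma isProb_convPow (μ : Measure ℝ) [IsProbabilityMeasure μ] (k : ℕ) :
    IsProbabilityMeasure (convPow μ k) := by
  induction k with
  | zero => rw [convPow]; infer_instance
  | succ n ih =>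
    rw [convPow, mconv]
    exact Measure.isProbabilityMeasure_map (by fun_prop)

lemma charFun_convPow (μ : Measure ℝ) [IsProbabilityMeasure μ] (k : ℕ) (t : ℝ) :
    charFun (convPow μ k) t = charFun μ t ^ k := by
  induction k with
  | zero => simp [convPow]
  | succ n ih =>
    have := isProb_convPow μ n
    have h : convPow μ (n + 1) = μ ∗ convPow μ n := rfl
    rw [h, charFun_conv, ih, pow_succ']

/-- Bundle a finite measure. -/
noncomputable def toFM (ρ : Measure ℝ) [h : IsFiniteMeasure ρ] : FiniteMeasure ℝ := ⟨ρ, h⟩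

/-- Bundle a probability measure. -/
noncomputable def toPM (ρ : Measure ℝ) [h : IsProbabilityMeasure ρ] : ProbabilityMeasure ℝ := ⟨ρ, h⟩

/-- Weak limits as convergence of finite measures. -/
lemma weakLim_iff (ρ : ℕ → Measure ℝ) [∀ n, IsFiniteMeasure (ρ n)] (ρ' : Measure ℝ)
    [IsFiniteMeasure ρ'] : WeakLim ρ ρ' ↔
    Tendsto (fun n => toFM (ρ n)) atTop (𝓝 (toFM ρ')) := by
  rw [FiniteMeasure.tendsto_iff_forall_integral_tendsto]
  rfl

lemma weakLim_complex {ρ : ℕ → Measure ℝ} [∀ n, IsFiniteMeasure (ρ n)] {ρ' : Measure ℝ}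
    [IsFiniteMeasure ρ'] (h : WeakLim ρ ρ') (f : BoundedContinuousFunction ℝ ℂ) :
    Tendsto (fun n => ∫ x, f x ∂(ρ n)) atTop (𝓝 (∫ x, f x ∂ρ')) := by
  rw [weakLim_iff, FiniteMeasure.tendsto_iff_forall_integral_rclike_tendsto ℂ] at h
  exact h f

lemma weakLim_prob (ρ : ℕ → Measure ℝ) [∀ n, IsProbabilityMeasure (ρ n)] (ρ' : Measure ℝ)
    [IsProbabilityMeasure ρ'] : WeakLim ρ ρ' ↔
    ∀ t, Tendsto (fun n => charFun (ρ n) t) atTop (𝓝 (charFun ρ' t)) := by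
  have := ProbabilityMeasure.tendsto_iff_tendsto_charFun (E := ℝ)
    (μ := fun n => toPM (ρ n)) (μ₀ := toPM ρ')
  rw [ProbabilityMeasure.tendsto_iff_forall_integral_tendsto] at this
  exact this

/-- Lévy's convergence theorem for finite measures. -/
lemma weakLim_of_charFun (ρ : ℕ → Measure ℝ) [∀ n, IsFiniteMeasure (ρ n)] (ρ' : Measure ℝ)
    [IsFiniteMeasure ρ']
    (h : ∀ t, Tendsto (fun n => charFun (ρ n) t) atTop (𝓝 (charFun ρ' t))) :
    WeakLim ρ ρ' := by
  have hm : Tendsto (fun n => (ρ n).real Set.univ) atTop (𝓝 (ρ'.real Set.univ)) := by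
    have := (Complex.continuous_re.tendsto _).comp (h 0)
    simpa [Function.comp_def, charFun_zero] using this
  rw [weakLim_iff]
  set R : ℕ → FiniteMeasure ℝ := fun n => toFM (ρ n) with hR
  set R' : FiniteMeasure ℝ := toFM ρ' with hR'
  have hmass : Tendsto (fun n => (R n).mass) atTop (𝓝 R'.mass) := by
    rw [← NNReal.tendsto_coe]
    exact hm
  by_cases h0 : R' = 0
  · rw [h0]
    apply FiniteMeasure.tendsto_zero_of_tendsto_zero_mass
    simpa [h0] using hmass
  · apply FiniteMeasure.tendsto_of_tendsto_normalize_testAgainstNN_of_tendsto_mass _ hmass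
    apply ProbabilityMeasure.tendsto_of_tendsto_charFun
    intro t
    have key : ∀ S : FiniteMeasure ℝ, S ≠ 0 →
        charFun (S.normalize : Measure ℝ) t = ((S.mass : ℝ) : ℂ)⁻¹ * charFun (S : Measure ℝ) t := by
      intro S hS
      rw [S.toMeasure_normalize_eq_of_nonzero hS]
      rw [charFun_apply, charFun_apply]
      have : (S.mass⁻¹ • (S : Measure ℝ)) = ((S.mass⁻¹ : NNReal) : ENNReal) • (S : Measure ℝ) := rfl
      rw [this, integral_smul_measure]
      simp
    have hne : ∀ᶠ n in atTop, R n ≠ 0 := by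
      have : R'.mass ≠ 0 := by simpa using h0
      filter_upwards [hmass.eventually_ne this] with n hn
      simpa using hn
    rw [key _ h0]
    have h1 : Tendsto (fun n => (((R n).mass : ℝ) : ℂ)⁻¹ * charFun (R n : Measure ℝ) t) atTop
      (𝓝 (((R'.mass : ℝ) : ℂ)⁻¹ * charFun (R' : Measure ℝ) t)) := by
      apply Tendsto.mul _ (h t)
      apply Tendsto.inv₀
      · exact (Complex.continuous_ofReal.tendsto _).comp (NNReal.tendsto_coe.2 hmass)
      · simpa using h0
    refine h1.congr' ?_
    filter_upwards [hne] with n hn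
    rw [key _ hn]

/-- `(1 + z n / k n) ^ k n → exp z`. -/
lemma tendsto_pow_exp (k : ℕ → ℕ) (hk : StrictMono k) (a : ℕ → ℂ) (z : ℂ)
    (h : Tendsto (fun n => (k n : ℂ) * (a n - 1)) atTop (𝓝 z)) :
    Tendsto (fun n => a n ^ k n) atTop (𝓝 (Complex.exp z)) := by
  classical
  let g : ℕ → ℂ := fun m => if hm : ∃ n, k n = m then a hm.choose - 1 else z / m
  have hg : ∀ n, g (k n) = a n - 1 := by
    intro n
    have hm : ∃ n', k n' = k n := ⟨n, rfl⟩
    have : hm.choose = n := hk.injective hm.choose_spec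
    simp only [g, dif_pos hm, this]
  have hlim : Tendsto (fun m : ℕ => (m : ℂ) * g m) atTop (𝓝 z) := by
    rw [Metric.tendsto_atTop] at h ⊢
    intro ε hε
    obtain ⟨N, hN⟩ := h ε hε
    refine ⟨k N + 1, fun m hm => ?_⟩
    by_cases hx : ∃ n, k n = m
    · obtain ⟨n, rfl⟩ := hx
      rw [hg]
      apply hN
      have : k N < k n := by omega
      exact (hk.lt_iff_lt.1 this).le
    · simp only [g, dif_neg hx]
      have : (m : ℂ) ≠ 0 := by
        have : m ≠ 0 := by omega
        exact_mod_cast this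
      rw [mul_div_cancel₀ _ this]
      simpa using hε
  have := (Complex.tendsto_one_add_pow_exp_of_tendsto hlim).comp hk.tendsto_atTop
  refine this.congr fun n => ?_
  simp [hg]


lemma norm_expI (t x : ℝ) : ‖Complex.exp (Complex.I * t * x)‖ = 1 := by
  have : Complex.I * t * x = ((t * x : ℝ) : ℂ) * Complex.I := by push_cast; ring
  rw [this, Complex.norm_exp_ofReal_mul_I]

lemma norm_exp_taylor (t x : ℝ) :
    ‖Complex.exp (Complex.I * t * x) - 1 - Complex.I * t * x‖ ≤ 3 * (t * x) ^ 2 := by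
  have hn : ‖Complex.I * t * x‖ = |t * x| := by simp [abs_mul]
  by_cases h : |t * x| ≤ 1
  · have := Complex.norm_exp_sub_one_sub_id_le (x := Complex.I * t * x) (by rw [hn]; exact h)
    rw [hn, sq_abs] at this
    nlinarith [sq_nonneg (t * x)]
  · push Not at h
    have h1 : ‖Complex.exp (Complex.I * t * x) - 1 - Complex.I * t * x‖ ≤ 1 + 1 + |t * x| := by
      refine (norm_sub_le _ _).trans ?_
      rw [hn]
      gcongr
      refine (norm_sub_le _ _).trans ?_
      rw [norm_expI]; simp
    have h2 : (t * x) ^ 2 = |t * x| ^ 2 := (sq_abs _).symm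
    rw [h2]
    nlinarith

lemma one_add_sq_ne (x : ℝ) : (1 + (x : ℂ) ^ 2) ≠ 0 := by
  have : (1 + x ^ 2 : ℝ) ≠ 0 := by positivity
  exact_mod_cast this

lemma levy_eq {t x : ℝ} (hx : x ≠ 0) : levyIntegrand t x =
    (Complex.exp (Complex.I * t * x) - 1 - Complex.I * t * x) / x ^ 2 * (1 + x ^ 2)
      + Complex.I * t * x := by
  rw [levyIntegrand, if_neg hx]
  have h1 : (x : ℂ) ≠ 0 := by exact_mod_cast hx
  have h2 := one_add_sq_ne x
  field_simp
  ring

lemma levy_mul (t x : ℝ) : ((x ^ 2 / (1 + x ^ 2) : ℝ) : ℂ) * levyIntegrand t x =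
    Complex.exp (Complex.I * t * x) - 1 - Complex.I * t * ((x / (1 + x ^ 2) : ℝ) : ℂ) := by
  by_cases hx : x = 0
  · simp [hx]
  rw [levyIntegrand, if_neg hx]
  have h1 : (x : ℂ) ≠ 0 := by exact_mod_cast hx
  have h2 := one_add_sq_ne x
  push_cast
  field_simp

lemma levy_bound (t x : ℝ) : ‖levyIntegrand t x‖ ≤ 6 * t ^ 2 + |t| + 4 := by
  by_cases hx : x = 0
  · rw [levyIntegrand, if_pos hx]
    have : ‖(-((t : ℂ) ^ 2) / 2)‖ = t ^ 2 / 2 := by simp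
    rw [this]
    have := abs_nonneg t
    nlinarith [sq_nonneg t]
  have hx2 : 0 < x ^ 2 := by positivity
  have hn1 : ‖(1 + (x : ℂ) ^ 2)‖ = 1 + x ^ 2 := by
    have : (1 + (x : ℂ) ^ 2) = ((1 + x ^ 2 : ℝ) : ℂ) := by push_cast; ring
    rw [this, Complex.norm_real, Real.norm_of_nonneg (by positivity)]
  have hn2 : ‖(x : ℂ) ^ 2‖ = x ^ 2 := by simp
  by_cases h : |x| ≤ 1
  · rw [levy_eq hx]
    have hx1 : x ^ 2 ≤ 1 := by rw [← sq_abs]; nlinarith [abs_nonneg x]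
    refine (norm_add_le _ _).trans ?_
    have h1 : ‖Complex.I * t * x‖ ≤ |t| := by
      simp only [norm_mul, Complex.norm_I, Complex.norm_real, Real.norm_eq_abs, one_mul]
      nlinarith [abs_nonneg t]
    have h2 : ‖(Complex.exp (Complex.I * t * x) - 1 - Complex.I * t * x) / x ^ 2 * (1 + x ^ 2)‖
        ≤ 3 * t ^ 2 * 2 := by
      rw [norm_mul, norm_div, hn1, hn2]
      have : ‖Complex.exp (Complex.I * t * x) - 1 - Complex.I * t * x‖ / x ^ 2 ≤ 3 * t ^ 2 := by
        rw [div_le_iff₀ hx2]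
        refine (norm_exp_taylor t x).trans (le_of_eq (by ring))
      apply mul_le_mul this (by linarith) (by positivity) (by positivity)
    linarith
  · push Not at h
    rw [levyIntegrand, if_neg hx]
    have hx1 : 1 ≤ x ^ 2 := by rw [← sq_abs]; nlinarith
    have e : (Complex.exp (Complex.I * t * x) - 1 - Complex.I * t * x / (1 + x ^ 2))
          * (1 + x ^ 2) / x ^ 2 = (Complex.exp (Complex.I * t * x) - 1) * ((1 + x ^ 2) / x ^ 2)
          - Complex.I * t / x := by
      have h1 : (x : ℂ) ≠ 0 := by exact_mod_cast hx
      have h2 := one_add_sq_ne x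
      field_simp
    rw [e]
    refine (norm_sub_le _ _).trans ?_
    have h1 : ‖Complex.I * t / x‖ ≤ |t| := by
      simp only [norm_div, norm_mul, Complex.norm_I, Complex.norm_real, Real.norm_eq_abs, one_mul]
      exact div_le_self (abs_nonneg _) h.le
    have h2 : ‖(Complex.exp (Complex.I * t * x) - 1) * ((1 + x ^ 2) / x ^ 2)‖ ≤ 2 * 2 := by
      rw [norm_mul, norm_div, hn1, hn2]
      have a1 : ‖Complex.exp (Complex.I * t * x) - 1‖ ≤ 2 := by
        refine (norm_sub_le _ _).trans ?_
        rw [norm_expI]; norm_num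
      have a2 : (1 + x ^ 2) / x ^ 2 ≤ 2 := by
        rw [div_le_iff₀ hx2]; linarith
      apply mul_le_mul a1 a2 (by positivity) (by positivity)
    nlinarith [sq_nonneg t]

lemma levy_meas : Measurable (fun p : ℝ × ℝ => levyIntegrand p.1 p.2) := by
  unfold levyIntegrand
  apply Measurable.ite
  · exact measurable_snd (measurableSet_singleton 0)
  · fun_prop
  · fun_prop

lemma levy_cont_left (x : ℝ) : Continuous (fun t => levyIntegrand t x) := by
  by_cases hx : x = 0
  · simp only [levyIntegrand, if_pos hx]
    fun_prop
  · simp only [levyIntegrand, if_neg hx]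
    fun_prop

lemma exp_taylor3 (z : ℂ) (hz : ‖z‖ ≤ 1) :
    ‖Complex.exp z - 1 - z - z ^ 2 / 2‖ ≤ 3 * ‖z‖ ^ 3 := by
  have := Complex.norm_exp_sub_sum_le_norm_mul_exp z 3
  simp only [Finset.sum_range_succ, Finset.sum_range_zero] at this
  norm_num at this
  have e : Complex.exp z - 1 - z - z ^ 2 / 2 = Complex.exp z - (1 + z + z ^ 2 / 2) := by ring
  rw [e]
  refine this.trans ?_
  have : Real.exp ‖z‖ ≤ 3 := by
    refine (Real.exp_le_exp.2 hz).trans ?_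
    have := Real.exp_one_lt_d9
    linarith
  have := pow_nonneg (norm_nonneg z) 3
  nlinarith

lemma levy_cont (t : ℝ) : Continuous (levyIntegrand t) := by
  rw [continuous_iff_continuousAt]
  intro x
  by_cases hx : x = 0
  · subst hx
    -- the quotient part
    have hq : Tendsto (fun x : ℝ =>
        (Complex.exp (Complex.I * t * x) - 1 - Complex.I * t * x) / (x : ℂ) ^ 2) (𝓝[≠] 0)
        (𝓝 (-(t : ℂ) ^ 2 / 2)) := by
      rw [tendsto_iff_norm_sub_tendsto_zero]
      have hlim : Tendsto (fun x : ℝ => 3 * |t| ^ 3 * |x|) (𝓝[≠] 0) (𝓝 0) := by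
        have : Continuous (fun x : ℝ => 3 * |t| ^ 3 * |x|) := by fun_prop
        have := (this.tendsto 0).mono_left (nhdsWithin_le_nhds (s := {0}ᶜ))
        simpa using this
      refine squeeze_zero' (Eventually.of_forall fun _ => norm_nonneg _) ?_ hlim
      have hsmall : ∀ᶠ x : ℝ in 𝓝[≠] 0, |t * x| < 1 := by
        have : Continuous (fun x : ℝ => |t * x|) := by fun_prop
        have := (this.tendsto 0).mono_left (nhdsWithin_le_nhds (s := {0}ᶜ))
        exact this.eventually_lt_const (by simp)
      filter_upwards [hsmall, self_mem_nhdsWithin] with x hx hx0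
      have hx0 : x ≠ 0 := hx0
      have hc : (x : ℂ) ≠ 0 := by exact_mod_cast hx0
      have hn : ‖Complex.I * t * x‖ = |t * x| := by simp [abs_mul]
      have h3 := exp_taylor3 (Complex.I * t * x) (by rw [hn]; exact hx.le)
      have e : (Complex.exp (Complex.I * t * x) - 1 - Complex.I * t * x) / (x : ℂ) ^ 2
          - -(t : ℂ) ^ 2 / 2 = (Complex.exp (Complex.I * t * x) - 1 - Complex.I * t * x
            - (Complex.I * t * x) ^ 2 / 2) / (x : ℂ) ^ 2 := by
        field_simp
        rw [Complex.I_sq]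
        ring
      rw [e, norm_div, hn] at *
      have : ‖(x : ℂ) ^ 2‖ = |x| ^ 2 := by simp
      have hp : 0 < |x| := abs_pos.2 hx0
      rw [this, div_le_iff₀ (by positivity)]
      refine h3.trans (le_of_eq ?_)
      rw [abs_mul]
      ring
    rw [continuousAt_iff_punctured_nhds]
    have h0 : levyIntegrand t 0 = -(t : ℂ) ^ 2 / 2 * (1 + ((0 : ℝ) : ℂ) ^ 2)
        + Complex.I * t * ((0 : ℝ) : ℂ) := by
      simp [levyIntegrand]
    rw [h0]
    have hc1 : Continuous (fun x : ℝ => (1 + (x : ℂ) ^ 2)) := by fun_prop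
    have hc2 : Continuous (fun x : ℝ => Complex.I * t * (x : ℂ)) := by fun_prop
    have := (hq.mul ((hc1.tendsto 0).mono_left (nhdsWithin_le_nhds (s := {0}ᶜ)))).add
      ((hc2.tendsto 0).mono_left (nhdsWithin_le_nhds (s := {0}ᶜ)))
    refine this.congr' ?_
    filter_upwards [self_mem_nhdsWithin] with x hx
    rw [levy_eq hx]
  · have hc : ContinuousAt (fun x : ℝ =>
        (Complex.exp (Complex.I * t * x) - 1 - Complex.I * t * x) / (x : ℂ) ^ 2 * (1 + (x : ℂ) ^ 2)
      + Complex.I * t * x) x := by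
      have : (x : ℂ) ^ 2 ≠ 0 := by
        apply pow_ne_zero; exact_mod_cast hx
      fun_prop (disch := exact this)
    refine hc.congr ?_
    filter_upwards [isOpen_ne.mem_nhds hx] with y hy
    rw [levy_eq hy]

/-- The Lévy integrand as a bounded continuous function. -/
noncomputable def levyBCF (t : ℝ) : BoundedContinuousFunction ℝ ℂ :=
  BoundedContinuousFunction.ofNormedAddCommGroup (levyIntegrand t) (levy_cont t)
    (6 * t ^ 2 + |t| + 4) (levy_bound t)

lemma levy_integrable (ρ : Measure ℝ) [IsFiniteMeasure ρ] (t : ℝ) :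
    Integrable (levyIntegrand t) ρ := (levyBCF t).integrable ρ

/-- The Lévy exponent. -/
noncomputable def psi (γ : ℝ) (ρ : Measure ℝ) (t : ℝ) : ℂ :=
  Complex.I * γ * t + ∫ x, levyIntegrand t x ∂ρ

lemma psi_zero (γ : ℝ) (ρ : Measure ℝ) : psi γ ρ 0 = 0 := by
  have : levyIntegrand 0 = 0 := by
    ext x
    simp [levyIntegrand]
  simp [psi, this]

lemma norm_intLevy_le (ρ : Measure ℝ) [IsFiniteMeasure ρ] (t : ℝ) :
    ‖∫ x, levyIntegrand t x ∂ρ‖ ≤ (6 * t ^ 2 + |t| + 4) * ρ.real Set.univ :=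
  norm_integral_le_of_norm_le_const (Eventually.of_forall (levy_bound t))

lemma norm_psi_le (γ : ℝ) (ρ : Measure ℝ) [IsFiniteMeasure ρ] (t : ℝ) :
    ‖psi γ ρ t‖ ≤ |γ| * |t| + (6 * t ^ 2 + |t| + 4) * ρ.real Set.univ := by
  rw [psi]
  refine (norm_add_le _ _).trans ?_
  have : ‖Complex.I * γ * t‖ = |γ| * |t| := by simp
  rw [this]
  gcongr
  exact norm_intLevy_le ρ t

lemma psi_cont (γ : ℝ) (ρ : Measure ℝ) [IsFiniteMeasure ρ] : Continuous (psi γ ρ) := by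
  unfold psi
  refine Continuous.add (by fun_prop) ?_
  rw [continuous_iff_continuousAt]
  intro t
  apply continuousAt_of_dominated (bound := fun _ => 6 * (|t| + 1) ^ 2 + (|t| + 1) + 4)
  · exact Eventually.of_forall fun s => (levy_cont s).aestronglyMeasurable
  · have : ∀ᶠ s in 𝓝 t, |s| < |t| + 1 :=
      (continuous_abs.tendsto t).eventually_lt_const (by linarith)
    filter_upwards [this] with s hs
    refine Eventually.of_forall fun x => (levy_bound s x).trans ?_
    rw [← sq_abs s]
    gcongr
  · exact integrable_const _
  · exact Eventually.of_forall fun x => (levy_cont_left x).continuousAt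

lemma levy_second_diff (t s x : ℝ) :
    levyIntegrand t x - (levyIntegrand (t + s) x + levyIntegrand (t - s) x) / 2 =
    if x = 0 then (s : ℂ) ^ 2 / 2 else
      Complex.exp (x * t * Complex.I) * ((1 + (x : ℂ) ^ 2) / (x : ℂ) ^ 2) *
        (1 - (Complex.exp (Complex.I * x * s) + Complex.exp (- Complex.I * x * s)) / 2) := by
  by_cases hx : x = 0
  · simp only [levyIntegrand, if_pos hx]
    push_cast
    ring
  · simp only [levyIntegrand, if_neg hx]
    have h1 : (x : ℂ) ≠ 0 := by exact_mod_cast hx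
    have h2 := one_add_sq_ne x
    have e1 : Complex.exp (Complex.I * ((t + s : ℝ) : ℂ) * x) =
        Complex.exp (x * t * Complex.I) * Complex.exp (Complex.I * x * s) := by
      rw [← Complex.exp_add]; congr 1; push_cast; ring
    have e2 : Complex.exp (Complex.I * ((t - s : ℝ) : ℂ) * x) =
        Complex.exp (x * t * Complex.I) * Complex.exp (- Complex.I * x * s) := by
      rw [← Complex.exp_add]; congr 1; push_cast; ring
    have e3 : Complex.exp (Complex.I * t * x) = Complex.exp (x * t * Complex.I) := by
      congr 1; ring
    rw [e1, e2, e3]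
    push_cast
    field_simp
    ring


lemma int_exp_neg : IntegrableOn (fun s : ℝ => Real.exp (-s)) (Set.Ioi 0) :=
  integrableOn_exp_neg_Ioi 0

lemma int_exp_neg_sq : IntegrableOn (fun s : ℝ => Real.exp (-s) * s ^ 2) (Set.Ioi 0) := by
  have := Real.GammaIntegral_convergent (s := 3) (by norm_num)
  refine this.congr_fun (fun s _ => ?_) measurableSet_Ioi
  norm_num

lemma integral_exp_neg_sq : ∫ s in Set.Ioi (0 : ℝ), Real.exp (-s) * s ^ 2 = 2 := by
  have := Real.Gamma_eq_integral (s := 3) (by norm_num)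
  have h3 : Real.Gamma 3 = 2 := by
    have := Real.Gamma_nat_eq_factorial 2
    have e : ((2 : ℕ) : ℝ) + 1 = 3 := by norm_num
    rw [e] at this
    rw [this]
    norm_num [Nat.factorial]
  rw [h3] at this
  rw [this]
  apply setIntegral_congr_fun measurableSet_Ioi
  intro s _
  norm_num

/-- The growth bound used for domination. -/
noncomputable def bd (t s : ℝ) : ℝ := 12 * t ^ 2 + |t| + 5 + 13 * s ^ 2

lemma bd_nonneg (t s : ℝ) : 0 ≤ bd t s := by
  unfold bd; positivity

lemma int_bd (t c : ℝ) : IntegrableOn (fun s : ℝ => Real.exp (-s) * (c * bd t s)) (Set.Ioi 0) := by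
  have : (fun s : ℝ => Real.exp (-s) * (c * bd t s)) = fun s =>
      (c * (12 * t ^ 2 + |t| + 5)) * Real.exp (-s) + (c * 13) * (Real.exp (-s) * s ^ 2) := by
    ext s; unfold bd; ring
  rw [this]
  exact (int_exp_neg.const_mul _).add (int_exp_neg_sq.const_mul _)

lemma bd_add (t s : ℝ) : 6 * (t + s) ^ 2 + |t + s| + 4 ≤ bd t s := by
  unfold bd
  have h1 : |t + s| ≤ |t| + |s| := abs_add_le _ _
  have h2 : |s| ≤ 1 + s ^ 2 := by rw [← sq_abs]; nlinarith [abs_nonneg s]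
  nlinarith [sq_nonneg (t - s)]

lemma bd_sub (t s : ℝ) : 6 * (t - s) ^ 2 + |t - s| + 4 ≤ bd t s := by
  have := bd_add t (-s)
  simpa [bd, sub_eq_add_neg] using this

lemma bd_self (t s : ℝ) : 6 * t ^ 2 + |t| + 4 ≤ bd t s := by
  unfold bd
  nlinarith [sq_nonneg t, sq_nonneg s]

lemma norm_diff_le {a b c : ℂ} {B : ℝ} (ha : ‖a‖ ≤ B) (hb : ‖b‖ ≤ B) (hc : ‖c‖ ≤ B) :
    ‖a - (b + c) / 2‖ ≤ 2 * B := by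
  refine (norm_sub_le _ _).trans ?_
  rw [norm_div]
  have : ‖b + c‖ ≤ B + B := (norm_add_le _ _).trans (add_le_add hb hc)
  have h2 : ‖(2 : ℂ)‖ = 2 := by norm_num
  rw [h2]
  linarith

/-- Laplace averaging of the second difference of the integrand. -/
lemma integral_second_diff (t x : ℝ) :
    ∫ s in Set.Ioi (0 : ℝ), (Real.exp (-s) : ℂ) *
      (levyIntegrand t x - (levyIntegrand (t + s) x + levyIntegrand (t - s) x) / 2) =
    Complex.exp (x * t * Complex.I) := by
  simp_rw [levy_second_diff]
  by_cases hx : x = 0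
  · simp only [if_pos hx]
    have : ∀ s : ℝ, (Real.exp (-s) : ℂ) * ((s : ℂ) ^ 2 / 2) =
        ((Real.exp (-s) * s ^ 2 : ℝ) : ℂ) / 2 := by
      intro s; push_cast; ring
    simp_rw [this]
    rw [integral_div, integral_complex_ofReal, integral_exp_neg_sq]
    simp [hx]
  · simp only [if_neg hx]
    set c : ℂ := Complex.exp (x * t * Complex.I) * ((1 + (x : ℂ) ^ 2) / (x : ℂ) ^ 2) with hc
    have e : ∀ s : ℝ, (Real.exp (-s) : ℂ) * (c *
        (1 - (Complex.exp (Complex.I * x * s) + Complex.exp (- Complex.I * x * s)) / 2)) =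
        c * Complex.exp ((-1 : ℂ) * s) - ((c / 2) * Complex.exp ((-1 + Complex.I * x) * s)
          + (c / 2) * Complex.exp ((-1 - Complex.I * x) * s)) := by
      intro s
      have e1 : Complex.exp ((-1 + Complex.I * x) * s) =
          Complex.exp ((-1 : ℂ) * s) * Complex.exp (Complex.I * x * s) := by
        rw [← Complex.exp_add]; congr 1; ring
      have e2 : Complex.exp ((-1 - Complex.I * x) * s) =
          Complex.exp ((-1 : ℂ) * s) * Complex.exp (- Complex.I * x * s) := by
        rw [← Complex.exp_add]; congr 1; ring
      have e3 : (Real.exp (-s) : ℂ) = Complex.exp ((-1 : ℂ) * s) := by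
        push_cast; congr 1; ring
      rw [e1, e2, e3]
      ring
    simp_rw [e]
    have r0 : (-1 : ℂ).re < 0 := by simp
    have r1 : (-1 + Complex.I * x).re < 0 := by simp
    have r2 : (-1 - Complex.I * x).re < 0 := by simp
    have i0 := (integrableOn_exp_mul_complex_Ioi r0 0).const_mul c
    have i1 := (integrableOn_exp_mul_complex_Ioi r1 0).const_mul (c / 2)
    have i2 := (integrableOn_exp_mul_complex_Ioi r2 0).const_mul (c / 2)
    have n1 : (-1 + Complex.I * x) ≠ 0 := fun h => by rw [h] at r1; simp at r1
    have n2 : (-1 - Complex.I * x) ≠ 0 := fun h => by rw [h] at r2; simp at r2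
    have i12 : Integrable (fun s : ℝ => (c / 2) * Complex.exp ((-1 + Complex.I * x) * s)
          + (c / 2) * Complex.exp ((-1 - Complex.I * x) * s)) (volume.restrict (Set.Ioi 0)) :=
      i1.add i2
    rw [integral_sub i0 i12, integral_add i1 i2]
    simp_rw [integral_const_mul]
    rw [integral_exp_mul_complex_Ioi r0, integral_exp_mul_complex_Ioi r1,
      integral_exp_mul_complex_Ioi r2]
    have hxc : (x : ℂ) ≠ 0 := by exact_mod_cast hx
    have hprod : (-1 + Complex.I * x) * (-1 - Complex.I * x) = 1 + (x : ℂ) ^ 2 := by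
      ring_nf; rw [Complex.I_sq]; ring
    have hinv : -1 / (-1 + Complex.I * x) + -1 / (-1 - Complex.I * x) = 2 / (1 + (x : ℂ) ^ 2) := by
      rw [← hprod]
      field_simp
      ring
    have h2 := one_add_sq_ne x
    have hfin : c - c / 2 * (2 / (1 + (x : ℂ) ^ 2)) = Complex.exp (x * t * Complex.I) := by
      rw [hc]
      field_simp
      ring
    rw [← hfin, ← hinv]
    simp
    ring

/-- Laplace averaging recovers the characteristic function of the Lévy measure. -/
lemma integral_psi (γ : ℝ) (ρ : Measure ℝ) [IsFiniteMeasure ρ] (t : ℝ) :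
    ∫ s in Set.Ioi (0 : ℝ), (Real.exp (-s) : ℂ) *
      (psi γ ρ t - (psi γ ρ (t + s) + psi γ ρ (t - s)) / 2) = charFun ρ t := by
  have h1 : ∀ s : ℝ, (Real.exp (-s) : ℂ) *
      (psi γ ρ t - (psi γ ρ (t + s) + psi γ ρ (t - s)) / 2) =
      ∫ x, (Real.exp (-s) : ℂ) *
      (levyIntegrand t x - (levyIntegrand (t + s) x + levyIntegrand (t - s) x) / 2) ∂ρ := by
    intro s
    have i2 : Integrable (fun x => (levyIntegrand (t + s) x + levyIntegrand (t - s) x) / 2) ρ :=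
      ((levy_integrable ρ _).add (levy_integrable ρ _)).div_const 2
    rw [integral_const_mul, integral_sub (levy_integrable ρ _) i2, integral_div,
      integral_add (levy_integrable ρ _) (levy_integrable ρ _)]
    simp only [psi]
    push_cast
    ring
  simp_rw [h1]
  rw [integral_integral_swap]
  · simp_rw [integral_second_diff]
    rw [charFun_apply_real]
    congr 1
    ext x
    congr 1
    ring
  · have hb : Integrable (fun p : ℝ × ℝ => Real.exp (-p.1) * (2 * bd t p.1))
        ((volume.restrict (Set.Ioi 0)).prod ρ) := (int_bd t 2).integrable.comp_fst ρ
    refine hb.mono' ?_ ?_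
    · have m1 : Measurable (fun p : ℝ × ℝ => levyIntegrand t p.2) :=
        levy_meas.comp (measurable_const.prodMk measurable_snd)
      have m2 : Measurable (fun p : ℝ × ℝ => levyIntegrand (t + p.1) p.2) :=
        levy_meas.comp ((measurable_fst.const_add t).prodMk measurable_snd)
      have m3 : Measurable (fun p : ℝ × ℝ => levyIntegrand (t - p.1) p.2) :=
        levy_meas.comp ((measurable_fst.const_sub t).prodMk measurable_snd)
      have m0 : Measurable (fun p : ℝ × ℝ => (Real.exp (-p.1) : ℂ)) := by fun_prop
      exact (m0.mul (m1.sub ((m2.add m3).div_const 2))).aestronglyMeasurable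
    · refine Eventually.of_forall fun p => ?_
      simp only [Function.uncurry]
      rw [norm_mul, Complex.norm_real, Real.norm_of_nonneg (Real.exp_pos _).le]
      refine mul_le_mul_of_nonneg_left ?_ (Real.exp_pos _).le
      exact norm_diff_le ((levy_bound _ _).trans (bd_self _ _))
        ((levy_bound _ _).trans (bd_add _ _)) ((levy_bound _ _).trans (bd_sub _ _))

/-- Convergence of the exponents with bounds gives convergence of the Lévy measures. -/
lemma weakLim_of_psi (γ : ℕ → ℝ) (ρ : ℕ → Measure ℝ) [∀ n, IsFiniteMeasure (ρ n)]
    (γ' : ℝ) (ρ' : Measure ℝ) [IsFiniteMeasure ρ'] (G M : ℝ)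
    (hG : ∀ᶠ n in atTop, |γ n| ≤ G) (hM : ∀ᶠ n in atTop, (ρ n).real Set.univ ≤ M)
    (h : ∀ t, Tendsto (fun n => psi (γ n) (ρ n) t) atTop (𝓝 (psi γ' ρ' t))) :
    WeakLim ρ ρ' := by
  apply weakLim_of_charFun
  intro t
  simp_rw [← fun n => integral_psi (γ n) (ρ n) t]
  rw [← integral_psi γ' ρ' t]
  apply tendsto_integral_filter_of_dominated_convergence
    (bound := fun s => Real.exp (-s) * ((2 * (G + M)) * bd t s))
  · refine Eventually.of_forall fun n => Continuous.aestronglyMeasurable ?_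
    have := psi_cont (γ n) (ρ n)
    fun_prop
  · filter_upwards [hG, hM] with n hGn hMn
    refine Eventually.of_forall fun s => ?_
    rw [norm_mul, Complex.norm_real, Real.norm_of_nonneg (Real.exp_pos _).le]
    refine mul_le_mul_of_nonneg_left ?_ (Real.exp_pos _).le
    have key : ∀ u, 6 * u ^ 2 + |u| + 4 ≤ bd t s →
        ‖psi (γ n) (ρ n) u‖ ≤ (G + M) * bd t s := by
      intro u hu
      refine (norm_psi_le _ _ u).trans ?_
      have h1 : |u| ≤ bd t s := by nlinarith [sq_nonneg u]
      have h2 : |γ n| * |u| ≤ G * bd t s :=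
        mul_le_mul hGn h1 (abs_nonneg _) ((abs_nonneg _).trans hGn)
      have h3 : (6 * u ^ 2 + |u| + 4) * (ρ n).real Set.univ ≤ bd t s * M :=
        mul_le_mul hu hMn measureReal_nonneg (bd_nonneg t s)
      linarith
    rw [mul_assoc]
    exact norm_diff_le (key _ (bd_self _ _)) (key _ (bd_add _ _)) (key _ (bd_sub _ _))
  · exact (int_bd t _).integrable
  · refine Eventually.of_forall fun s => ?_
    exact ((h t).sub (((h _).add (h _)).div_const 2)).const_mul _


/-- The measure `k x²/(1+x²) dμ`. -/
noncomputable def sig (μ : Measure ℝ) (k : ℕ) : Measure ℝ :=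
  μ.withDensity (fun x => ENNReal.ofReal ((k : ℝ) * x ^ 2 / (1 + x ^ 2)))

lemma frac_nonneg (k : ℕ) (x : ℝ) : 0 ≤ (k : ℝ) * x ^ 2 / (1 + x ^ 2) := by positivity

lemma frac_le (k : ℕ) (x : ℝ) : (k : ℝ) * x ^ 2 / (1 + x ^ 2) ≤ k := by
  rw [div_le_iff₀ (by positivity)]
  nlinarith [(Nat.cast_nonneg k : (0 : ℝ) ≤ k)]

lemma frac_cont (k : ℕ) : Continuous (fun x : ℝ => (k : ℝ) * x ^ 2 / (1 + x ^ 2)) := by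
  have : ∀ x : ℝ, 1 + x ^ 2 ≠ 0 := fun x => by positivity
  fun_prop (disch := assumption)

instance sig_finite (μ : Measure ℝ) [IsFiniteMeasure μ] (k : ℕ) : IsFiniteMeasure (sig μ k) := by
  apply isFiniteMeasure_withDensity
  refine ne_of_lt (lt_of_le_of_lt (lintegral_mono (g := fun _ => ENNReal.ofReal k) fun x => ?_) ?_)
  · exact ENNReal.ofReal_le_ofReal (frac_le k x)
  · rw [lintegral_const]
    exact ENNReal.mul_lt_top ENNReal.ofReal_lt_top (measure_lt_top _ _)

lemma integral_sig (μ : Measure ℝ) (k : ℕ) {E : Type*} [NormedAddCommGroup E] [NormedSpace ℝ E]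
    (f : ℝ → E) :
    ∫ x, f x ∂(sig μ k) = ∫ x, ((k : ℝ) * x ^ 2 / (1 + x ^ 2)) • f x ∂μ := by
  rw [sig, integral_withDensity_eq_integral_toReal_smul]
  · congr 1
    ext x
    rw [ENNReal.toReal_ofReal (frac_nonneg k x)]
  · exact (frac_cont k).measurable.ennreal_ofReal
  · exact Eventually.of_forall fun x => ENNReal.ofReal_lt_top

lemma xfrac_int (μ : Measure ℝ) [IsFiniteMeasure μ] :
    Integrable (fun x : ℝ => x / (1 + x ^ 2)) μ := by
  have hc : Continuous (fun x : ℝ => x / (1 + x ^ 2)) := by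
    have : ∀ x : ℝ, 1 + x ^ 2 ≠ 0 := fun x => by positivity
    fun_prop (disch := assumption)
  refine Integrable.of_bound hc.aestronglyMeasurable 1 (Eventually.of_forall fun x => ?_)
  rw [Real.norm_eq_abs, abs_div, abs_of_pos (by positivity : (0 : ℝ) < 1 + x ^ 2),
    div_le_one (by positivity), ← sq_abs]
  nlinarith [abs_nonneg x]

lemma exp_int (μ : Measure ℝ) [IsFiniteMeasure μ] (t : ℝ) :
    Integrable (fun x : ℝ => Complex.exp (Complex.I * t * x)) μ := by
  refine Integrable.of_bound (Continuous.aestronglyMeasurable (by fun_prop)) 1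
    (Eventually.of_forall fun x => ?_)
  rw [norm_expI]

lemma psi_sig (μ : Measure ℝ) [IsProbabilityMeasure μ] (k : ℕ) (t : ℝ) :
    psi ((k : ℝ) * ∫ x, x / (1 + x ^ 2) ∂μ) (sig μ k) t = k * (charFun μ t - 1) := by
  rw [psi, integral_sig]
  have e : ∀ x : ℝ, ((k : ℝ) * x ^ 2 / (1 + x ^ 2)) • levyIntegrand t x =
      (k : ℂ) * (Complex.exp (Complex.I * t * x) - 1
        - Complex.I * t * ((x / (1 + x ^ 2) : ℝ) : ℂ)) := by
    intro x
    rw [← levy_mul, Complex.real_smul]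
    push_cast
    ring
  simp_rw [e]
  have i1 : Integrable (fun x : ℝ => Complex.exp (Complex.I * t * x) - 1) μ :=
    (exp_int μ t).sub (integrable_const 1)
  have i2 : Integrable (fun x : ℝ => Complex.I * t * ((x / (1 + x ^ 2) : ℝ) : ℂ)) μ :=
    (xfrac_int μ).ofReal.const_mul _
  rw [integral_const_mul, integral_sub i1 i2, integral_sub (exp_int μ t) (integrable_const 1),
    integral_const_mul, integral_complex_ofReal, ← charFn_eq, charFn]
  simp
  ring

lemma mass_sig (μ : Measure ℝ) [IsProbabilityMeasure μ] (k : ℕ) :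
    (sig μ k).real Set.univ = ∫ x, (k : ℝ) * x ^ 2 / (1 + x ^ 2) ∂μ := by
  have := integral_sig μ k (fun _ => (1 : ℝ))
  simpa using this

lemma re_charFun (μ : Measure ℝ) [IsProbabilityMeasure μ] (t : ℝ) :
    (charFun μ t).re = ∫ x, Real.cos (t * x) ∂μ := by
  rw [← charFn_eq, charFn]
  have := integral_re (exp_int μ t)
  simp only [RCLike.re_to_complex] at this
  rw [← this]
  congr 1
  ext x
  have : Complex.I * t * x = ((t * x : ℝ) : ℂ) * Complex.I := by push_cast; ring
  rw [this, Complex.exp_ofReal_mul_I_re]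

lemma cos_int (μ : Measure ℝ) [IsFiniteMeasure μ] : Integrable (fun x : ℝ => Real.cos x) μ :=
  Integrable.of_bound Real.continuous_cos.aestronglyMeasurable 1
    (Eventually.of_forall fun x => by rw [Real.norm_eq_abs]; exact Real.abs_cos_le_one x)

lemma sig_mass_le (μ : Measure ℝ) [IsProbabilityMeasure μ] (k : ℕ) (C : ℝ)
    (h : ∀ t ∈ Set.Icc (-2 : ℝ) 2, ‖(k : ℂ) * (charFun μ t - 1)‖ ≤ C) :
    (sig μ k).real Set.univ ≤ 10 * C := by
  have hk : (0 : ℝ) ≤ k := Nat.cast_nonneg k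
  rw [mass_sig]
  have hS : MeasurableSet {x : ℝ | 1 < |x|} := measurableSet_lt measurable_const measurable_id.abs
  have h1 : (k : ℝ) * μ.real {x | 1 < |x|} ≤ 2 * C := by
    have := measureReal_abs_gt_le_integral_charFun (μ := μ) (r := 1) one_pos
    norm_num at this
    have h2 : (k : ℝ) * ‖∫ t in (-2 : ℝ)..2, 1 - charFun μ t‖ ≤ C * |2 - (-2)| := by
      have e : (k : ℝ) * ‖∫ t in (-2 : ℝ)..2, 1 - charFun μ t‖ =
          ‖∫ t in (-2 : ℝ)..2, (k : ℂ) * (1 - charFun μ t)‖ := by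
        rw [intervalIntegral.integral_const_mul, norm_mul]
        simp
      rw [e]
      apply intervalIntegral.norm_integral_le_of_norm_le_const
      intro t ht
      rw [Set.uIoc_of_le (by norm_num)] at ht
      have := h t ⟨ht.1.le, ht.2⟩
      have e2 : (k : ℂ) * (1 - charFun μ t) = -((k : ℂ) * (charFun μ t - 1)) := by ring
      rw [e2, norm_neg]
      exact this
    have h4 : |(2 : ℝ) - (-2)| = 4 := by norm_num
    rw [h4] at h2
    nlinarith
  have h2 : (k : ℝ) * ∫ x, (1 - Real.cos x) ∂μ ≤ C := by
    have h3 := h 1 (by norm_num)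
    have h4 : ((k : ℂ) * (charFun μ 1 - 1)).re = (k : ℝ) * ((charFun μ 1).re - 1) := by simp
    have h5 := (abs_le.1 (Complex.abs_re_le_norm ((k : ℂ) * (charFun μ 1 - 1)))).1
    rw [h4, re_charFun] at h5
    rw [integral_sub (integrable_const _) (cos_int μ)]
    simp only [one_mul] at h5
    simp
    linarith
  have hi : Integrable (fun x => {x : ℝ | 1 < |x|}.indicator (fun _ => (k : ℝ)) x
      + 8 * ((k : ℝ) * (1 - Real.cos x))) μ :=
    ((integrable_const _).indicator hS).add
      ((((integrable_const _).sub (cos_int μ)).const_mul _).const_mul _)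
  have hle : ∫ x, (k : ℝ) * x ^ 2 / (1 + x ^ 2) ∂μ ≤
      ∫ x, ({x : ℝ | 1 < |x|}.indicator (fun _ => (k : ℝ)) x
      + 8 * ((k : ℝ) * (1 - Real.cos x))) ∂μ := by
    apply integral_mono_of_nonneg (Eventually.of_forall (frac_nonneg k)) hi
    refine Eventually.of_forall fun x => ?_
    simp only
    have hc : 0 ≤ (k : ℝ) * (1 - Real.cos x) :=
      mul_nonneg hk (by linarith [Real.cos_le_one x])
    by_cases hx : 1 < |x|
    · rw [Set.indicator_of_mem (show x ∈ {x : ℝ | 1 < |x|} from hx)]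
      have := frac_le k x
      linarith
    · rw [Set.indicator_of_notMem (show x ∉ {x : ℝ | 1 < |x|} from hx)]
      push Not at hx
      have hq := Real.cos_le_one_sub_mul_cos_sq (x := x) (by linarith [Real.pi_gt_three])
      have hpi : (1 : ℝ) / 8 ≤ 2 / Real.pi ^ 2 := by
        rw [div_le_div_iff₀ (by norm_num) (by positivity)]
        nlinarith [Real.pi_le_four, Real.pi_pos]
      have hx8 : x ^ 2 ≤ 8 * (1 - Real.cos x) := by
        nlinarith [sq_nonneg x]
      have : (k : ℝ) * x ^ 2 / (1 + x ^ 2) ≤ (k : ℝ) * x ^ 2 :=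
        div_le_self (by positivity) (by nlinarith [sq_nonneg x])
      nlinarith
  refine hle.trans ?_
  have i8 : Integrable (fun x => 8 * ((k : ℝ) * (1 - Real.cos x))) μ :=
    (((integrable_const _).sub (cos_int μ)).const_mul _).const_mul _
  rw [integral_add ((integrable_const _).indicator hS) i8,
    integral_indicator_const _ hS, integral_const_mul, integral_const_mul, smul_eq_mul]
  linarith

lemma gam_le (γ : ℝ) (ρ : Measure ℝ) [IsFiniteMeasure ρ] (C : ℝ) (h : ‖psi γ ρ 1‖ ≤ C) :
    |γ| ≤ C + 11 * ρ.real Set.univ := by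
  have h1 := norm_intLevy_le ρ 1
  have e : Complex.I * γ = psi γ ρ 1 - ∫ x, levyIntegrand 1 x ∂ρ := by
    rw [psi]; push_cast; ring
  have e2 : |γ| = ‖Complex.I * (γ : ℂ)‖ := by simp
  rw [e2, e]
  refine (norm_sub_le _ _).trans ?_
  norm_num at h1
  linarith


/-- Continuous selection of roots. -/
lemma root_eq (T : ℝ) (hT : 0 ≤ T) (k : ℕ) (hk : 0 < k) (φ ψ : ℝ → ℂ) (hφ : Continuous φ)
    (hψ : Continuous ψ) (hφ0 : φ 0 = 1) (hψ0 : ψ 0 = 0)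
    (h : ∀ t ∈ Set.Icc (-T) T, ‖φ t ^ k * Complex.exp (-ψ t) - 1‖ ≤ 1 / 2) :
    ∀ t ∈ Set.Icc (-T) T,
      φ t = Complex.exp ((ψ t + Complex.log (φ t ^ k * Complex.exp (-ψ t))) / k) := by
  have hk' : (k : ℂ) ≠ 0 := by exact_mod_cast hk.ne'
  set w : ℝ → ℂ := fun t => φ t ^ k * Complex.exp (-ψ t) with hw
  set H : ℝ → ℂ := fun t => Complex.exp ((ψ t + Complex.log (w t)) / k) with hH
  have hslit : ∀ t ∈ Set.Icc (-T) T, w t ∈ Complex.slitPlane := by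
    intro t ht
    left
    have h1 := Complex.abs_re_le_norm (w t - 1)
    have h2 := (abs_le.1 (h1.trans (h t ht))).1
    simp at h2
    linarith
  have hwc : Continuous w := by fun_prop
  have hlog : ContinuousOn (fun t => Complex.log (w t)) (Set.Icc (-T) T) :=
    hwc.continuousOn.clog hslit
  have hHc : ContinuousOn H (Set.Icc (-T) T) :=
    ((hψ.continuousOn.add hlog).div_const _).cexp
  have hH0 : ∀ t, H t ≠ 0 := fun t => Complex.exp_ne_zero _
  have hHk : ∀ t ∈ Set.Icc (-T) T, H t ^ k = φ t ^ k := by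
    intro t ht
    have hw0 : w t ≠ 0 := Complex.slitPlane_ne_zero (hslit t ht)
    rw [hH]
    simp only
    rw [← Complex.exp_nat_mul, mul_div_cancel₀ _ hk', Complex.exp_add, Complex.exp_log hw0, hw]
    simp only
    rw [mul_left_comm, ← Complex.exp_add]
    simp
  have hq : ContinuousOn (fun t => φ t / H t) (Set.Icc (-T) T) :=
    hφ.continuousOn.div hHc (fun t _ => hH0 t)
  have hpre : IsPreconnected ((fun t => φ t / H t) '' Set.Icc (-T) T) :=
    isPreconnected_Icc.image _ hq
  have hfin : ((fun t => φ t / H t) '' Set.Icc (-T) T).Finite := by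
    have hroots : {z : ℂ | z ^ k = 1}.Finite := by
      have := (Polynomial.nthRoots k (1 : ℂ)).toFinset.finite_toSet
      refine this.subset fun z hz => ?_
      simpa [Polynomial.mem_nthRoots hk] using hz
    refine hroots.subset ?_
    rintro _ ⟨t, ht, rfl⟩
    simp only [Set.mem_ofPred_eq]
    rw [div_pow, hHk t ht]
    apply div_self
    rw [← hHk t ht]
    exact pow_ne_zero _ (hH0 t)
  have hsub : ((fun t => φ t / H t) '' Set.Icc (-T) T).Subsingleton := by
    by_contra hcon
    rw [Set.not_subsingleton_iff] at hcon
    exact hpre.infinite_of_nontrivial hcon hfin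
  intro t ht
  have h0 : (0 : ℝ) ∈ Set.Icc (-T) T := ⟨by linarith, hT⟩
  have := hsub (Set.mem_image_of_mem _ ht) (Set.mem_image_of_mem _ h0)
  have hone : H 0 = 1 := by simp [hH, hw, hφ0, hψ0]
  simp only [hone, hφ0, div_one] at this
  rw [div_eq_iff (hH0 t), one_mul] at this
  exact this

lemma charFun_diff_le (ρ : Measure ℝ) [IsProbabilityMeasure ρ] (s t δ : ℝ) (h : |t - s| ≤ δ) :
    ‖charFun ρ t - charFun ρ s‖ ≤ ∫ x, min 2 (δ * |x|) ∂ρ := by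
  rw [← charFn_eq, ← charFn_eq, charFn, charFn, ← integral_sub (exp_int ρ t) (exp_int ρ s)]
  have hδ : 0 ≤ δ := (abs_nonneg _).trans h
  refine norm_integral_le_of_norm_le ?_ (Eventually.of_forall fun x => ?_)
  · refine Integrable.of_bound (Continuous.aestronglyMeasurable (by fun_prop)) 2
      (Eventually.of_forall fun x => ?_)
    rw [Real.norm_of_nonneg (by positivity)]
    exact min_le_left _ _
  · apply le_min
    · refine (norm_sub_le _ _).trans ?_
      rw [norm_expI, norm_expI]; norm_num
    · have e : Complex.exp (Complex.I * t * x) - Complex.exp (Complex.I * s * x) =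
          Complex.exp (Complex.I * s * x) *
            (Complex.exp (Complex.I * (((t - s) * x : ℝ) : ℂ)) - 1) := by
        rw [mul_sub, ← Complex.exp_add, mul_one]
        congr 2
        push_cast; ring
      rw [e, norm_mul, norm_expI, one_mul]
      refine Real.norm_exp_I_mul_ofReal_sub_one_le.trans ?_
      rw [Real.norm_eq_abs, abs_mul]
      gcongr

/-- Weak convergence gives locally uniform convergence of characteristic functions. -/
lemma charFun_unif (ρ : ℕ → Measure ℝ) [∀ n, IsProbabilityMeasure (ρ n)] (ρ' : Measure ℝ)
    [IsProbabilityMeasure ρ'] (h : WeakLim ρ ρ') (T : ℝ) :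
    TendstoUniformlyOn (fun n => charFun (ρ n)) (charFun ρ') atTop (Set.Icc (-T) T) := by
  have hpt := (weakLim_prob ρ ρ').1 h
  have hloc : TendstoLocallyUniformly (fun n => charFun (ρ n)) (charFun ρ') atTop := by
    rw [Metric.tendstoLocallyUniformly_iff]
    intro ε hε t
    -- small modulus for the limit
    have hmod : ∃ δ > 0, ∫ x, min 2 (δ * |x|) ∂ρ' < ε / 4 := by
      have hlim : Tendsto (fun δ : ℝ => ∫ x, min 2 (δ * |x|) ∂ρ') (𝓝[>] 0) (𝓝 (∫ x, (0 : ℝ) ∂ρ')) := by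
        apply tendsto_integral_filter_of_dominated_convergence (bound := fun _ => 2)
        · exact Eventually.of_forall fun δ => Continuous.aestronglyMeasurable (by fun_prop)
        · filter_upwards [self_mem_nhdsWithin] with δ hδ
          have hδ : 0 < δ := hδ
          refine Eventually.of_forall fun x => ?_
          rw [Real.norm_of_nonneg (by positivity)]
          exact min_le_left _ _
        · exact integrable_const _
        · refine Eventually.of_forall fun x => ?_
          have hc : Continuous (fun δ : ℝ => min 2 (δ * |x|)) := by fun_prop
          have := (hc.tendsto 0).mono_left (nhdsWithin_le_nhds (s := Set.Ioi 0))
          simpa using this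
      rw [integral_zero] at hlim
      have h1 := hlim.eventually_lt_const (show (0 : ℝ) < ε / 4 by positivity)
      obtain ⟨δ, hδ1, hδ2⟩ := (h1.and self_mem_nhdsWithin).exists
      exact ⟨δ, hδ2, hδ1⟩
    obtain ⟨δ, hδ, hδ'⟩ := hmod
    refine ⟨Metric.closedBall t δ, Metric.closedBall_mem_nhds t hδ, ?_⟩
    let g : BoundedContinuousFunction ℝ ℝ :=
      BoundedContinuousFunction.ofNormedAddCommGroup (fun x => min 2 (δ * |x|)) (by fun_prop) 2
        (fun x => by
          rw [Real.norm_of_nonneg (by positivity)]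
          exact min_le_left _ _)
    have hg : Tendsto (fun n => ∫ x, min 2 (δ * |x|) ∂(ρ n)) atTop
      (𝓝 (∫ x, min 2 (δ * |x|) ∂ρ')) := h g
    have h2 := hg.eventually_lt_const hδ'
    have h3 : ∀ᶠ n in atTop, ‖charFun (ρ n) t - charFun ρ' t‖ < ε / 4 := by
      have := Metric.tendsto_nhds.1 (hpt t) (ε / 4) (by positivity)
      simpa [dist_eq_norm] using this
    filter_upwards [h2, h3] with n hn2 hn3 s hs
    have hs' : |s - t| ≤ δ := by simpa [Real.dist_eq] using hs
    have a1 := charFun_diff_le (ρ n) t s δ hs'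
    have a2 := charFun_diff_le ρ' t s δ hs'
    rw [dist_eq_norm]
    have e : charFun ρ' s - charFun (ρ n) s = (charFun ρ' s - charFun ρ' t)
      - (charFun (ρ n) s - charFun (ρ n) t) - (charFun (ρ n) t - charFun ρ' t) := by ring
    rw [e]
    refine ((norm_sub_le _ _).trans (add_le_add_left (norm_sub_le _ _) _)).trans_lt ?_
    linarith
  exact (tendstoLocallyUniformlyOn_iff_tendstoUniformlyOn_of_compact isCompact_Icc).1
    (hloc.tendstoLocallyUniformlyOn)

/-- Uniform convergence of the exponents `k (φ - 1)`. -/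
lemma exponent_unif (μ : ℕ → Measure ℝ) [∀ n, IsProbabilityMeasure (μ n)]
    (k : ℕ → ℕ) (hkmono : StrictMono k) (hkpos : ∀ n, 0 < k n)
    (ν : Measure ℝ) [IsProbabilityMeasure ν] (ψ : ℝ → ℂ) (hψ : Continuous ψ) (hψ0 : ψ 0 = 0)
    (hν : ∀ t, charFun ν t = Complex.exp (ψ t))
    (h : WeakLim (fun n => convPow (μ n) (k n)) ν) (T : ℝ) (hT : 0 ≤ T) :
    TendstoUniformlyOn (fun n t => (k n : ℂ) * (charFun (μ n) t - 1)) ψ atTop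
      (Set.Icc (-T) T) := by
  have : ∀ n, IsProbabilityMeasure (convPow (μ n) (k n)) := fun n => isProb_convPow _ _
  have hu := charFun_unif _ ν h T
  obtain ⟨C, hC⟩ := isCompact_Icc.exists_bound_of_continuousOn
    (s := Set.Icc (-T) T) (f := ψ) hψ.continuousOn
  obtain ⟨E, hE⟩ := isCompact_Icc.exists_bound_of_continuousOn
    (s := Set.Icc (-T) T) (f := fun t => Complex.exp (-ψ t)) (by fun_prop)
  have h0mem : (0 : ℝ) ∈ Set.Icc (-T) T := ⟨by linarith, hT⟩
  have hC0 : 0 ≤ C := (norm_nonneg _).trans (hC 0 h0mem)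
  have hE0 : 1 ≤ E := by
    have := hE 0 h0mem
    simpa [hψ0] using this
  rw [Metric.tendstoUniformlyOn_iff] at hu ⊢
  intro ε hε
  set η : ℝ := min (1 / 2) (ε / 4) with hη
  have hηpos : 0 < η := by positivity
  have hη1 : η ≤ 1 / 2 := min_le_left _ _
  have hη2 : η ≤ ε / 4 := min_le_right _ _
  have hkinf : Tendsto (fun n => (k n : ℝ)) atTop atTop :=
    tendsto_natCast_atTop_atTop.comp hkmono.tendsto_atTop
  filter_upwards [hu (η / E) (by positivity), hkinf.eventually_ge_atTop (C + 1),
    hkinf.eventually_gt_atTop ((C + 1) ^ 2 / (ε / 2))] with n hn hk1 hk2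
  have hkp : (0 : ℝ) < k n := by exact_mod_cast hkpos n
  have hkc : (k n : ℂ) ≠ 0 := by exact_mod_cast (hkpos n).ne'
  have hclose : ∀ t ∈ Set.Icc (-T) T,
      ‖charFun (μ n) t ^ k n * Complex.exp (-ψ t) - 1‖ ≤ η := by
    intro t ht
    have h1 := hn t ht
    rw [dist_eq_norm, charFun_convPow, hν, ← norm_neg, neg_sub] at h1
    have e : charFun (μ n) t ^ k n * Complex.exp (-ψ t) - 1 =
        (charFun (μ n) t ^ k n - Complex.exp (ψ t)) * Complex.exp (-ψ t) := by
      rw [sub_mul, ← Complex.exp_add]; simp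
    rw [e, norm_mul]
    calc _ ≤ η / E * E := mul_le_mul h1.le (hE t ht) (norm_nonneg _) (by positivity)
      _ = η := by field_simp
  have hroot := root_eq T hT (k n) (hkpos n) (charFun (μ n)) ψ (by fun_prop) hψ (by simp) hψ0
    (fun t ht => (hclose t ht).trans hη1)
  intro t ht
  set w := charFun (μ n) t ^ k n * Complex.exp (-ψ t) with hw
  set u := ψ t + Complex.log w with hu'
  have hlog : ‖Complex.log w‖ ≤ 3 / 2 * η := by
    have := Complex.norm_log_one_add_half_le_self (z := w - 1) ((hclose t ht).trans hη1)
    rw [add_sub_cancel] at this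
    refine this.trans ?_
    gcongr
    exact hclose t ht
  have hun : ‖u‖ ≤ C + 1 := by
    refine (norm_add_le _ _).trans ?_
    have := hC t ht
    linarith
  have hukn : ‖u / k n‖ ≤ (C + 1) / k n := by
    rw [norm_div, Complex.norm_natCast]
    gcongr
  have huk : ‖u / k n‖ ≤ 1 := hukn.trans (by rw [div_le_one hkp]; exact hk1)
  have htay := Complex.norm_exp_sub_one_sub_id_le huk
  rw [dist_eq_norm, ← norm_neg, neg_sub, hroot t ht]
  have e : (k n : ℂ) * (Complex.exp (u / k n) - 1) - ψ t =
      k n * (Complex.exp (u / k n) - 1 - u / k n) + Complex.log w := by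
    rw [mul_sub (k n : ℂ) _ (u / k n), mul_div_cancel₀ _ hkc, hu']
    ring
  rw [e]
  refine (norm_add_le _ _).trans_lt ?_
  rw [norm_mul, Complex.norm_natCast]
  have h5 : (k n : ℝ) * ‖Complex.exp (u / k n) - 1 - u / k n‖ ≤ (C + 1) ^ 2 / k n := by
    calc _ ≤ (k n : ℝ) * ((C + 1) / k n) ^ 2 := by
          gcongr
          exact htay.trans (by gcongr)
      _ = (C + 1) ^ 2 / k n := by field_simp
  have h6 : (C + 1) ^ 2 / k n < ε / 2 := by
    rw [div_lt_iff₀ (by positivity)] at hk2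
    rw [div_lt_iff₀ hkp]
    linarith
  linarith

end BP

/-- (Classical part of the Bercovici–Pata limit theorem.) The convolution powers
`μ_n^{∗ k_n}` converge weakly to the classically infinitely divisible measure
`ν = ν_∗^{γ,σ}` iff `k_n x²/(1+x²) dμ_n → σ` weakly and
`k_n ∫ x/(1+x²) dμ_n → γ`. -/
theorem bercovici_pata_classical
    (σ : Measure ℝ) [IsFiniteMeasure σ] (γ : ℝ)
    (μ : ℕ → Measure ℝ) [∀ n, IsProbabilityMeasure (μ n)]
    (k : ℕ → ℕ) (hkmono : StrictMono k) (hkpos : ∀ n, 0 < k n)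
    (ν : Measure ℝ) [IsProbabilityMeasure ν]
    (hν : ∀ t : ℝ, charFn ν t =
      Complex.exp (Complex.I * γ * t + ∫ x, levyIntegrand t x ∂σ)) :
    WeakLim (fun n => convPow (μ n) (k n)) ν ↔
      (WeakLim (fun n => (μ n).withDensity
            (fun x => ENNReal.ofReal ((k n : ℝ) * x^2 / (1 + x^2)))) σ ∧
        Tendsto (fun n => (k n : ℝ) * ∫ x, x / (1 + x^2) ∂(μ n)) atTop (𝓝 γ)) := by
  have hν' : ∀ t, charFun ν t = Complex.exp (BP.psi γ σ t) := by
    intro t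
    rw [← BP.charFn_eq, hν, BP.psi]
  have hP : ∀ n, IsProbabilityMeasure (convPow (μ n) (k n)) := fun n => BP.isProb_convPow _ _
  change WeakLim (fun n => convPow (μ n) (k n)) ν ↔
    (WeakLim (fun n => BP.sig (μ n) (k n)) σ ∧
      Tendsto (fun n => (k n : ℝ) * ∫ x, x / (1 + x^2) ∂(μ n)) atTop (𝓝 γ))
  set g : ℕ → ℝ := fun n => (k n : ℝ) * ∫ x, x / (1 + x^2) ∂(μ n) with hg
  have hz : ∀ n t, BP.psi (g n) (BP.sig (μ n) (k n)) t = k n * (charFun (μ n) t - 1) :=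
    fun n t => BP.psi_sig (μ n) (k n) t
  constructor
  · intro h
    have hunif := BP.exponent_unif μ k hkmono hkpos ν (BP.psi γ σ) (BP.psi_cont γ σ)
      (BP.psi_zero γ σ) hν' h
    have hlim : ∀ t, Tendsto (fun n => BP.psi (g n) (BP.sig (μ n) (k n)) t) atTop
        (𝓝 (BP.psi γ σ t)) := by
      intro t
      simp_rw [hz]
      exact (hunif |t| (abs_nonneg t)).tendsto_at ⟨neg_abs_le t, le_abs_self t⟩
    obtain ⟨C, hC⟩ := isCompact_Icc.exists_bound_of_continuousOn
      (s := Set.Icc (-2 : ℝ) 2) (f := BP.psi γ σ) (BP.psi_cont γ σ).continuousOn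
    have hb : ∀ᶠ n in atTop, ∀ t ∈ Set.Icc (-2 : ℝ) 2,
        ‖(k n : ℂ) * (charFun (μ n) t - 1)‖ ≤ C + 1 := by
      have h2 := Metric.tendstoUniformlyOn_iff.1 (hunif 2 (by norm_num)) 1 one_pos
      filter_upwards [h2] with n hn t ht
      have h3 := hn t ht
      rw [dist_eq_norm, ← norm_neg, neg_sub] at h3
      have h4 := norm_le_norm_add_norm_sub' ((k n : ℂ) * (charFun (μ n) t - 1)) (BP.psi γ σ t)
      have h5 := hC t ht
      linarith
    have hM : ∀ᶠ n in atTop, (BP.sig (μ n) (k n)).real Set.univ ≤ 10 * (C + 1) := by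
      filter_upwards [hb] with n hn
      exact BP.sig_mass_le (μ n) (k n) (C + 1) hn
    have hG : ∀ᶠ n in atTop, |g n| ≤ (C + 1) + 11 * (10 * (C + 1)) := by
      filter_upwards [hb, hM] with n hn hMn
      have := BP.gam_le (g n) (BP.sig (μ n) (k n)) (C + 1)
        (by rw [hz]; exact hn 1 (by norm_num))
      linarith
    have hW := BP.weakLim_of_psi g (fun n => BP.sig (μ n) (k n)) γ σ _ _ hG hM hlim
    refine ⟨hW, ?_⟩
    have h1 := (hlim 1).sub (BP.weakLim_complex hW (BP.levyBCF 1))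
    have e : ∀ (γ : ℝ) (ρ : Measure ℝ), BP.psi γ ρ 1 - ∫ x, BP.levyBCF 1 x ∂ρ = Complex.I * γ := by
      intro γ ρ
      have : ∫ x, BP.levyBCF 1 x ∂ρ = ∫ x, levyIntegrand 1 x ∂ρ := rfl
      rw [this, BP.psi]
      push_cast
      ring
    simp_rw [e] at h1
    have h2 := (Complex.continuous_im.tendsto _).comp h1
    simpa [Function.comp_def] using h2
  · rintro ⟨hW, hg'⟩
    rw [BP.weakLim_prob]
    intro t
    simp_rw [BP.charFun_convPow]
    rw [hν']
    apply BP.tendsto_pow_exp k hkmono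
    simp_rw [← hz]
    unfold BP.psi
    refine Tendsto.add ?_ (BP.weakLim_complex hW (BP.levyBCF t))
    exact (((Complex.continuous_ofReal.tendsto _).comp hg').const_mul Complex.I).mul_const _
end

section
/- (Boolean part of the Bercovici–Pata limit theorem.) Let σ be a finite positive Borel measure on ℝ, γ ∈ ℝ, (μ_n) a sequence of Borel probability measures on ℝ, and k₁ < k₂ < ⋯ a strictly increasing sequence of positive integers. Let (ρ_n) be Borel probability measures on ℝ whose F-transforms satisfy F_{ρ_n}(z) = z + k_n (F_{μ_n}(z) − z) for all z ∈ ℂ⁺ (these are the Boolean convolution powers μ_n^{⊎k_n}), and let ν be a Borel probability measure on ℝ with F_ν(z) = z − γ − ∫_ℝ (1 + xz)/(z − x) dσ(x) for all z ∈ ℂ⁺. Then the following are equivalent: (1) ρ_n converges weakly to ν; (2) the finite measures with density k_n x²/(1 + x²) with respect to μ_n converge weakly to σ, and k_n ∫_ℝ x/(1 + x²) dμ_n(x) → γ. -/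
open MeasureTheory Filter Topology

/-- The Cauchy transform `G_μ(z) = ∫ 1/(z - x) dμ(x)` of a measure on `ℝ`. -/
noncomputable def cauchyTransform (μ : Measure ℝ) (z : ℂ) : ℂ :=
  ∫ x, (z - (x : ℂ))⁻¹ ∂μ

/-- The `F`-transform `F_μ = 1/G_μ`. -/
noncomputable def Ftransform (μ : Measure ℝ) (z : ℂ) : ℂ :=
  (cauchyTransform μ z)⁻¹

open scoped BoundedContinuousFunction

namespace BPB

lemma sub_ne {z : ℂ} (hz : z.im ≠ 0) (x : ℝ) : z - (x : ℂ) ≠ 0 := by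
  intro h
  apply hz
  have := congrArg Complex.im h
  simpa using this

lemma norm_inv_le {z : ℂ} (hz : z.im ≠ 0) (x : ℝ) : ‖(z - (x : ℂ))⁻¹‖ ≤ |z.im|⁻¹ := by
  rw [norm_inv]
  have h1 : |z.im| ≤ ‖z - (x : ℂ)‖ := by
    have := Complex.abs_im_le_norm (z - (x : ℂ))
    simpa using this
  exact inv_anti₀ (abs_pos.mpr hz) h1

lemma cont_inv {z : ℂ} (hz : z.im ≠ 0) : Continuous (fun x : ℝ => (z - (x : ℂ))⁻¹) :=
  Continuous.inv₀ (by fun_prop) (fun x => sub_ne hz x)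

/-- the resolvent function as a bounded continuous function -/
noncomputable def res (z : ℂ) (hz : z.im ≠ 0) : ℝ →ᵇ ℂ :=
  BoundedContinuousFunction.ofNormedAddCommGroup (fun x : ℝ => (z - (x : ℂ))⁻¹)
    (cont_inv hz) (|z.im|⁻¹) (norm_inv_le hz)

@[simp] lemma res_apply (z : ℂ) (hz : z.im ≠ 0) (x : ℝ) : res z hz x = (z - (x : ℂ))⁻¹ := rfl

lemma int_inv {z : ℂ} (hz : z.im ≠ 0) (τ : Measure ℝ) [IsFiniteMeasure τ] :
    Integrable (fun x : ℝ => (z - (x : ℂ))⁻¹) τ :=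
  (res z hz).integrable τ

lemma inv_im (z : ℂ) (x : ℝ) : ((z - (x : ℂ))⁻¹).im = - (z.im / ((z.re - x)^2 + z.im^2)) := by
  rw [Complex.inv_im, Complex.normSq_apply]
  simp only [Complex.sub_im, Complex.ofReal_im, Complex.sub_re, Complex.ofReal_re, sub_zero]
  ring

lemma cauchy_im {z : ℂ} (hz : z.im ≠ 0) (τ : Measure ℝ) [IsFiniteMeasure τ] :
    (cauchyTransform τ z).im = - ∫ x, z.im / ((z.re - x)^2 + z.im^2) ∂τ := by
  have h := integral_im (𝕜 := ℂ) (int_inv hz τ)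
  simp only [RCLike.im_eq_complex_im] at h
  rw [cauchyTransform, ← h, ← integral_neg]
  exact integral_congr_ae (Eventually.of_forall fun x => inv_im z x)

lemma cauchy_ne {z : ℂ} (hz : 0 < z.im) (τ : Measure ℝ) [IsProbabilityMeasure τ] :
    cauchyTransform τ z ≠ 0 := by
  intro h
  have h1 := cauchy_im hz.ne' τ
  rw [h] at h1
  have hintg : Integrable (fun x : ℝ => z.im / ((z.re - x)^2 + z.im^2)) τ := by
    have := (int_inv hz.ne' τ).im.neg
    refine this.congr (Eventually.of_forall fun x => ?_)
    have := inv_im z x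
    simp only [Pi.neg_apply]
    simp only [RCLike.im_eq_complex_im]
    rw [this]; ring
  have hpos : ∀ x : ℝ, 0 < z.im / ((z.re - x)^2 + z.im^2) := fun x => by positivity
  have : 0 < ∫ x, z.im / ((z.re - x)^2 + z.im^2) ∂τ := by
    rw [integral_pos_iff_support_of_nonneg (fun x => (hpos x).le) hintg]
    have : Function.support (fun x : ℝ => z.im / ((z.re - x)^2 + z.im^2)) = Set.univ := by
      ext x; simpa using (hpos x).ne'
    rw [this]; simp
  simp only [Complex.zero_im] at h1
  linarith

/-- generators -/
def gen : Set (ℝ →ᵇ ℂ) :=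
  {f | f = 1 ∨ ∃ z : ℂ, z.im ≠ 0 ∧ 0 < z.re ∧ ∀ x, f x = (z - (x : ℂ))⁻¹}

/-- closed span of the generators -/
noncomputable def clos : Submodule ℂ (ℝ →ᵇ ℂ) := (Submodule.span ℂ gen).topologicalClosure

lemma clos_le {t : Submodule ℂ (ℝ →ᵇ ℂ)} (ht : IsClosed (t : Set (ℝ →ᵇ ℂ))) (h : gen ⊆ t) :
    clos ≤ t :=
  Submodule.topologicalClosure_minimal _ (Submodule.span_le.mpr h) ht

lemma gen_le : gen ⊆ (clos : Set (ℝ →ᵇ ℂ)) :=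
  Submodule.subset_span.trans (Submodule.le_topologicalClosure _)

lemma clos_closed : IsClosed (clos : Set (ℝ →ᵇ ℂ)) := Submodule.isClosed_topologicalClosure _

lemma gen_mul_ne {z w : ℂ} (hz : z.im ≠ 0) (hw : w.im ≠ 0) (hzr : 0 < z.re) (hwr : 0 < w.re)
    (hne : z ≠ w) : res z hz * res w hw ∈ clos := by
  have h : res z hz * res w hw = (w - z)⁻¹ • (res z hz - res w hw) := by
    ext x
    have h1 := sub_ne hz x
    have h2 := sub_ne hw x
    have h3 : w - z ≠ 0 := sub_ne_zero.mpr hne.symm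
    simp only [BoundedContinuousFunction.coe_mul, Pi.mul_apply, res_apply,
      BoundedContinuousFunction.coe_smul, BoundedContinuousFunction.coe_sub, Pi.sub_apply,
      smul_eq_mul]
    field_simp
    ring
  rw [h]
  refine clos.smul_mem _ (clos.sub_mem (gen_le ?_) (gen_le ?_))
  · exact Or.inr ⟨z, hz, hzr, fun x => rfl⟩
  · exact Or.inr ⟨w, hw, hwr, fun x => rfl⟩

lemma gen_mul_self {z : ℂ} (hz : z.im ≠ 0) (hzr : 0 < z.re) : res z hz * res z hz ∈ clos := by
  have him : ∀ n : ℕ, (z + ((1 / ((n : ℝ) + 1) : ℝ) : ℂ)).im ≠ 0 := fun n => by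
    rw [Complex.add_im, Complex.ofReal_im, add_zero]; exact hz
  have hp : ∀ n : ℕ, 0 < 1 / ((n : ℝ) + 1) := fun n => by positivity
  have key : Tendsto (fun n : ℕ => res z hz * res _ (him n)) atTop (𝓝 (res z hz * res z hz)) := by
    refine Tendsto.const_mul _ ?_
    rw [tendsto_iff_norm_sub_tendsto_zero]
    have hlim : Tendsto (fun n : ℕ => (1 / ((n : ℝ) + 1)) * (|z.im|⁻¹ * |z.im|⁻¹)) atTop (𝓝 0) := by
      have := (tendsto_one_div_add_atTop_nhds_zero_nat (𝕜 := ℝ)).mul_const (|z.im|⁻¹ * |z.im|⁻¹)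
      simpa using this
    refine squeeze_zero (fun n => norm_nonneg _) (fun n => ?_) hlim
    rw [BoundedContinuousFunction.norm_le (by have := hp n; positivity)]
    intro x
    set e : ℝ := 1 / ((n : ℝ) + 1) with he
    have h1 := sub_ne hz x
    have h2 := sub_ne (him n) x
    have hcalc : (res _ (him n) - res z hz) x
        = -(e : ℂ) * ((z + (e : ℂ) - (x : ℂ))⁻¹ * (z - (x : ℂ))⁻¹) := by
      simp only [BoundedContinuousFunction.coe_sub, Pi.sub_apply, res_apply]
      rw [← he] at h2 ⊢
      field_simp
      ring
    rw [hcalc, norm_mul, norm_mul, norm_neg, Complex.norm_real, Real.norm_of_nonneg (hp n).le]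
    have h3 := norm_inv_le (him n) x
    have h4 := norm_inv_le hz x
    rw [Complex.add_im, Complex.ofReal_im, add_zero] at h3
    gcongr
  refine clos_closed.mem_of_tendsto key (Eventually.of_forall fun n => ?_)
  refine gen_mul_ne hz (him n) hzr ?_ ?_
  · rw [Complex.add_re, Complex.ofReal_re]; have := hp n; linarith
  · intro h
    have := congrArg Complex.re h
    rw [Complex.add_re, Complex.ofReal_re] at this
    have := hp n; linarith

lemma gen_mul {f g : ℝ →ᵇ ℂ} (hf : f ∈ gen) (hg : g ∈ gen) : f * g ∈ clos := by
  rcases hf with rfl | ⟨z, hz, hzr, hfz⟩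
  · rw [one_mul]; exact gen_le hg
  rcases hg with rfl | ⟨w, hw, hwr, hgw⟩
  · rw [mul_one]; exact gen_le (Or.inr ⟨z, hz, hzr, hfz⟩)
  have h1 : f = res z hz := by ext x; rw [hfz]; rfl
  have h2 : g = res w hw := by ext x; rw [hgw]; rfl
  rw [h1, h2]
  by_cases h : z = w
  · subst h; exact gen_mul_self hz hzr
  · exact gen_mul_ne hz hw hzr hwr h

lemma clos_mul {f g : ℝ →ᵇ ℂ} (hf : f ∈ clos) (hg : g ∈ clos) : f * g ∈ clos := by
  have step1 : ∀ g ∈ gen, ∀ f ∈ clos, f * g ∈ clos := by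
    intro g hg f hf
    have : clos ≤ clos.comap (LinearMap.mulRight ℂ g) := by
      refine clos_le ?_ ?_
      · exact clos_closed.preimage (continuous_id.mul continuous_const : Continuous fun f => f * g)
      · intro f hf; exact gen_mul hf hg
    exact this hf
  have : clos ≤ clos.comap (LinearMap.mulLeft ℂ f) := by
    refine clos_le ?_ ?_
    · exact clos_closed.preimage (continuous_const.mul continuous_id : Continuous fun g => f * g)
    · intro g hg; exact step1 g hg f hf
  exact this hg

lemma clos_star {f : ℝ →ᵇ ℂ} (hf : f ∈ clos) : star f ∈ clos := by
  have : clos ≤ clos.comap (starLinearEquiv ℂ : (ℝ →ᵇ ℂ) ≃ₗ⋆[ℂ] (ℝ →ᵇ ℂ)).toLinearMap := by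
    refine clos_le ?_ ?_
    · exact clos_closed.preimage (continuous_star : Continuous fun f : ℝ →ᵇ ℂ => star f)
    · rintro f (rfl | ⟨z, hz, hzr, hfz⟩)
      · change star (1 : ℝ →ᵇ ℂ) ∈ clos
        rw [star_one]; exact gen_le (Or.inl rfl)
      · change star f ∈ clos
        refine gen_le (Or.inr ⟨(starRingEnd ℂ) z, by simpa using hz, by simpa using hzr, fun x => ?_⟩)
        rw [BoundedContinuousFunction.star_apply, hfz]
        simp
  exact this hf

/-- the closed star algebra generated by resolvents -/
noncomputable def alg : StarSubalgebra ℂ (ℝ →ᵇ ℂ) where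
  carrier := clos
  mul_mem' := clos_mul
  one_mem' := gen_le (Or.inl rfl)
  add_mem' := clos.add_mem
  zero_mem' := clos.zero_mem
  algebraMap_mem' := fun c => by
    rw [Algebra.algebraMap_eq_smul_one]
    exact clos.smul_mem _ (gen_le (Or.inl rfl))
  star_mem' := clos_star

lemma alg_sep : (alg.map (BoundedContinuousFunction.toContinuousMapStarₐ ℂ)).SeparatesPoints := by
  intro x y hxy
  have hz : (1 + Complex.I : ℂ).im ≠ 0 := by simp
  refine ⟨fun t => ((1 + Complex.I) - (t : ℂ))⁻¹, ?_, ?_⟩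
  · refine ⟨BoundedContinuousFunction.toContinuousMapStarₐ ℂ (res _ hz), ?_, rfl⟩
    exact ⟨res _ hz, gen_le (Or.inr ⟨_, hz, by simp, fun x => rfl⟩), rfl⟩
  · intro h
    have := inv_injective h
    apply hxy
    simpa using this

/-- functions along which integrals converge -/
noncomputable def convSub (τ : ℕ → Measure ℝ) [∀ n, IsProbabilityMeasure (τ n)]
    (τ₀ : Measure ℝ) [IsProbabilityMeasure τ₀] : Submodule ℂ (ℝ →ᵇ ℂ) where
  carrier := {g | Tendsto (fun n => ∫ x, g x ∂(τ n)) atTop (𝓝 (∫ x, g x ∂τ₀))}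
  add_mem' := by
    intro f g hf hg
    have h : ∀ (m : Measure ℝ) [IsProbabilityMeasure m],
        ∫ x, (f + g) x ∂m = ∫ x, f x ∂m + ∫ x, g x ∂m := fun m _ =>
      integral_add (f.integrable m) (g.integrable m)
    simp only [Set.mem_ofPred_eq, h] at *
    exact hf.add hg
  zero_mem' := by simp
  smul_mem' := by
    intro c f hf
    have h : ∀ (m : Measure ℝ), ∫ x, (c • f) x ∂m = c * ∫ x, f x ∂m := fun m =>
      integral_const_mul c _
    simp only [Set.mem_ofPred_eq, h] at *
    exact hf.const_mul c

lemma int_diff_le (m : Measure ℝ) [IsProbabilityMeasure m] (f g : ℝ →ᵇ ℂ) :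
    dist (∫ x, f x ∂m) (∫ x, g x ∂m) ≤ dist f g := by
  rw [dist_eq_norm, dist_eq_norm, ← integral_sub (f.integrable m) (g.integrable m)]
  have := norm_integral_le_of_norm_le_const (μ := m) (f := fun x => f x - g x) (C := ‖f - g‖)
    (Eventually.of_forall fun x => (f - g).norm_coe_le_norm x)
  simpa using this

lemma conv_closed (τ : ℕ → Measure ℝ) [∀ n, IsProbabilityMeasure (τ n)]
    (τ₀ : Measure ℝ) [IsProbabilityMeasure τ₀] :
    IsClosed (convSub τ τ₀ : Set (ℝ →ᵇ ℂ)) := by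
  refine isClosed_of_closure_subset fun g hg => ?_
  change Tendsto _ _ _
  rw [Metric.tendsto_atTop]
  intro ε hε
  obtain ⟨f, hf, hfg⟩ := Metric.mem_closure_iff.mp hg (ε / 3) (by positivity)
  have hf' : Tendsto (fun n => ∫ x, f x ∂(τ n)) atTop (𝓝 (∫ x, f x ∂τ₀)) := hf
  obtain ⟨N, hN⟩ := Metric.tendsto_atTop.mp hf' (ε / 3) (by positivity)
  refine ⟨N, fun n hn => ?_⟩
  have h1 := hN n hn
  have h2 := int_diff_le (τ n) g f
  have h3 := int_diff_le τ₀ f g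
  rw [dist_comm f g] at h3
  have h4 := dist_triangle4 (∫ x, g x ∂(τ n)) (∫ x, f x ∂(τ n)) (∫ x, f x ∂τ₀) (∫ x, g x ∂τ₀)
  linarith

lemma cauchy_conj (τ : Measure ℝ) (z : ℂ) :
    cauchyTransform τ ((starRingEnd ℂ) z) = (starRingEnd ℂ) (cauchyTransform τ z) := by
  rw [cauchyTransform, cauchyTransform, ← integral_conj]
  simp

lemma alg_conv (τ : ℕ → Measure ℝ) [∀ n, IsProbabilityMeasure (τ n)]
    (τ₀ : Measure ℝ) [IsProbabilityMeasure τ₀]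
    (h : ∀ z : ℂ, 0 < z.im → z ≠ Complex.I →
      Tendsto (fun n => cauchyTransform (τ n) z) atTop (𝓝 (cauchyTransform τ₀ z))) :
    clos ≤ convSub τ τ₀ := by
  refine clos_le (conv_closed τ τ₀) ?_
  rintro f (rfl | ⟨z, hz, hzr, hfz⟩)
  · change Tendsto _ _ _
    simp
  · change Tendsto _ _ _
    simp only [hfz]
    change Tendsto (fun n => cauchyTransform (τ n) z) atTop (𝓝 (cauchyTransform τ₀ z))
    rcases lt_or_gt_of_ne hz with hlt | hgt
    · have h1 := h ((starRingEnd ℂ) z) (by simpa using hlt) (by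
        intro h0
        have := congrArg Complex.re h0
        simp at this; linarith)
      simp only [cauchy_conj] at h1
      have h2 := (Complex.continuous_conj.tendsto _).comp h1
      simpa [Function.comp_def] using h2
    · refine h z hgt ?_
      rintro rfl
      simp at hzr


lemma tail_le {r : ℝ} (hr : 0 < r) (m : Measure ℝ) [IsProbabilityMeasure m] :
    m.real {x | r < ‖x‖} ≤ 2 * (1 + r * (cauchyTransform m (r * Complex.I)).im) ∧
    2 * (1 + r * (cauchyTransform m (r * Complex.I)).im) = ∫ x, 2 * (x^2 / (x^2 + r^2)) ∂m := by
  have him : ((r : ℂ) * Complex.I).im ≠ 0 := by simpa using hr.ne'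
  have hintg : Integrable (fun x : ℝ => x^2 / (x^2 + r^2)) m := by
    refine Integrable.of_bound (C := 1) ?_ (Eventually.of_forall fun x => ?_)
    · exact Continuous.aestronglyMeasurable (by
        refine Continuous.div (by fun_prop) (by fun_prop) (fun x => by positivity))
    · rw [Real.norm_of_nonneg (by positivity), div_le_one (by positivity)]
      nlinarith
  have heq : 2 * (1 + r * (cauchyTransform m (r * Complex.I)).im)
      = ∫ x, 2 * (x^2 / (x^2 + r^2)) ∂m := by
    rw [cauchy_im him, integral_const_mul]
    have h1 : ∀ x : ℝ, ((r : ℂ) * Complex.I).im / ((((r : ℂ) * Complex.I).re - x)^2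
        + ((r : ℂ) * Complex.I).im^2) = r⁻¹ * (1 - x^2 / (x^2 + r^2)) := by
      intro x
      have : x^2 + r^2 ≠ 0 := by positivity
      simp
      field_simp
      ring
    simp only [h1]
    rw [integral_const_mul, integral_sub (integrable_const _) hintg]
    simp
    field_simp
    ring
  refine ⟨?_, heq⟩
  rw [heq]
  have hs : MeasurableSet {x : ℝ | r < ‖x‖} := measurableSet_lt measurable_const measurable_norm
  rw [← integral_indicator_one hs]
  refine integral_mono_of_nonneg (Eventually.of_forall fun x => ?_) (hintg.const_mul 2)
    (Eventually.of_forall fun x => ?_)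
  · exact Set.indicator_nonneg (fun _ _ => zero_le_one) x
  · by_cases hx : x ∈ {x : ℝ | r < ‖x‖}
    · simp only [Set.indicator_of_mem hx, Pi.one_apply]
      have hx' : r < |x| := hx
      have : r^2 < x^2 := by rw [← sq_abs x]; gcongr
      rw [← mul_div_assoc, le_div_iff₀ (by positivity)]
      linarith
    · rw [Set.indicator_of_notMem hx]
      positivity

lemma tail_lim (m : Measure ℝ) [IsProbabilityMeasure m] :
    Tendsto (fun r : ℝ => ∫ x, 2 * (x^2 / (x^2 + r^2)) ∂m) atTop (𝓝 0) := by
  have : (0 : ℝ) = ∫ x : ℝ, (0 : ℝ) ∂m := by simp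
  rw [this]
  refine tendsto_integral_filter_of_dominated_convergence (fun _ => 2) ?_ ?_ (integrable_const _) ?_
  · filter_upwards [eventually_gt_atTop 0] with r hr
    exact Continuous.aestronglyMeasurable (by
        refine continuous_const.mul
          (Continuous.div (by fun_prop) (by fun_prop) (fun x => by positivity)))
  · filter_upwards [eventually_gt_atTop 0] with r hr
    refine Eventually.of_forall fun x => ?_
    rw [Real.norm_of_nonneg (by positivity)]
    have : x^2 / (x^2 + r^2) ≤ 1 := by
      rw [div_le_one (by positivity)]
      nlinarith
    linarith
  · refine Eventually.of_forall fun x => ?_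
    have h1 : Tendsto (fun r : ℝ => x^2 + r^2) atTop atTop :=
      tendsto_atTop_add_const_left _ _ (tendsto_pow_atTop two_ne_zero)
    have h2 := (h1.const_div_atTop (x^2)).const_mul 2
    simpa using h2

lemma tight (τ : ℕ → Measure ℝ) [∀ n, IsProbabilityMeasure (τ n)]
    (τ₀ : Measure ℝ) [IsProbabilityMeasure τ₀]
    (h : ∀ z : ℂ, 0 < z.im → z ≠ Complex.I →
      Tendsto (fun n => cauchyTransform (τ n) z) atTop (𝓝 (cauchyTransform τ₀ z))) :
    IsTightMeasureSet (Set.range τ) := by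
  refine isTightMeasureSet_range_of_tendsto_limsup_measure_norm_gt ?_
  have hlim : Tendsto (fun r : ℝ => ENNReal.ofReal (∫ x, 2 * (x^2 / (x^2 + r^2)) ∂τ₀)) atTop
      (𝓝 0) := by
    have := ENNReal.tendsto_ofReal (tail_lim τ₀)
    simpa using this
  refine tendsto_of_tendsto_of_tendsto_of_le_of_le' tendsto_const_nhds hlim
    (Eventually.of_forall fun _ => zero_le) ?_
  filter_upwards [eventually_gt_atTop 1] with r hr
  have hr0 : 0 < r := by linarith
  rw [← (tail_le hr0 τ₀).2]
  have hG := h ((r : ℂ) * Complex.I) (by simpa using hr0) (by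
    intro h0
    have := congrArg Complex.im h0
    simp at this
    linarith)
  have hG2 : Tendsto (fun n => ENNReal.ofReal
      (2 * (1 + r * (cauchyTransform (τ n) (r * Complex.I)).im))) atTop
      (𝓝 (ENNReal.ofReal (2 * (1 + r * (cauchyTransform τ₀ (r * Complex.I)).im)))) := by
    refine ENNReal.tendsto_ofReal ?_
    exact ((((Complex.continuous_im.tendsto _).comp hG).const_mul r).const_add 1).const_mul 2
  rw [← hG2.limsup_eq]
  refine limsup_le_limsup (Eventually.of_forall fun n => ?_)
  change (τ n) {x | r < ‖x‖} ≤ _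
  rw [← ofReal_measureReal]
  exact ENNReal.ofReal_le_ofReal (tail_le hr0 (τ n)).1

lemma weak_of_cauchy_prob (τ : ℕ → Measure ℝ) [∀ n, IsProbabilityMeasure (τ n)]
    (τ₀ : Measure ℝ) [IsProbabilityMeasure τ₀]
    (h : ∀ z : ℂ, 0 < z.im → z ≠ Complex.I →
      Tendsto (fun n => cauchyTransform (τ n) z) atTop (𝓝 (cauchyTransform τ₀ z))) :
    WeakLim τ τ₀ := by
  let P : ℕ → ProbabilityMeasure ℝ := fun n => ⟨τ n, inferInstance⟩
  let P₀ : ProbabilityMeasure ℝ := ⟨τ₀, inferInstance⟩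
  have key : Tendsto P atTop (𝓝 P₀) := by
    refine ProbabilityMeasure.tendsto_of_tight_of_separatesPoints ℂ ?_ alg_sep ?_
    · exact tight τ τ₀ h
    · intro g hg
      exact alg_conv τ τ₀ h hg
  intro g
  exact ProbabilityMeasure.tendsto_iff_forall_integral_tendsto.mp key g

lemma weak_of_cauchy (τ : ℕ → Measure ℝ) [∀ n, IsFiniteMeasure (τ n)]
    (τ₀ : Measure ℝ) [IsFiniteMeasure τ₀]
    (hm : Tendsto (fun n => (τ n).real Set.univ) atTop (𝓝 (τ₀.real Set.univ)))
    (h : ∀ z : ℂ, 0 < z.im → z ≠ Complex.I →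
      Tendsto (fun n => cauchyTransform (τ n) z) atTop (𝓝 (cauchyTransform τ₀ z))) :
    WeakLim τ τ₀ := by
  let Q : Measure ℝ → Measure ℝ := fun m =>
    ENNReal.ofReal (m.real Set.univ + 1)⁻¹ • (m + Measure.dirac 0)
  have hQ : ∀ m : Measure ℝ, IsFiniteMeasure m → IsProbabilityMeasure (Q m) := by
    intro m hm
    constructor
    have hp : 0 < m.real Set.univ + 1 := by positivity
    simp only [Q, Measure.smul_apply, Measure.add_apply, measure_univ, smul_eq_mul]
    rw [← ofReal_measureReal, ← ENNReal.ofReal_one, ← ENNReal.ofReal_add (by positivity) (by simp),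
      ← ENNReal.ofReal_mul (by positivity), inv_mul_cancel₀ hp.ne']
  have hI : ∀ m : Measure ℝ, IsFiniteMeasure m → ∀ g : ℝ →ᵇ ℝ,
      ∫ x, g x ∂(Q m) = (m.real Set.univ + 1)⁻¹ * (∫ x, g x ∂m + g 0) := by
    intro m hm g
    simp only [Q]
    rw [integral_smul_measure, integral_add_measure (g.integrable m) (g.integrable _),
      integral_dirac, ENNReal.toReal_ofReal (by positivity), smul_eq_mul]
  have hG : ∀ m : Measure ℝ, IsFiniteMeasure m → ∀ z : ℂ, 0 < z.im →
      cauchyTransform (Q m) z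
        = (((m.real Set.univ + 1)⁻¹ : ℝ) : ℂ) * (cauchyTransform m z + z⁻¹) := by
    intro m hm z hz
    simp only [Q, cauchyTransform]
    rw [integral_smul_measure, integral_add_measure (int_inv hz.ne' m) (int_inv hz.ne' _),
      integral_dirac, ENNReal.toReal_ofReal (by positivity), Complex.real_smul]
    simp
  have hne : τ₀.real Set.univ + 1 ≠ 0 := by positivity
  have hinv : Tendsto (fun n => ((τ n).real Set.univ + 1)⁻¹) atTop
      (𝓝 (τ₀.real Set.univ + 1)⁻¹) := (hm.add_const 1).inv₀ hne
  have : ∀ n, IsProbabilityMeasure (Q (τ n)) := fun n => hQ _ inferInstance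
  have : IsProbabilityMeasure (Q τ₀) := hQ _ inferInstance
  have hw : WeakLim (fun n => Q (τ n)) (Q τ₀) := by
    refine weak_of_cauchy_prob _ _ ?_
    intro z hz hzI
    simp only [hG _ inferInstance z hz]
    exact ((Complex.continuous_ofReal.tendsto _).comp hinv).mul ((h z hz hzI).add_const _)
  intro g
  have h1 := hw g
  simp only [hI _ inferInstance] at h1
  have h2 := ((hm.add_const 1).mul h1).sub_const (g 0)
  have h3 : ∀ m : Measure ℝ, (m.real Set.univ + 1) *
      ((m.real Set.univ + 1)⁻¹ * (∫ x, g x ∂m + g 0)) - g 0 = ∫ x, g x ∂m := by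
    intro m
    have : m.real Set.univ + 1 ≠ 0 := by positivity
    rw [mul_inv_cancel_left₀ this]; ring
  simpa only [h3] using h2

lemma weak_complex {τ : ℕ → Measure ℝ} [∀ n, IsFiniteMeasure (τ n)]
    {τ₀ : Measure ℝ} [IsFiniteMeasure τ₀] (h : WeakLim τ τ₀) (g : ℝ →ᵇ ℂ) :
    Tendsto (fun n => ∫ x, g x ∂(τ n)) atTop (𝓝 (∫ x, g x ∂τ₀)) := by
  let P : ℕ → FiniteMeasure ℝ := fun n => ⟨τ n, inferInstance⟩
  let P₀ : FiniteMeasure ℝ := ⟨τ₀, inferInstance⟩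
  have key : Tendsto P atTop (𝓝 P₀) := FiniteMeasure.tendsto_iff_forall_integral_tendsto.mpr h
  exact (FiniteMeasure.tendsto_iff_forall_integral_rclike_tendsto ℂ).mp key g

lemma weak_cauchy {τ : ℕ → Measure ℝ} [∀ n, IsFiniteMeasure (τ n)]
    {τ₀ : Measure ℝ} [IsFiniteMeasure τ₀] (h : WeakLim τ τ₀) {z : ℂ} (hz : 0 < z.im) :
    Tendsto (fun n => cauchyTransform (τ n) z) atTop (𝓝 (cauchyTransform τ₀ z)) :=
  weak_complex h (res z hz.ne')

lemma weak_mass {τ : ℕ → Measure ℝ} [∀ n, IsFiniteMeasure (τ n)]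
    {τ₀ : Measure ℝ} [IsFiniteMeasure τ₀] (h : WeakLim τ τ₀) :
    Tendsto (fun n => (τ n).real Set.univ) atTop (𝓝 (τ₀.real Set.univ)) := by
  simpa using h 1

/-- The Boolean Levy-Khintchine transform in terms of the Cauchy transform. -/
lemma nev {z : ℂ} (hz : 0 < z.im) (s : Measure ℝ) [IsFiniteMeasure s] :
    ∫ x, (1 + (x : ℂ) * z) / (z - (x : ℂ)) ∂s
      = - z * (s.real Set.univ : ℂ) + (1 + z^2) * cauchyTransform s z := by
  have h1 : ∀ x : ℝ, (1 + (x : ℂ) * z) / (z - (x : ℂ)) = -z + (1 + z^2) * (z - (x : ℂ))⁻¹ := by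
    intro x
    have := sub_ne hz.ne' x
    field_simp
    ring
  simp only [h1]
  rw [integral_add (integrable_const _) ((int_inv hz.ne' s).const_mul _), integral_const_mul,
    integral_const, cauchyTransform, Complex.real_smul]
  ring

/-- the measure with density `c x²/(1+x²)` -/
noncomputable def sg (c : ℝ) (m : Measure ℝ) : Measure ℝ :=
  m.withDensity (fun x => ENNReal.ofReal (c * x^2 / (1 + x^2)))

lemma sg_fin (c : ℝ) (m : Measure ℝ) [IsFiniteMeasure m] : IsFiniteMeasure (sg c m) := by
  refine isFiniteMeasure_withDensity_ofReal ?_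
  refine (Integrable.of_bound (C := |c|) ?_ (Eventually.of_forall fun x => ?_)).2
  · exact Continuous.aestronglyMeasurable (by
      refine Continuous.div (by fun_prop) (by fun_prop) (fun x => by positivity))
  · rw [norm_div, norm_mul, Real.norm_eq_abs, Real.norm_of_nonneg (sq_nonneg x),
      Real.norm_of_nonneg (by positivity : (0:ℝ) ≤ 1 + x^2), div_le_iff₀ (by positivity)]
    have := abs_nonneg c
    nlinarith

lemma sg_int {c : ℝ} (hc : 0 ≤ c) (m : Measure ℝ) (g : ℝ → ℂ) :
    ∫ x, g x ∂(sg c m) = ∫ x, ((c * x^2 / (1 + x^2) : ℝ) : ℂ) * g x ∂m := by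
  rw [sg, integral_withDensity_eq_integral_toReal_smul]
  · refine integral_congr_ae (Eventually.of_forall fun x => ?_)
    simp only
    rw [ENNReal.toReal_ofReal (by positivity), Complex.real_smul]
  · exact Measurable.ennreal_ofReal (by fun_prop)
  · exact Eventually.of_forall fun x => ENNReal.ofReal_lt_top

/-- `Φ(z) = g + ∫ (1 + x z)/(z - x) ds` -/
noncomputable def Phi (g : ℝ) (s : Measure ℝ) (z : ℂ) : ℂ :=
  (g : ℂ) + ∫ x, (1 + (x : ℂ) * z) / (z - (x : ℂ)) ∂s

lemma bdd_frac : ∀ x : ℝ, |x / (1 + x^2)| ≤ 1 := by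
  intro x
  rw [abs_div, abs_of_nonneg (by positivity : (0:ℝ) ≤ 1 + x^2), div_le_one (by positivity),
    ← sq_abs x]
  nlinarith [sq_nonneg (|x| - 1), abs_nonneg x]

lemma Phi_eq {c : ℝ} (hc : 0 ≤ c) {z : ℂ} (hz : 0 < z.im) (m : Measure ℝ)
    [IsProbabilityMeasure m] :
    Phi (c * ∫ x, x / (1 + x^2) ∂m) (sg c m) z = c * z * (z * cauchyTransform m z - 1) := by
  have hfin := sg_fin c m
  have hcont : Continuous fun x : ℝ => x / (1 + x^2) :=
    Continuous.div (by fun_prop) (by fun_prop) (fun x => by positivity)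
  have hint1 : Integrable (fun x : ℝ => ((c * (x / (1 + x^2)) : ℝ) : ℂ)) m := by
    refine Integrable.ofReal (Integrable.const_mul ?_ c)
    exact Integrable.of_bound hcont.aestronglyMeasurable 1 (Eventually.of_forall bdd_frac)
  have hpt : ∀ x : ℝ, ((c * x^2 / (1 + x^2) : ℝ) : ℂ) * ((1 + (x : ℂ) * z) / (z - (x : ℂ)))
      = (c * z * z) * (z - (x : ℂ))⁻¹ - c * z - ((c * (x / (1 + x^2)) : ℝ) : ℂ) := by
    intro x
    have h1 := sub_ne hz.ne' x
    have h2 : (1 + (x : ℂ)^2) ≠ 0 := by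
      have : (1 + x^2 : ℝ) ≠ 0 := by positivity
      exact_mod_cast this
    push_cast
    field_simp
    ring
  rw [Phi, sg_int hc]
  simp only [hpt]
  have hint2 : Integrable (fun x : ℝ => (c * z * z) * (z - (x : ℂ))⁻¹ - c * z) m :=
    ((int_inv hz.ne' m).const_mul _).sub (integrable_const _)
  rw [integral_sub hint2 hint1,
    integral_sub ((int_inv hz.ne' m).const_mul _) (integrable_const _), integral_const_mul,
    integral_complex_ofReal, integral_const_mul c (fun x : ℝ => x / (1 + x^2))]
  simp [cauchyTransform]
  ring

lemma Phi_I (g : ℝ) (s : Measure ℝ) [IsFiniteMeasure s] :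
    Phi g s Complex.I = (g : ℂ) - Complex.I * (s.real Set.univ : ℂ) := by
  rw [Phi, nev (by simp)]
  simp
  ring

end BPB

/-- (Boolean part of the Bercovici–Pata limit theorem.) The Boolean convolution
powers `ρ_n = μ_n^{⊎ k_n}`, characterized by
`F_{ρ_n}(z) = z + k_n (F_{μ_n}(z) - z)` on `ℂ⁺`, converge weakly to the Boolean
infinitely divisible measure `ν = ν_⊎^{γ,σ}`, characterized by
`F_ν(z) = z - γ - ∫ (1+xz)/(z-x) dσ(x)`, iff `k_n x²/(1+x²) dμ_n → σ` weakly and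
`k_n ∫ x/(1+x²) dμ_n → γ`. -/
theorem bercovici_pata_boolean
    (σ : Measure ℝ) [IsFiniteMeasure σ] (γ : ℝ)
    (μ : ℕ → Measure ℝ) [∀ n, IsProbabilityMeasure (μ n)]
    (k : ℕ → ℕ) (hkmono : StrictMono k) (hkpos : ∀ n, 0 < k n)
    (ρ : ℕ → Measure ℝ) [∀ n, IsProbabilityMeasure (ρ n)]
    (hρ : ∀ n, ∀ z : ℂ, 0 < z.im →
      Ftransform (ρ n) z = z + (k n : ℂ) * (Ftransform (μ n) z - z))
    (ν : Measure ℝ) [IsProbabilityMeasure ν]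
    (hν : ∀ z : ℂ, 0 < z.im →
      Ftransform ν z = z - (γ : ℂ) - ∫ x, (1 + (x : ℂ) * z) / (z - (x : ℂ)) ∂σ) :
    WeakLim ρ ν ↔
      (WeakLim (fun n => (μ n).withDensity
            (fun x => ENNReal.ofReal ((k n : ℝ) * x^2 / (1 + x^2)))) σ ∧
        Tendsto (fun n => (k n : ℝ) * ∫ x, x / (1 + x^2) ∂(μ n)) atTop (𝓝 γ)) := by
  have hk : Tendsto (fun n => (k n : ℂ)) atTop (Bornology.cobounded ℂ) := by
    refine tendsto_norm_atTop_iff_cobounded.mp ?_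
    simp only [Complex.norm_natCast]
    exact tendsto_natCast_atTop_atTop.comp hkmono.tendsto_atTop
  set s : ℕ → Measure ℝ := fun n => BPB.sg (k n : ℝ) (μ n) with hs
  have hsfin : ∀ n, IsFiniteMeasure (s n) := fun n => BPB.sg_fin _ _
  set g : ℕ → ℝ := fun n => (k n : ℝ) * ∫ x, x / (1 + x^2) ∂(μ n) with hg
  change WeakLim ρ ν ↔ WeakLim s σ ∧ Tendsto g atTop (𝓝 γ)
  have hz0 : ∀ z : ℂ, 0 < z.im → z ≠ 0 := by
    rintro z hz rfl
    simp at hz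
  -- the fundamental relation
  have rel : ∀ n, ∀ z : ℂ, 0 < z.im →
      (z - Ftransform (ρ n) z) * (1 + BPB.Phi (g n) (s n) z * ((k n : ℂ)⁻¹ * z⁻¹))
        = BPB.Phi (g n) (s n) z ∧
      1 + BPB.Phi (g n) (s n) z * ((k n : ℂ)⁻¹ * z⁻¹) ≠ 0 := by
    intro n z hz
    have hkn : (k n : ℂ) ≠ 0 := by exact_mod_cast (hkpos n).ne'
    have hzz := hz0 z hz
    have hG := BPB.cauchy_ne hz (μ n)
    have hP := BPB.Phi_eq (c := (k n : ℝ)) (by positivity) hz (μ n)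
    change BPB.Phi (g n) (s n) z = _ at hP
    have h1 : 1 + BPB.Phi (g n) (s n) z * ((k n : ℂ)⁻¹ * z⁻¹) = z * cauchyTransform (μ n) z := by
      rw [hP]
      push_cast
      field_simp
      ring
    rw [h1]
    refine ⟨?_, mul_ne_zero hzz hG⟩
    rw [hρ n z hz, hP, Ftransform]
    push_cast
    field_simp
    ring
  have hνΦ : ∀ z : ℂ, 0 < z.im → Ftransform ν z = z - BPB.Phi γ σ z := by
    intro z hz
    rw [hν z hz, BPB.Phi]; ring
  have hk0 : ∀ z : ℂ, Tendsto (fun n => (k n : ℂ)⁻¹ * z⁻¹) atTop (𝓝 0) := by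
    intro z
    simpa using (tendsto_inv₀_cobounded.comp hk).mul_const z⁻¹
  constructor
  · intro hw
    have hΦ : ∀ z : ℂ, 0 < z.im →
        Tendsto (fun n => BPB.Phi (g n) (s n) z) atTop (𝓝 (BPB.Phi γ σ z)) := by
      intro z hz
      have hF : Tendsto (fun n => Ftransform (ρ n) z) atTop (𝓝 (Ftransform ν z)) :=
        (BPB.weak_cauchy hw hz).inv₀ (BPB.cauchy_ne hz ν)
      have hd : Tendsto (fun n => z - Ftransform (ρ n) z) atTop (𝓝 (BPB.Phi γ σ z)) := by
        have := hF.const_sub z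
        rw [hνΦ z hz, sub_sub_cancel] at this
        exact this
      have hden : Tendsto (fun n => 1 - (z - Ftransform (ρ n) z) * ((k n : ℂ)⁻¹ * z⁻¹)) atTop
          (𝓝 1) := by
        simpa using (hd.mul (hk0 z)).const_sub 1
      have hq := hd.div hden one_ne_zero
      rw [div_one] at hq
      refine hq.congr' ?_
      filter_upwards [hden.eventually_ne one_ne_zero] with n hn
      have h1 := (rel n z hz).1
      rw [Pi.div_apply, div_eq_iff hn]
      linear_combination h1
    have hI := hΦ Complex.I (by simp)
    simp only [BPB.Phi_I] at hI
    have hre : Tendsto g atTop (𝓝 γ) := by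
      simpa [Function.comp_def] using (Complex.continuous_re.tendsto _).comp hI
    have hmass : Tendsto (fun n => (s n).real Set.univ) atTop (𝓝 (σ.real Set.univ)) := by
      have := ((Complex.continuous_im.tendsto _).comp hI).neg
      simpa [Function.comp_def] using this
    refine ⟨BPB.weak_of_cauchy s σ hmass ?_, hre⟩
    intro z hz hzI
    have hne : 1 + z^2 ≠ 0 := by
      intro h0
      have h2 : (z - Complex.I) * (z + Complex.I) = 0 := by
        linear_combination h0 - Complex.I_sq
      rcases mul_eq_zero.mp h2 with h3 | h3
      · exact hzI (sub_eq_zero.mp h3)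
      · have := congrArg Complex.im h3
        simp at this
        linarith
    have e : ∀ (a : ℝ) (m : Measure ℝ), IsFiniteMeasure m → cauchyTransform m z
        = (1 + z^2)⁻¹ * (BPB.Phi a m z - (a : ℂ) + z * (m.real Set.univ : ℂ)) := by
      intro a m hm
      rw [BPB.Phi, BPB.nev hz]
      field_simp
      ring
    rw [e γ σ inferInstance]
    simp only [fun n => e (g n) (s n) (hsfin n)]
    exact (((hΦ z hz).sub ((Complex.continuous_ofReal.tendsto _).comp hre)).add
      (((Complex.continuous_ofReal.tendsto _).comp hmass).const_mul z)).const_mul _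
  · rintro ⟨hw, hγ⟩
    refine BPB.weak_of_cauchy_prob ρ ν ?_
    intro z hz _
    have hΦ : Tendsto (fun n => BPB.Phi (g n) (s n) z) atTop (𝓝 (BPB.Phi γ σ z)) := by
      simp only [BPB.Phi]
      refine ((Complex.continuous_ofReal.tendsto _).comp hγ).add ?_
      rw [BPB.nev hz]
      simp only [fun n => BPB.nev hz (s n)]
      exact (((Complex.continuous_ofReal.tendsto _).comp (BPB.weak_mass hw)).const_mul (-z)).add
        ((BPB.weak_cauchy hw hz).const_mul _)
    have hden : Tendsto (fun n => 1 + BPB.Phi (g n) (s n) z * ((k n : ℂ)⁻¹ * z⁻¹)) atTop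
        (𝓝 1) := by
      simpa using (hΦ.mul (hk0 z)).const_add 1
    have hq := (hΦ.div hden one_ne_zero).const_sub z
    rw [div_one, ← hνΦ z hz] at hq
    have hF : Tendsto (fun n => Ftransform (ρ n) z) atTop (𝓝 (Ftransform ν z)) := by
      refine hq.congr fun n => ?_
      obtain ⟨h1, h2⟩ := rel n z hz
      rw [Pi.div_apply, sub_eq_iff_eq_add, ← sub_eq_iff_eq_add', eq_comm, div_eq_iff h2]
      exact h1.symm
    have hne : Ftransform ν z ≠ 0 := inv_ne_zero (BPB.cauchy_ne hz ν)
    have := hF.inv₀ hne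
    simpa [Ftransform] using this
end
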